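/- arXiv:1106.5204 — 3 statements merged into one kernel-verified Lean document; each statement's English description precedes it below -/
import Mathlib

section
/- The additive structure of ℕ is not uniformly 3-repetitive for the sum morphism on {0,1,3,4}: for every R ∈ ℕ there exists a finite word u over the alphabet {0,1,3,4} with |u| ≥ R such that u contains no nonempty factor x₁x₂x₃ with |x₁|=|x₂|=|x₃| and Σx₁ = Σx₂ = Σx₃. -/
namespace AddCube

/-- Binary search trees with natural keys and natural values. -/
inductive Tr where
  | leaf : Tr
  | node : Tr → ℕ → ℕ → Tr → Tr

/-- Lookup with default value `0`. -/
noncomputable def Tr.get (t : Tr) (x : ℕ) : ℕ :=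
  Tr.rec 0 (fun _ k m _ l r => bif Nat.blt x k then l else bif Nat.blt k x then r else m) t

/-- All entries of the tree satisfy `p`. -/
noncomputable def Tr.all (t : Tr) (p : ℕ → ℕ → Bool) : Bool :=
  Tr.rec true (fun _ k m _ l r => p k m && (l && r)) t

/-- `List.all`, in a form convenient for evaluation. -/
noncomputable def all {α : Type} (l : List α) (p : α → Bool) : Bool :=
  List.rec true (fun h _ ih => p h && ih) l

/-- The finite set of difference vectors: for each pair of first two coordinates, a bit mask of the
pairs of last two coordinates. -/
def Dtree : Tr :=
  (.node (.node (.node (.node (.node (.node (.node .leaf 370 1688849860263936 .leaf) 371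
  66121202055200930529280 .leaf) 372 422246828998656 (.node .leaf 383
  950970130057811691557164679168 .leaf)) 384 1902056331146416026942435229696 (.node (.node (.node
  .leaf 385 541669620555865519034466816 .leaf) 386 66121778727042292908032 .leaf) 387
  422264004673536 (.node .leaf 395 563018672898048 .leaf))) 396
  21276735561835720351496394388879179776 (.node (.node (.node (.node .leaf 397
  42553471281257268298405586986197844480 .leaf) 398 5194515546972035623988466274009600 .leaf) 399
  634115477737218800208597484032 (.node .leaf 400 77387784773744278535929856 .leaf)) 408
  317028735278011672952982994944 (.node (.node (.node .leaf 409
  174299018368029770947908102672581386043904 .leaf) 410 31911208644170058274342163757370704384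
  .leaf) 411 21271543343924841831096621609689022976 (.node .leaf 412
  2596623943349019827179126435873280 .leaf)))) 413 158524031959706341719737892864 (.node (.node
  (.node (.node (.node .leaf 414 70368744177664 .leaf) 420 2306687468503564288 .leaf) 421
  304908956041479363179589379749203901677568 (.node .leaf 422
  130708310606480944609267780649620575617024 .leaf)) 423 87149509184648865536647745947856550232320
  (.node (.node (.node .leaf 424 10638692338940529942133244817139826688 .leaf) 425
  10635771671880213957364522630716063744 .leaf) 426 79228162514264337610723819520 (.node .leaf 432
  2305843009213693952 .leaf))) 433 1298549719041544891587220511653888 (.node (.node (.node (.node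
  .leaf 434 356964388290931458557445944745187570358419456 .leaf) 435
  356964389620159493956444255372819337784066048 .leaf) 436
  130687043120213301660032047226188176818432 (.node .leaf 437
  43574754592304548355850105784702420910336 .leaf)) 438 5317885816128228875517695443555319808
  (.node (.node (.node .leaf 439 324518553658426726783156020576256 .leaf) 445 1153062242095202304
  .leaf) 446 178482203449899400954776869822490586820640768 (.node .leaf 447
  535294127958213555047614086914991762658295808 .leaf))))) 448
  535283238922634364105488804279603627249631232 (.node (.node (.node (.node (.node (.node .leaf
  449 65354155303260201974007694666982325485568 .leaf) 450
  21787377215022672030502519692328542666752 .leaf) 451 2658780510123490172534397276581265408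
  (.node .leaf 458 89202980794771767415992238690817408495517696 .leaf)) 459
  1461769322516476168132604731880645752861617029120 (.node (.node (.node .leaf 460
  1461769322517140944409585895362449706077223124992 .leaf) 461
  178482205443984842895963715292701338740195328 .leaf) 462
  178438638667113549942239311640200212718288896 (.node .leaf 463
  32671760658348960640397644272140780830720 .leaf))) 464 162259276829213363391578010288128 (.node
  (.node (.node (.node .leaf 470 21778071482940061666378341358502810746880 .leaf) 471
  267641618796460082439877613268213561286459392 .leaf) 472
  267690620122072974559779822168558451826884608 (.node .leaf 473
  1461769327951025072307885445587068401479044825088 .leaf)) 474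
  267647064310196831893807466725045072031645696 (.node (.node (.node .leaf 475
  89241097072732706180613882426772151335387136 .leaf) 476
  10891029745722985033850706539985013571584 .leaf) 482 5316911983139663491615228241121378304
  (.node .leaf 483 2659429784982996775862637037860421632 .leaf)))) 484
  731018465729430565879366208642185870212916576256 (.node (.node (.node (.node (.node .leaf 485
  731018465729430647009007046413457336456959754240 .leaf) 486
  731018465729762954017856795696614883951936274432 .leaf) 487
  730840059762856498806971681782871950676960739328 (.node .leaf 488
  16335880329164574381442459939066066501632 .leaf)) 496
  89241101724949700409670878120656366200684544 (.node (.node (.node .leaf 497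
  730840059767841103949621433069567640628946272256 .leaf) 498
  731018465729761655943642155200297073109649850368 .leaf) 499
  730884661253253560063158268810505100415471714304 (.node .leaf 500
  133820809729968984128740351041044759256760320 .leaf))) 501
  5445182484732907873350445622438431555584 (.node (.node (.node (.node .leaf 509
  32671094908397447240102673734630589333504 .leaf) 510
  267641619460018870078651450219378969350766592 .leaf) 511
  730840059762524232382720366282900680464708665344 (.node .leaf 512
  133820809730009548947944112102609751073882112 .leaf)) 513
  44606937241364996988438277293027493828100096 (.node (.node .leaf 524
  89213873817547949951721319789452443447721984 .leaf) 525 5446512280705486333670102595416098865152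
  (.node .leaf 526 996920996838686904677855295210258432 .leaf))))))

/-- Search tree: vector code, bit mask of letter triples. -/
def Ftree : Tr :=
  (.node (.node (.node (.node (.node (.node (.node (.node .leaf 7521 16 .leaf) 9692 17867063967744
  (.node .leaf 9705 18037419538403392 .leaf)) 9706 274877906944 (.node (.node .leaf 9717
  409837461721583520 .leaf) 9718 22524251616580848 (.node .leaf 9719 343597383744 .leaf))) 9730
  648518346341353728 (.node (.node (.node .leaf 9731 328772668403746224 .leaf) 9732
  18019415031283792 (.node .leaf 9744 72057594037930256 .leaf)) 9860 4879087046736 (.node (.node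
  .leaf 9873 31526915387950304 .leaf) 9874 481040531520 (.node .leaf 9885 256 .leaf)))) 9886
  4503599627370896 (.node (.node (.node (.node .leaf 9887 68720525424 .leaf) 9900 16 (.node .leaf
  10029 68719476800 .leaf)) 10041 272 (.node (.node .leaf 10042 4503599627370640 .leaf) 10043
  68719476800 (.node .leaf 10056 16 .leaf))) 11720 17179869184 (.node (.node (.node .leaf 11733
  1231930842677252 .leaf) 11734 17179869184 (.node .leaf 11745 12745475775951577193 .leaf)) 11746
  6945026653557973103 (.node (.node .leaf 11747 105970806030340 .leaf) 11758 481897255017645728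
  .leaf)))) 11759 12745194575819223137 (.node (.node (.node (.node (.node .leaf 11771
  792633534601759488 .leaf) 11888 6918848913776599044 (.node .leaf 11889 105571369877504 .leaf))
  11901 17321291606710612077 (.node (.node .leaf 11902 4611950319176278020 .leaf) 11903
  70368744177664 (.node .leaf 11913 1130413402267586432 .leaf))) 11914 10876210348955834081 (.node
  (.node (.node .leaf 11915 17321010126902063201 .leaf) 11916 4611950314612867072 (.node .leaf
  11926 648518346341353728 .leaf)) 11927 1130413402269683600 (.node (.node .leaf 11928
  10732095160712206064 .leaf) 11929 5782785680332615776 (.node .leaf 11940 792633534568205056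
  .leaf)))) 11941 1130415601361096624 (.node (.node (.node (.node .leaf 12044 105829067915264
  .leaf) 12057 6935737975019954240 (.node .leaf 12058 105829067915264 .leaf)) 12069
  499912409447663344 (.node (.node .leaf 12070 12749698175446593760 .leaf) 12071
  4629894963121905728 (.node .leaf 12072 70643622084608 .leaf))) 12082 842173130511223680 (.node
  (.node (.node .leaf 12083 463883612428699376 .leaf) 12084 1157432182681153776 (.node .leaf 12085
  17660905537600 .leaf)) 12096 842173130478717856 (.node (.node .leaf 12097 319768424185071344
  .leaf) 12098 4879088095344 .leaf))))) 12109 72057594037929984 (.node (.node (.node (.node (.node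
  (.node .leaf 12110 112591090213719984 .leaf) 12213 4611879808425541632 (.node .leaf 12214
  70368744177664 .leaf)) 12226 5782785680329470016 (.node (.node .leaf 12227 88235808145408 .leaf)
  12238 1130415670080573424 (.node .leaf 12239 1463687127558558960 .leaf))) 12240 22333829959744
  (.node (.node (.node .leaf 12251 653021945985502080 .leaf) 12252 409837530441060320 (.node .leaf
  12253 18020651986064464 .leaf)) 12254 274877906944 (.node (.node .leaf 12265 112589990684264848
  .leaf) 12266 22519716124820976 (.node .leaf 12279 4503599627370896 .leaf)))) 12382
  17867063967744 (.node (.node (.node (.node .leaf 12395 4879087046720 .leaf) 12407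
  400830262458453936 (.node .leaf 12408 18020514543961200 .leaf)) 12409 274877906944 (.node (.node
  .leaf 12420 72057594037930240 .leaf) 12421 4504699138999696 (.node .leaf 12422 68719476800
  .leaf))) 12434 256 (.node (.node (.node .leaf 12435 16 .leaf) 12577 16 (.node .leaf 13929
  1794464717602816 .leaf)) 13930 25770065920 (.node (.node .leaf 13941 12110021178097674 .leaf)
  13942 6919393987810754566 .leaf)))) 13943 1231931381841926 (.node (.node (.node (.node (.node
  .leaf 13944 17179869184 .leaf) 13954 432356559595504128 (.node .leaf 13955 11541325069396017162
  .leaf)) 13956 6919394262957105158 (.node (.node .leaf 13967 720575940513497088 .leaf) 13968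
  432357659107132928 (.node .leaf 13981 792633534568204800 .leaf))) 14085 105579960074240 (.node
  (.node (.node .leaf 14097 11551458894906327054 .leaf) 14098 6919411872323035142 (.node .leaf
  14099 105579960074240 .leaf)) 14110 299787342999258635 (.node (.node .leaf 14111
  17325231947146453007 .leaf) 14112 4613076279752089606 (.node .leaf 14113 70385924046848
  .leaf)))) 14122 648518346341353472 (.node (.node (.node (.node .leaf 14123 1080873806358121984
  .leaf) 14124 10712109681464083497 (.node .leaf 14125 17324669340789891151 .leaf)) 14136
  648518346341353472 (.node (.node .leaf 14137 504413054054698752 .leaf) 14138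
  10727873036078318697 (.node .leaf 14150 648518346341353728 .leaf))) 14253 6946715477648302094
  (.node (.node (.node .leaf 14254 105996576096260 .leaf) 14266 12711698778746364011 (.node .leaf
  14267 6946715469057974286 .leaf)) 14268 105996576096260 (.node (.node .leaf 14278
  792633534568204800 .leaf) 14279 481897255019742881 .leaf)))))) 14280 12709446978899058793 (.node
  (.node (.node (.node (.node (.node (.node .leaf 14281 6935737979318132839 .leaf) 14282
  105829067915264 (.node .leaf 14292 792633534568205056 .leaf)) 14293 481897255019742880 (.node
  (.node .leaf 14294 12709165778800259169 .leaf) 14306 792633534601759488 (.node .leaf 14307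
  499912409447663344 .leaf))) 14410 70385924046848 (.node (.node (.node .leaf 14422
  17321289407620309103 .leaf) 14423 4611950318907834372 (.node .leaf 14424 70368744177664 .leaf))
  14435 10727591561101612129 (.node (.node .leaf 14436 8097917366470504553 .leaf) 14437
  123562992091140 (.node .leaf 14447 648518346341353728 .leaf)))) 14448 481897255019743152 (.node
  (.node (.node (.node .leaf 14449 10732095160695428320 .leaf) 14450 6935707187086913633 (.node
  .leaf 14461 792633534551427328 .leaf)) 14462 481897255019742896 (.node (.node .leaf 14463
  10443855988450694368 .leaf) 14475 792633534568205056 (.node .leaf 14579 70368744177664 .leaf)))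
  14592 4611880014588166208 (.node (.node (.node .leaf 14593 70368744177664 .leaf) 14604
  355797221237589744 (.node .leaf 14605 12713667179335168224 .leaf)) 14606 4611880014588166208
  (.node (.node .leaf 14617 1130413402270732208 .leaf) 14618 355801619233768688 .leaf)))) 14619
  1170941332228714608 (.node (.node (.node (.node (.node .leaf 14630 648518346341353472 .leaf)
  14631 1130413402235080608 (.node .leaf 15970 8590196736 .leaf)) 15983 131072 (.node (.node .leaf
  16125 8590327808 .leaf) 16138 562949954076672 (.node .leaf 16139 25770196992 .leaf))) 16140
  25770065920 (.node (.node (.node .leaf 16151 33554432 .leaf) 16152 1688892810854400 (.node .leaf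
  16153 26307067904 .leaf)) 16165 2821346938191872 (.node (.node .leaf 16178 432356559578726400
  .leaf) 16281 25770196992 (.node .leaf 16294 1688909990723584 .leaf)))) 16295 35211752898560
  (.node (.node (.node (.node .leaf 16306 144117387333992448 .leaf) 16307 3947281171283970 (.node
  .leaf 16308 2307567111629635590 .leaf)) 16309 105579960074240 (.node (.node .leaf 16319
  144115188210073600 .leaf) 16320 434612757438922752 (.node .leaf 16321 2309790296829526022
  .leaf))) 16322 6919464511167463430 (.node (.node (.node .leaf 16333 1008815112791785472 .leaf)
  16334 435458281898051082 (.node .leaf 16346 576460752303423488 .leaf)) 16347 1008816212320192000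
  (.node (.node .leaf 16450 1161146019479552 .leaf) 16451 17179869184 .leaf))))) 16462
  2821346938191872 (.node (.node (.node (.node (.node (.node .leaf 16463 2307532046449180678
  .leaf) 16464 1231514763657216 (.node .leaf 16465 17179869184 .leaf)) 16475 432356559578726400
  (.node (.node .leaf 16476 12110021180194826 .leaf) 16477 6919394262688661510 (.node .leaf 16478
  105997112967172 .leaf))) 16488 720575940547051520 (.node (.node (.node .leaf 16489
  432357659107132928 .leaf) 16490 11559340155607777290 (.node .leaf 16491 6919411855143165958
  .leaf)) 16502 792633534568204800 (.node (.node .leaf 16503 477675130365937160 .leaf) 16516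
  792633534601759232 (.node .leaf 16619 6919464648612708358 .leaf)))) 16620 105579960074240 (.node
  (.node (.node (.node .leaf 16631 291343093687977482 .leaf) 16632 16145268512325050382 (.node
  .leaf 16633 4613076279752089606 .leaf)) 16634 70385924046848 (.node (.node .leaf 16644
  1080873806358121984 .leaf) 16645 9523159379838305323 (.node .leaf 16646 17325229748056088591
  .leaf))) 16647 4613076279481352196 (.node (.node (.node .leaf 16657 792633534568204800 .leaf)
  16658 1080876005448486400 (.node .leaf 16659 12999938913059513449 .leaf)) 16671
  648518346358131200 (.node (.node .leaf 16672 544945450701033344 .leaf) 16789 105854837981184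
  .leaf)))) 16801 12712824717844783215 (.node (.node (.node (.node (.node .leaf 16802
  6936863862044057606 .leaf) 16813 792633534601759232 (.node .leaf 16814 482178729996453545
  .leaf)) 16815 12709447258608803949 (.node (.node .leaf 16826 72057594037930240 .leaf) 16827
  792634634113388288 (.node .leaf 16840 256 .leaf))) 18504 131072 (.node (.node (.node .leaf 18505
  8590196736 .leaf) 18518 8590327808 (.node .leaf 18519 25770065920 .leaf)) 18531 565149044441088
  (.node (.node .leaf 18660 25770196992 .leaf) 18673 1688892810854400 (.node .leaf 18674
  25770196992 .leaf)))) 18675 17179869184 (.node (.node (.node (.node .leaf 18686 565149077864448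
  .leaf) 18687 1688892810854400 (.node .leaf 18699 144115188243628032 .leaf)) 18816 25770196992
  (.node (.node .leaf 18828 569547090952192 .leaf) 18829 1125960573648896 (.node .leaf 18830
  105579960074240 .leaf))) 18841 288241371368652800 (.node (.node (.node .leaf 18842
  1693290859528194 .leaf) 18843 4613550856184135684 (.node .leaf 18854 144115188243628032 .leaf))
  18855 291060519182794752 (.node (.node .leaf 18868 432356559578726400 .leaf) 21039 131072
  .leaf)))))))

/-- Codes of the four-position states. -/
def Blist : List ℕ :=
  [407865360, 1223598109, 2039326790, 2855057510, 2855057523, 4544438645, 5360171550, 6175902283,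
  6180728923, 6933368408, 7749099129, 9380560571, 11012362524, 11012364733, 11827724162,
  12643826175, 16664556044, 16722479780, 17480288793, 17538210501, 18296017305, 18353941222,
  19111748038, 19111748207, 19111752431, 19169671930, 19169671943, 19169672099, 19864389720,
  19927136027, 19985402676, 20680120441, 20680122481, 20801135425, 20805588745, 20805590954,
  20805962234, 21495851149, 21495851162, 21616864106, 21621692955, 22311581882, 22311581883,
  22374328190, 22374670922, 22374675159, 22432594839, 22437052396, 22437423676, 23185205739,
  23190401631, 23195228453, 23253150148, 24821863073, 24821867297, 24879758430, 24884587267,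
  25632397902, 25700318000, 26511591152, 27327326110, 28896065555, 29711420759, 29774514048,
  29774538372, 30590244769, 32221706211, 37053368372, 37053372609, 42762769575, 42762771772,
  42763141037, 42825889203, 43578502324, 43578502493, 43578871589, 43641593573, 44394233214,
  44457324294, 45209963935, 46904547058, 49351708620, 50167439341, 50167441369, 51798900783,
  52672553212, 53488285961, 54304014642, 55119745375, 57566933301, 59261147509, 60076878230,
  61645219862, 61708339672, 63281877185, 64034490306, 64092754746, 64908514027, 65608403360,
  67239862762, 67239864802, 67297786497, 68055595523, 68113515190, 68113517230, 68118341830,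
  68929243896, 68929245924, 69744976645, 70560705157, 70560707366, 70565529769, 70565531978,
  71376435890, 71376436059, 71376438074, 71376438087, 71376438243, 71376440283, 72192168820,
  73007901569, 73012728378, 73075103406, 73760539001, 73760881733, 73823630250, 73828454862,
  73828459099, 74576269734, 74576612466, 74639358774, 74639360983, 74639363011, 74644189820,
  75397167788, 75455089483, 75455091692, 75459916292, 77028633454, 77086181842, 77086550925,
  77086555149, 77091010679, 77149275119, 77839164046, 77844364175, 77902283842, 77902283855,
  77906741399, 77906741412, 77907110482, 77965005852, 78718357296, 79534092254, 81102831699,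
  81976482100, 81981304516, 82039201900, 82039202069, 82039568956, 82039573349, 82792215018,
  82854932621, 82854932790, 83607945739, 84423672235, 84423674263, 84486394063, 84486394219,
  84486394232, 84486765512, 85996840352, 85996868912, 85996871109, 85996873149, 86059588869,
  86059591065, 86059593105, 86117853309, 86117855505, 86117857545, 86812573269, 86812601830,
  86875321786, 86933586226, 88565047669, 89260136713, 89380778377, 89380778390, 89381147473,
  89381151710, 91012239832, 91706614863, 91769706112, 92522347781, 93338078502, 93338447585,
  96659661611, 98232458447, 98353471404, 99048193405, 99110937685, 99110941909, 99111313202,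
  99169206362, 99863550793, 100679652806, 100800294470, 101558474764, 101616396472, 102374205485,
  102432129221, 103189564914, 104005666927, 104063588635, 104821054916, 105636787665,
  106452516346, 107268247079, 108899706493, 108957601668, 108957970933, 109715435005,
  109715439398, 109778526254, 110531170131, 115425523532, 115488643329, 117877546728,
  118567808976, 119383537657, 119383539866, 119509006130, 120324738891, 121072918791,
  121136012068, 121825903192, 121888651540, 121888994441, 121951742789, 122704727346,
  122767473510, 122834675346, 123520113138, 123520458079, 123583204231, 123583204387,
  125281869550, 127661857836, 127666682436, 128424122210, 129297776823, 130109049999,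
  130113507543, 130113507556, 134187699367, 134187703604, 134188070660, 134245968213,
  134940685977, 135003432116, 135003432128, 135003434325, 135061698934, 136634895767,
  136693160363, 136693160376, 138266355012, 138266355013, 138266357209, 138266359249,
  139082087930, 141529649164, 143976500804, 144792231525, 144792233565, 147176301863,
  147239423700, 147296943527, 147297345577, 147992034612, 148055154409, 148112676276,
  148113045541, 148113076286, 148113078326, 148928807007, 149744537740, 154581000177,
  157027792499, 157028163792, 157843896541, 158659625222, 159474984649, 159474984662,
  159475355942, 159475355955, 161101619464, 161106446104, 161164710544, 161164737077,
  161980469982, 162796200715, 162801027355, 163616384600, 164432115321, 166063576763,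
  170079828964, 170084655604, 171716115006, 172527021127, 172531847767, 173280027667,
  173284854476, 173342406919, 173342778212, 173347233728, 173405496140, 174095760416,
  174100587225, 174158137640, 174158508933, 174162964449, 174221228889, 174974239654,
  174978692961, 174978695170, 175041784222, 175727222014, 175732046639, 175732050863,
  175789599069, 175789599082, 175789970362, 175789970375, 175789970531, 175794423694,
  175794425891, 175852688303, 175852692527, 176605701108, 177367965469, 177421433857,
  177425887177, 177425889373, 177425889386, 177426260666, 178237162538, 178241620094,
  178241991387, 179052893271, 179057350815, 179057350828, 179057722108, 179873448580,
  181504885699, 182320616419, 182320616432, 183131889584, 183947622332, 183947624542,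
  185516363987, 186331719191, 186331719203, 186394808243, 186394812480, 186394836804,
  186452732160, 186452734357, 186453105637, 187147451952, 187210540992, 187210541004,
  187210543201, 187268464909, 187268465078, 188842004643, 188899926507, 188899926520,
  188900297800, 193736386760, 193736390984, 196183238400, 196998971149, 199446187635,
  199504454453, 200256694072, 200261520712, 200261892005, 200261918356, 200319811685,
  200319813869, 200320185162, 200320187202, 201077622726, 201135544590, 201135915883,
  201951275323, 201951646616, 203524845490, 205972007052, 206787737773, 206787739801, 208419199215]

/-- The `i`-th binary digit of `m` is one. -/
noncomputable def bit (m i : ℕ) : Bool := Nat.beq (Nat.land 1 (Nat.shiftRight m i)) 1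

/-- Distance of two natural numbers, squared. -/
noncomputable def dsq (m n : ℕ) : ℕ := (m - n + (n - m)) ^ 2

/-! All vectors below are given by coordinates shifted by `32`. -/

/-- A vector that is certainly too long in the contracting direction. -/
noncomputable def big (a b c d : ℕ) : Bool :=
  Nat.blt 30250000
    (dsq (1000 * a + 444 * d) (469 * b + 593 * c + 12224) +
      dsq (477 * c + 11104) (88 * b + 736 * d))

noncomputable def code (a b c d : ℕ) : ℕ := ((a * 13 + b) * 13 + c) * 13 + d - 61880

noncomputable def inD (a b c d : ℕ) : Bool :=
  Nat.ble 26 a && Nat.ble a 38 && Nat.ble 26 b && Nat.ble b 38 && Nat.ble 26 c && Nat.ble c 38 &&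
    Nat.ble 26 d && Nat.ble d 38 && bit (Dtree.get (a * 13 + b)) (c * 13 + d - 364)

noncomputable def inF (l m n : ℕ) (a b c d : ℕ) : Bool :=
  inD a b c d && bit (Ftree.get (code a b c d)) (l * 16 + m * 4 + n)

noncomputable def codeB (k l m n : ℕ) (a b c d a' b' c' d' : ℕ) : ℕ :=
  (((k * 4 + l) * 4 + m) * 4 + n) * 815730721 + code a b c d * 28561 + code a' b' c' d'

noncomputable def inB (k l m n : ℕ) (a b c d a' b' c' d' : ℕ) : Bool :=
  inD a b c d && inD a' b' c' d' &&
    Blist.any (Nat.beq (codeB k l m n a b c d a' b' c' d'))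

/-- One way in which a letter `c` arises in the image of a letter `a`: it is preceded there by a
word with `x` occurrences of the first and `y` occurrences of the last letter. -/
structure Op where
  a : ℕ
  c : ℕ
  x : ℕ
  y : ℕ

noncomputable def T : List Op :=
  [⟨0, 0, 0, 0⟩, ⟨0, 2, 1, 0⟩, ⟨1, 3, 0, 0⟩, ⟨1, 2, 0, 1⟩, ⟨2, 1, 0, 0⟩, ⟨3, 0, 0, 0⟩,
    ⟨3, 1, 1, 0⟩]

/-- The elements of `T` with first entry `l` (for `l < 4`). -/
noncomputable def kids (l : ℕ) : List Op :=
  bif Nat.beq l 0 then [⟨0, 0, 0, 0⟩, ⟨0, 2, 1, 0⟩] else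
  bif Nat.beq l 1 then [⟨1, 3, 0, 0⟩, ⟨1, 2, 0, 1⟩] else
  bif Nat.beq l 2 then [⟨2, 1, 0, 0⟩] else [⟨3, 0, 0, 0⟩, ⟨3, 1, 1, 0⟩]

noncomputable def rng : List ℕ := [26, 27, 28, 29, 30, 31, 32, 33, 34, 35, 36, 37, 38]

noncomputable def letters : List ℕ := [0, 1, 2, 3]

noncomputable def allD (p : ℕ → ℕ → ℕ → ℕ → Bool) : Bool :=
  all rng fun a => all rng fun b => Nat.beq (Dtree.get (a * 13 + b)) 0 || all rng fun c => all rng fun d =>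
    !bit (Dtree.get (a * 13 + b)) (c * 13 + d - 364) || p a b c d

/-- All differences of offsets, shifted by `2`. -/
noncomputable def Eset : List (ℕ × ℕ) :=
  [(2, 2), (3, 2), (2, 3), (0, 2), (1, 2), (0, 3), (2, 0), (3, 0), (2, 1),
   (4, 2), (3, 3), (1, 3), (4, 0), (3, 1), (2, 4), (0, 4)]

noncomputable def goodPar (a b c d : ℕ) : Bool := inD a b c d || big a b c d

noncomputable def par3 (p : ℕ → ℕ → ℕ → ℕ → Bool) (a b c d f g : ℕ) : Bool :=
  p (c + 30 + g - d) (d + 2 - g) (b + c + f + g + 28 - a - d) (a + d + 4 - (c + f + g))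

noncomputable def check1 : Bool := allD fun a b c d => all Eset fun e => par3 goodPar a b c d e.1 e.2

noncomputable def goodKid (l m n : ℕ) (a b c d : ℕ) : Bool := !inD a b c d || inF l m n a b c d

noncomputable def kid3 (p : ℕ → ℕ → ℕ → ℕ → Bool) (a b c d f g : ℕ) : Bool :=
  p (a + d + f - 34) (c + d - 32) (a + b - 32) (b + g - 2)

noncomputable def dig (m i : ℕ) : ℕ := m / 13 ^ i % 13 + 26

noncomputable def kids2 (a b c d mask : ℕ) : Bool :=
  all letters fun l => all letters fun m => all letters fun n =>
    !bit mask (l * 16 + m * 4 + n) ||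
    all (kids l) fun t => all (kids m) fun u => all (kids n) fun v =>
      kid3 (goodKid t.c u.c v.c) a b c d (t.x + v.x + 2 - 2 * u.x) (t.y + v.y + 2 - 2 * u.y)

noncomputable def check2 : Bool := Ftree.all fun k mask => kids2 (dig k 3) (dig k 2) (dig k 1) (dig k 0) mask

noncomputable def ker3 (a b c d : ℕ) : Bool :=
  !(Nat.beq (a + b + c + d) 128 && Nat.beq (b + 3 * c + 4 * d) 256) ||
    (Nat.beq a 32 && Nat.beq b 32 && Nat.beq c 32 && Nat.beq d 32)

noncomputable def check3 : Bool := Ftree.all fun k _ => ker3 (dig k 3) (dig k 2) (dig k 1) (dig k 0)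

noncomputable def check4 : Bool :=
  all Blist fun s =>
    all T fun t => !Nat.beq t.c (s / 815730721 / 64 % 4) ||
    all T fun u => !Nat.beq u.c (s / 815730721 / 16 % 4) ||
    all T fun v => !Nat.beq v.c (s / 815730721 / 4 % 4) ||
      par3 (fun a0 a1 a2 a3 => !inF t.a u.a v.a a0 a1 a2 a3 ||
       all T fun w => !Nat.beq w.c (s / 815730721 % 4) ||
         par3 (fun b0 b1 b2 b3 =>
           !inF u.a v.a w.a b0 b1 b2 b3 || inB t.a u.a v.a w.a a0 a1 a2 a3 b0 b1 b2 b3)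
           (dig s 3) (dig s 2) (dig s 1) (dig s 0)
           (u.x + w.x + 2 - 2 * v.x) (u.y + w.y + 2 - 2 * v.y))
        (dig s 7) (dig s 6) (dig s 5) (dig s 4)
        (t.x + v.x + 2 - 2 * u.x) (t.y + v.y + 2 - 2 * u.y)

noncomputable def check5 : Bool :=
  all letters fun k => all letters fun l => all letters fun m => all letters fun n =>
    !inF k l m 32 32 32 32 || !inF l m n 32 32 32 32 || inB k l m n 32 32 32 32 32 32 32 32

noncomputable def check6 : Bool :=
  all T fun t => all T fun u => !Nat.beq t.a u.a || all T fun v => !Nat.beq t.a v.a ||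
    all T fun w => !Nat.beq t.a w.a ||
    (Nat.beq t.c u.c && Nat.beq t.c v.c && Nat.beq t.c w.c) ||
    !inB t.c u.c v.c w.c (t.x + v.x + 32 - 2 * u.x) 32 32 (t.y + v.y + 32 - 2 * u.y)
      (u.x + w.x + 32 - 2 * v.x) 32 32 (u.y + w.y + 32 - 2 * v.y)

noncomputable def check7 : Bool :=
  all rng fun c => all [29, 30, 31, 32, 33, 34, 35] fun d =>
    goodPar (2 * c + 3 * d - 128) (256 - (3 * c + 4 * d)) c d

theorem check1_true : check1 = true := by decide +kernel
theorem check2_true : check2 = true := by decide +kernel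
theorem check3_true : check3 = true := by decide +kernel
theorem check4_true : check4 = true := by decide +kernel
theorem check5_true : check5 = true := by decide +kernel
theorem check6_true : check6 = true := by decide +kernel
theorem check7_true : check7 = true := by decide +kernel

theorem inF_zero : inF 0 0 0 32 32 32 32 = true := by decide +kernel
/-! ### The contracting eigenvalue -/

lemma exists_real_root (f : ℝ → ℝ) (hf : Continuous f) (a b : ℝ) (hab : a ≤ b)
    (h : f a ≤ 0 ∧ 0 ≤ f b ∨ f b ≤ 0 ∧ 0 ≤ f a) : ∃ x, a ≤ x ∧ x ≤ b ∧ f x = 0 := by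
  rcases h with h | h
  · obtain ⟨x, hx, h0⟩ := intermediate_value_Icc hab hf.continuousOn (show (0 : ℝ) ∈ _ from h)
    exact ⟨x, hx.1, hx.2, h0⟩
  · obtain ⟨x, hx, h0⟩ := intermediate_value_Icc' hab hf.continuousOn (show (0 : ℝ) ∈ _ from h)
    exact ⟨x, hx.1, hx.2, h0⟩

lemma exists_mu : ∃ z : ℂ, z ^ 4 - z ^ 3 - 2 * z ^ 2 + 2 * z - 1 = 0 ∧
    0.40738 ≤ z.re ∧ z.re ≤ 0.4074 ∧ 0.47655 ≤ z.im ∧ z.im ≤ 0.47658 := by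
  have hc : Continuous (fun t : ℝ => t ^ 4 - t ^ 3 - 2 * t ^ 2 + 2 * t - 1) := by fun_prop
  obtain ⟨p, hp1, hp2, hp⟩ := exists_real_root _ hc 1.690284 1.690285 (by norm_num) (by norm_num)
  obtain ⟨q, hq1, hq2, hq⟩ := exists_real_root _ hc (-1.505069) (-1.505068) (by norm_num) (by norm_num)
  have hne : p - q ≠ 0 := by
    have : 0 < p - q := by linarith
    exact this.ne'
  have hα : p ^ 3 + p ^ 2 * q + p * q ^ 2 + q ^ 3 - (p ^ 2 + p * q + q ^ 2) - 2 * (p + q) + 2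
      = 0 := by
    apply mul_left_cancel₀ hne
    linear_combination hp - hq
  set c : ℝ := p ^ 2 + p * q + q ^ 2 - (p + q) - 2 with hcdef
  set x : ℝ := (1 - (p + q)) / 2 with hx
  have hx1 : 0.407390 ≤ x := by rw [hx]; linarith
  have hx2 : x ≤ 0.407394 := by rw [hx]; linarith
  have hc1 : 0.393075 ≤ c := by rw [hcdef]; nlinarith
  have hc2 : c ≤ 0.393092 := by rw [hcdef]; nlinarith
  have hpos : 0 ≤ c - x ^ 2 := by nlinarith
  have hy0 : 0 ≤ √(c - x ^ 2) := Real.sqrt_nonneg _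
  have hy : √(c - x ^ 2) ^ 2 = c - x ^ 2 := Real.sq_sqrt hpos
  set y : ℝ := √(c - x ^ 2) with hydef
  refine ⟨⟨x, y⟩, ?_, by simp only; linarith, by simp only; linarith, ?_, ?_⟩
  · have hq0 : (⟨x, y⟩ : ℂ) ^ 2 + ((p : ℂ) + q - 1) * ⟨x, y⟩ + (c : ℂ) = 0 := by
      apply Complex.ext
      · simp [pow_two]
        linear_combination (-1 : ℝ) * hy + 2 * x * hx
      · simp [pow_two]
        linear_combination 2 * y * hx
    have hα' : (p : ℂ) ^ 3 + p ^ 2 * q + p * q ^ 2 + q ^ 3 - (p ^ 2 + p * q + q ^ 2)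
        - 2 * (p + q) + 2 = 0 := by exact_mod_cast congrArg (Complex.ofReal) hα
    have hp' : (p : ℂ) ^ 4 - p ^ 3 - 2 * p ^ 2 + 2 * p - 1 = 0 := by
      exact_mod_cast congrArg (Complex.ofReal) hp
    have hc' : (c : ℂ) = p ^ 2 + p * q + q ^ 2 - (p + q) - 2 := by
      exact_mod_cast congrArg (Complex.ofReal) hcdef
    rw [hc'] at hq0
    generalize (⟨x, y⟩ : ℂ) = z at *
    linear_combination (z - p) * (z - q) * hq0 + (z - p) * hα' + hp'
  · simp only
    by_contra! h
    nlinarith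
  · simp only
    by_contra! h
    nlinarith

lemma norm_le_of (w : ℂ) (a b r : ℝ) (h1 : |w.re| ≤ a) (h2 : |w.im| ≤ b) (hr : 0 ≤ r)
    (h : a ^ 2 + b ^ 2 ≤ r ^ 2) : ‖w‖ ≤ r := by
  apply abs_le_of_sq_le_sq' _ hr |>.2
  rw [Complex.sq_norm, Complex.normSq_apply]
  have h3 := sq_le_sq' (by linarith [abs_nonneg w.re]) h1
  have h4 := sq_le_sq' (by linarith [abs_nonneg w.im]) h2
  rw [sq_abs] at h3 h4
  nlinarith

/-- The weights of the letters in the contracting direction, and their properties. -/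
lemma exists_weights : ∃ z u v w : ℂ, ‖z‖ ≤ 0.628 ∧ ‖w‖ ≤ 1 ∧ ‖1 - w‖ ≤ 1 ∧
    1 + v = z ∧ w + v = z * u ∧ u = z * v ∧ 1 + u = z * w ∧
    ‖u - ⟨-0.469, -0.088⟩‖ ≤ 0.001 ∧ ‖v - ⟨-0.593, 0.477⟩‖ ≤ 0.001 ∧
    ‖w - ⟨0.444, -0.736⟩‖ ≤ 0.001 := by
  obtain ⟨z, hz, h1, h2, h3, h4⟩ := exists_mu
  have k1 : 0.40738 * 0.40738 ≤ z.re * z.re := by nlinarith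
  have k2 : z.re * z.re ≤ 0.4074 * 0.4074 := by nlinarith
  have k3 : 0.47655 * 0.47655 ≤ z.im * z.im := by nlinarith
  have k4 : z.im * z.im ≤ 0.47658 * 0.47658 := by nlinarith
  have k5 : 0.40738 * 0.47655 ≤ z.re * z.im := by nlinarith
  have k6 : z.re * z.im ≤ 0.4074 * 0.47658 := by nlinarith
  have e1 : (z ^ 2 - z).re = z.re * z.re - z.im * z.im - z.re := by simp [pow_two]
  have e2 : (z ^ 2 - z).im = 2 * (z.re * z.im) - z.im := by simp [pow_two]; ring
  have e3 : (z ^ 3 - z ^ 2 - z + 1).re = (z.re * z.re) * z.re - 3 * (z.re * (z.im * z.im))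
      - (z.re * z.re - z.im * z.im) - z.re + 1 := by simp [pow_succ]; ring
  have e4 : (z ^ 3 - z ^ 2 - z + 1).im = 3 * ((z.re * z.re) * z.im) - (z.im * z.im) * z.im
      - 2 * (z.re * z.im) - z.im := by simp [pow_succ]; ring
  have w1 : 0.4435 ≤ (z ^ 3 - z ^ 2 - z + 1).re := by rw [e3]; nlinarith
  have w2 : (z ^ 3 - z ^ 2 - z + 1).re ≤ 0.4441 := by rw [e3]; nlinarith
  have w3 : -0.7361 ≤ (z ^ 3 - z ^ 2 - z + 1).im := by rw [e4]; nlinarith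
  have w4 : (z ^ 3 - z ^ 2 - z + 1).im ≤ -0.7355 := by rw [e4]; nlinarith
  refine ⟨z, z ^ 2 - z, z - 1, z ^ 3 - z ^ 2 - z + 1, ?_, ?_, ?_, by ring, by ring, by ring,
    by linear_combination (-1 : ℂ) * hz, ?_, ?_, ?_⟩
  · apply norm_le_of _ 0.4074 0.47658 <;> try norm_num
    · rw [abs_le]; constructor <;> linarith
    · rw [abs_le]; constructor <;> linarith
  · apply norm_le_of _ 0.4441 0.7361
    · rw [abs_le]; constructor <;> linarith
    · rw [abs_le]; constructor <;> linarith
    all_goals norm_num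
  · apply norm_le_of _ 0.5565 0.7361
    · rw [Complex.sub_re, Complex.one_re, abs_le]; constructor <;> linarith
    · rw [Complex.sub_im, Complex.one_im, abs_le]; constructor <;> linarith
    all_goals norm_num
  · apply norm_le_of _ 0.0006 0.0006
    · rw [Complex.sub_re, e1, abs_le]; constructor <;> simp only <;> linarith
    · rw [Complex.sub_im, e2, abs_le]; constructor <;> simp only <;> linarith
    all_goals norm_num
  · apply norm_le_of _ 0.0006 0.0006
    · rw [Complex.sub_re, Complex.sub_re, Complex.one_re, abs_le]
      constructor <;> simp only <;> linarith
    · rw [Complex.sub_im, Complex.sub_im, Complex.one_im, abs_le]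
      constructor <;> simp only <;> linarith
    all_goals norm_num
  · apply norm_le_of _ 0.0006 0.0006
    · rw [Complex.sub_re, abs_le]; constructor <;> simp only <;> linarith
    · rw [Complex.sub_im, abs_le]; constructor <;> simp only <;> linarith
    all_goals norm_num

/-! ### What the checks mean -/

attribute [irreducible] Dtree Ftree Blist

lemma beq_iff {a b : ℕ} : Nat.beq a b = true ↔ a = b :=
  ⟨Nat.eq_of_beq_eq_true, fun h => h ▸ Nat.beq_refl a⟩

lemma beq_iff' {a b : ℕ} : Nat.beq a b = false ↔ a ≠ b := by
  rw [← Bool.not_eq_true, beq_iff]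

lemma all_spec {α : Type} {l : List α} {p : α → Bool} (h : all l p = true) :
    ∀ x ∈ l, p x = true := by
  induction l with
  | nil => simp
  | cons y l ih =>
    have h' : (p y && all l p) = true := h
    rw [Bool.and_eq_true] at h'
    intro x hx
    rcases List.mem_cons.1 hx with rfl | hx
    · exact h'.1
    · exact ih h'.2 x hx

lemma Tr.all_spec {p : ℕ → ℕ → Bool} (x : ℕ) : ∀ t : Tr, t.all p = true → t.get x ≠ 0 →
    p x (t.get x) = true := by
  intro t
  induction t with
  | leaf => intro _ h; exact absurd rfl h
  | node l k m r ihl ihr =>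
    intro h h0
    have h' : (p k m && (l.all p && r.all p)) = true := h
    have e : (Tr.node l k m r).get x =
      bif Nat.blt x k then l.get x else bif Nat.blt k x then r.get x else m := rfl
    simp only [Bool.and_eq_true] at h'
    rw [e] at h0 ⊢
    cases h1 : Nat.blt x k with
    | true => simp only [h1, cond_true] at h0 ⊢; exact ihl h'.2.1 h0
    | false =>
      cases h2 : Nat.blt k x with
      | true => simp only [h1, h2, cond_true, cond_false] at h0 ⊢; exact ihr h'.2.2 h0
      | false =>
        simp only [cond_false]
        have h3 : ¬ x < k := by rw [← Nat.blt_eq]; simp [h1]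
        have h4 : ¬ k < x := by rw [← Nat.blt_eq]; simp [h2]
        obtain rfl : x = k := by omega
        exact h'.1

lemma mem_rng {a : ℕ} (h1 : 26 ≤ a) (h2 : a ≤ 38) : a ∈ rng := by
  unfold rng; interval_cases a <;> simp

lemma mem_letters {a : ℕ} (h : a < 4) : a ∈ letters := by
  unfold letters; interval_cases a <;> simp

lemma inD_bounds {a b c d : ℕ} (h : inD a b c d = true) : 26 ≤ a ∧ a ≤ 38 ∧ 26 ≤ b ∧ b ≤ 38 ∧
    26 ≤ c ∧ c ≤ 38 ∧ 26 ≤ d ∧ d ≤ 38 := by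
  simp only [inD, Bool.and_eq_true, Nat.ble_eq] at h
  tauto

lemma allD_spec {p : ℕ → ℕ → ℕ → ℕ → Bool} (h : allD p = true) {a b c d : ℕ}
    (hd : inD a b c d = true) : p a b c d = true := by
  have hb := inD_bounds hd
  have h1 := all_spec h a (mem_rng (by omega) (by omega))
  have h2 := all_spec h1 b (mem_rng (by omega) (by omega))
  simp only [inD, Bool.and_eq_true] at hd
  have hbit := hd.2
  simp only [Bool.or_eq_true] at h2
  rcases h2 with h2 | h2
  · rw [beq_iff] at h2
    rw [h2] at hbit
    simp [bit] at hbit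
  · have h3 := all_spec h2 c (mem_rng (by omega) (by omega))
    have h4 := all_spec h3 d (mem_rng (by omega) (by omega))
    rw [hbit] at h4
    simpa using h4

lemma inF_inD {l m n a b c d : ℕ} (h : inF l m n a b c d = true) : inD a b c d = true := by
  simp only [inF, Bool.and_eq_true] at h
  exact h.1

lemma inB_inD {k l m n a b c d a' b' c' d' : ℕ} (h : inB k l m n a b c d a' b' c' d' = true) :
    inD a b c d = true ∧ inD a' b' c' d' = true := by
  simp only [inB, Bool.and_eq_true] at h
  exact h.1

lemma code_eq {a b c d : ℕ} (h : inD a b c d = true) :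
    ((a * 13 + b) * 13 + c) * 13 + d = code a b c d + 61880 := by
  have := inD_bounds h
  unfold code
  refine (Nat.sub_add_cancel ?_).symm
  omega

lemma dig_code {a b c d : ℕ} (h : inD a b c d = true) :
    dig (code a b c d) 3 = a ∧ dig (code a b c d) 2 = b ∧ dig (code a b c d) 1 = c ∧
      dig (code a b c d) 0 = d := by
  have hb := inD_bounds h
  have hc := code_eq h
  generalize code a b c d = k at *
  simp only [dig]
  norm_num
  clear h
  omega

lemma inF_get {l m n a b c d : ℕ} (h : inF l m n a b c d = true) :
    Ftree.get (code a b c d) ≠ 0 := by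
  intro h0
  simp only [inF, Bool.and_eq_true, h0] at h
  simp [bit] at h

lemma Eset_mem : ∀ t ∈ T, ∀ u ∈ T, ∀ v ∈ T,
    (t.x + v.x + 2 - 2 * u.x, t.y + v.y + 2 - 2 * u.y) ∈ Eset := by
  decide

lemma T_xy : ∀ t ∈ T, t.x = 0 ∧ t.y = 0 ∨ t.x = 1 ∧ t.y = 0 ∨ t.x = 0 ∧ t.y = 1 := by
  decide

lemma T_kids : ∀ t ∈ T, t ∈ kids t.a := by
  simp [T, kids, Nat.beq]

/-- Shift by `32`. -/
def S (a : ℤ) : ℕ := (a + 32).toNat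

lemma S_cast {a : ℤ} (h : 26 ≤ S a) : (S a : ℤ) = a + 32 := by
  unfold S at *; omega

lemma S_of {a : ℤ} {n : ℕ} (h : (n : ℤ) = a + 32) : n = S a := by
  unfold S; omega

lemma S_le {a : ℤ} (h : -6 ≤ a) : (S a : ℤ) = a + 32 := by
  unfold S; omega

lemma par_eq {a b c d a0 a1 a2 a3 : ℤ} {x y x' y' x'' y'' : ℕ}
    (xt : x = 0 ∧ y = 0 ∨ x = 1 ∧ y = 0 ∨ x = 0 ∧ y = 1)
    (xu : x' = 0 ∧ y' = 0 ∨ x' = 1 ∧ y' = 0 ∨ x' = 0 ∧ y' = 1)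
    (xv : x'' = 0 ∧ y'' = 0 ∨ x'' = 1 ∧ y'' = 0 ∨ x'' = 0 ∧ y'' = 1)
    (ha : a = a0 + a3 + (x - 2 * x' + x'')) (hb : b = a2 + a3) (hc : c = a0 + a1)
    (hd : d = a1 + (y - 2 * y' + y'')) (h : inD (S a) (S b) (S c) (S d) = true) :
    S c + 30 + (y + y'' + 2 - 2 * y') - S d = S a0 ∧
    S d + 2 - (y + y'' + 2 - 2 * y') = S a1 ∧
    S b + S c + (x + x'' + 2 - 2 * x') + (y + y'' + 2 - 2 * y') + 28 - S a - S d = S a2 ∧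
    S a + S d + 4 - (S c + (x + x'' + 2 - 2 * x') + (y + y'' + 2 - 2 * y')) = S a3 := by
  obtain ⟨p1, p2, p3, p4, p5, p6, p7, p8⟩ := inD_bounds h
  have ea := S_cast p1
  have eb := S_cast p3
  have ec := S_cast p5
  have ed := S_cast p7
  clear h
  generalize S a = A at *
  generalize S b = B at *
  generalize S c = C at *
  generalize S d = D at *
  refine ⟨S_of ?_, S_of ?_, S_of ?_, S_of ?_⟩ <;>
    rcases xt with ⟨rfl, rfl⟩ | ⟨rfl, rfl⟩ | ⟨rfl, rfl⟩ <;>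
    rcases xu with ⟨rfl, rfl⟩ | ⟨rfl, rfl⟩ | ⟨rfl, rfl⟩ <;>
    rcases xv with ⟨rfl, rfl⟩ | ⟨rfl, rfl⟩ | ⟨rfl, rfl⟩ <;> omega

lemma kid_eq {a b c d a0 a1 a2 a3 : ℤ} {x y x' y' x'' y'' : ℕ}
    (xt : x = 0 ∧ y = 0 ∨ x = 1 ∧ y = 0 ∨ x = 0 ∧ y = 1)
    (xu : x' = 0 ∧ y' = 0 ∨ x' = 1 ∧ y' = 0 ∨ x' = 0 ∧ y' = 1)
    (xv : x'' = 0 ∧ y'' = 0 ∨ x'' = 1 ∧ y'' = 0 ∨ x'' = 0 ∧ y'' = 1)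
    (ha : a = a0 + a3 + (x - 2 * x' + x'')) (hb : b = a2 + a3) (hc : c = a0 + a1)
    (hd : d = a1 + (y - 2 * y' + y'')) (h : inD (S a0) (S a1) (S a2) (S a3) = true) :
    S a0 + S a3 + (x + x'' + 2 - 2 * x') - 34 = S a ∧ S a2 + S a3 - 32 = S b ∧
    S a0 + S a1 - 32 = S c ∧ S a1 + (y + y'' + 2 - 2 * y') - 2 = S d := by
  obtain ⟨p1, p2, p3, p4, p5, p6, p7, p8⟩ := inD_bounds h
  have ea := S_cast p1
  have eb := S_cast p3
  have ec := S_cast p5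
  have ed := S_cast p7
  clear h
  generalize S a0 = A at *
  generalize S a1 = B at *
  generalize S a2 = C at *
  generalize S a3 = D at *
  refine ⟨S_of ?_, S_of ?_, S_of ?_, S_of ?_⟩ <;>
    rcases xt with ⟨rfl, rfl⟩ | ⟨rfl, rfl⟩ | ⟨rfl, rfl⟩ <;>
    rcases xu with ⟨rfl, rfl⟩ | ⟨rfl, rfl⟩ | ⟨rfl, rfl⟩ <;>
    rcases xv with ⟨rfl, rfl⟩ | ⟨rfl, rfl⟩ | ⟨rfl, rfl⟩ <;> omega

lemma spec1 {a b c d a0 a1 a2 a3 : ℤ} {t u v : Op} (ht : t ∈ T) (hu : u ∈ T) (hv : v ∈ T)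
    (ha : a = a0 + a3 + (t.x - 2 * u.x + v.x)) (hb : b = a2 + a3) (hc : c = a0 + a1)
    (hd : d = a1 + (t.y - 2 * u.y + v.y)) (h : inD (S a) (S b) (S c) (S d) = true) :
    goodPar (S a0) (S a1) (S a2) (S a3) = true := by
  have h1 := all_spec (allD_spec check1_true h) _ (Eset_mem t ht u hu v hv)
  obtain ⟨q0, q1, q2, q3⟩ := par_eq (T_xy t ht) (T_xy u hu) (T_xy v hv) ha hb hc hd h
  simp only [par3] at h1
  rwa [q0, q1, q2, q3] at h1

lemma spec2 {a b c d a0 a1 a2 a3 : ℤ} {t u v : Op} (ht : t ∈ T) (hu : u ∈ T) (hv : v ∈ T)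
    (hta : t.a < 4) (hua : u.a < 4) (hva : v.a < 4)
    (ha : a = a0 + a3 + (t.x - 2 * u.x + v.x)) (hb : b = a2 + a3) (hc : c = a0 + a1)
    (hd : d = a1 + (t.y - 2 * u.y + v.y)) (h : inD (S a) (S b) (S c) (S d) = true)
    (hf : inF t.a u.a v.a (S a0) (S a1) (S a2) (S a3) = true) :
    inF t.c u.c v.c (S a) (S b) (S c) (S d) = true := by
  have h1 := Tr.all_spec _ _ check2_true (inF_get hf)
  obtain ⟨e3, e2, e1, e0⟩ := dig_code (inF_inD hf)
  simp only [e0, e1, e2, e3, kids2] at h1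
  have h2 := all_spec (all_spec (all_spec h1 _ (mem_letters hta)) _ (mem_letters hua)) _
    (mem_letters hva)
  have hbit : bit (Ftree.get (code (S a0) (S a1) (S a2) (S a3)))
      (t.a * 16 + u.a * 4 + v.a) = true := by
    simp only [inF, Bool.and_eq_true] at hf
    exact hf.2
  rw [hbit] at h2
  simp only [Bool.not_true, Bool.false_or] at h2
  have h3 := all_spec (all_spec (all_spec h2 _ (T_kids t ht)) _ (T_kids u hu)) _ (T_kids v hv)
  obtain ⟨q0, q1, q2, q3⟩ :=
    kid_eq (T_xy t ht) (T_xy u hu) (T_xy v hv) ha hb hc hd (inF_inD hf)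
  simp only [kid3, goodKid, q0, q1, q2, q3, h] at h3
  simpa using h3

lemma spec3 {l m n : ℕ} {a b c d : ℤ} (h : inF l m n (S a) (S b) (S c) (S d) = true)
    (h1 : a + b + c + d = 0) (h2 : b + 3 * c + 4 * d = 0) :
    a = 0 ∧ b = 0 ∧ c = 0 ∧ d = 0 := by
  have h3 := Tr.all_spec _ _ check3_true (inF_get h)
  obtain ⟨e3, e2, e1, e0⟩ := dig_code (inF_inD h)
  simp only [e0, e1, e2, e3, ker3] at h3
  have hb := inD_bounds (inF_inD h)
  simp only [Bool.or_eq_true, Bool.not_eq_true', Bool.and_eq_true, Bool.and_eq_false_iff,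
    beq_iff, beq_iff'] at h3
  have e1 := S_cast hb.1
  have e2 := S_cast hb.2.2.1
  have e3 := S_cast hb.2.2.2.2.1
  have e4 := S_cast hb.2.2.2.2.2.2.1
  generalize S a = A at *
  generalize S b = B at *
  generalize S c = C at *
  generalize S d = D at *
  omega

lemma Blist_mem {k l m n a b c d a' b' c' d' : ℕ}
    (h : inB k l m n a b c d a' b' c' d' = true) :
    codeB k l m n a b c d a' b' c' d' ∈ Blist := by
  simp only [inB, Bool.and_eq_true, List.any_eq_true, beq_iff] at h
  obtain ⟨-, x, hx, e⟩ := h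
  rw [e]; exact hx

lemma dig_codeB {k l m n a b c d a' b' c' d' : ℕ} (hk : k < 4) (hl : l < 4) (hm : m < 4)
    (hn : n < 4) (h : inD a b c d = true) (h' : inD a' b' c' d' = true) {s : ℕ}
    (hs : s = codeB k l m n a b c d a' b' c' d') :
    s / 815730721 / 64 % 4 = k ∧ s / 815730721 / 16 % 4 = l ∧ s / 815730721 / 4 % 4 = m ∧
    s / 815730721 % 4 = n ∧ dig s 7 = a ∧ dig s 6 = b ∧ dig s 5 = c ∧ dig s 4 = d ∧
    dig s 3 = a' ∧ dig s 2 = b' ∧ dig s 1 = c' ∧ dig s 0 = d' := by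
  have hb := inD_bounds h
  have hb' := inD_bounds h'
  have c1 : code a b c d < 28561 := by have := code_eq h; omega
  have c2 : code a' b' c' d' < 28561 := by have := code_eq h'; omega
  obtain ⟨e3, e2, e1, e0⟩ := dig_code h
  obtain ⟨f3, f2, f1, f0⟩ := dig_code h'
  simp only [codeB] at hs
  generalize code a b c d = x at *
  generalize code a' b' c' d' = y at *
  have s1 : s / 815730721 = ((k * 4 + l) * 4 + m) * 4 + n := by omega
  have s2 : s / 28561 % 28561 = x := by omega
  have s3 : s % 28561 = y := by omega
  simp only [dig] at *
  norm_num at *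
  refine ⟨by omega, by omega, by omega, by omega, by omega, by omega, by omega, by omega,
    by omega, by omega, by omega, by omega⟩

lemma spec4 {a b c d a0 a1 a2 a3 a' b' c' d' b0 b1 b2 b3 : ℤ} {t u v w : Op}
    (ht : t ∈ T) (hu : u ∈ T) (hv : v ∈ T) (hw : w ∈ T)
    (htc : t.c < 4) (huc : u.c < 4) (hvc : v.c < 4) (hwc : w.c < 4)
    (ha : a = a0 + a3 + (t.x - 2 * u.x + v.x)) (hb : b = a2 + a3) (hc : c = a0 + a1)
    (hd : d = a1 + (t.y - 2 * u.y + v.y))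
    (ha' : a' = b0 + b3 + (u.x - 2 * v.x + w.x)) (hb' : b' = b2 + b3) (hc' : c' = b0 + b1)
    (hd' : d' = b1 + (u.y - 2 * v.y + w.y))
    (h : inB t.c u.c v.c w.c (S a) (S b) (S c) (S d) (S a') (S b') (S c') (S d') = true)
    (h1 : inF t.a u.a v.a (S a0) (S a1) (S a2) (S a3) = true)
    (h2 : inF u.a v.a w.a (S b0) (S b1) (S b2) (S b3) = true) :
    inB t.a u.a v.a w.a (S a0) (S a1) (S a2) (S a3) (S b0) (S b1) (S b2) (S b3) = true := by
  obtain ⟨i1, i2⟩ := inB_inD h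
  have hm := Blist_mem h
  have hs := all_spec check4_true _ hm
  obtain ⟨k1, k2, k3, k4, d7, d6, d5, d4, d3, d2, d1, d0⟩ :=
    dig_codeB htc huc hvc hwc i1 i2 rfl
  simp only [k1, k2, k3, k4, d7, d6, d5, d4, d3, d2, d1, d0] at hs
  have hs := all_spec hs t ht
  rw [show Nat.beq t.c t.c = true from beq_iff.2 rfl, Bool.not_true, Bool.false_or] at hs
  have hs := all_spec hs u hu
  rw [show Nat.beq u.c u.c = true from beq_iff.2 rfl, Bool.not_true, Bool.false_or] at hs
  have hs := all_spec hs v hv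
  rw [show Nat.beq v.c v.c = true from beq_iff.2 rfl, Bool.not_true, Bool.false_or] at hs
  obtain ⟨q0, q1, q2, q3⟩ := par_eq (T_xy t ht) (T_xy u hu) (T_xy v hv) ha hb hc hd i1
  obtain ⟨r0, r1, r2, r3⟩ := par_eq (T_xy u hu) (T_xy v hv) (T_xy w hw) ha' hb' hc' hd' i2
  simp only [par3, q0, q1, q2, q3, h1, Bool.not_true, Bool.false_or] at hs
  have hs := all_spec hs w hw
  rw [show Nat.beq w.c w.c = true from beq_iff.2 rfl, Bool.not_true, Bool.false_or] at hs
  rw [r0, r1, r2, r3] at hs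
  simpa only [h2, Bool.not_true, Bool.false_or] using hs

lemma spec5 {k l m n : ℕ} (hk : k < 4) (hl : l < 4) (hm : m < 4) (hn : n < 4)
    (h1 : inF k l m 32 32 32 32 = true) (h2 : inF l m n 32 32 32 32 = true) :
    inB k l m n 32 32 32 32 32 32 32 32 = true := by
  have h := all_spec (all_spec (all_spec (all_spec check5_true _ (mem_letters hk)) _
    (mem_letters hl)) _ (mem_letters hm)) _ (mem_letters hn)
  simpa only [h1, h2, Bool.not_true, Bool.false_or] using h

lemma spec6 {t u v w : Op} (ht : t ∈ T) (hu : u ∈ T) (hv : v ∈ T) (hw : w ∈ T)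
    (h1 : t.a = u.a) (h2 : t.a = v.a) (h3 : t.a = w.a)
    (h : inB t.c u.c v.c w.c (S (t.x - 2 * u.x + v.x)) (S 0) (S 0) (S (t.y - 2 * u.y + v.y))
      (S (u.x - 2 * v.x + w.x)) (S 0) (S 0) (S (u.y - 2 * v.y + w.y)) = true) :
    t.c = u.c ∧ t.c = v.c ∧ t.c = w.c := by
  have hs := all_spec (all_spec check6_true t ht) u hu
  rw [show Nat.beq t.a u.a = true from beq_iff.2 h1, Bool.not_true, Bool.false_or] at hs
  have hs := all_spec hs v hv
  rw [show Nat.beq t.a v.a = true from beq_iff.2 h2, Bool.not_true, Bool.false_or] at hs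
  have hs := all_spec hs w hw
  rw [show Nat.beq t.a w.a = true from beq_iff.2 h3, Bool.not_true, Bool.false_or] at hs
  have xt := T_xy t ht
  have xu := T_xy u hu
  have xv := T_xy v hv
  have xw := T_xy w hw
  have q0 : t.x + v.x + 32 - 2 * u.x = S (t.x - 2 * u.x + v.x) := by apply S_of; omega
  have q1 : t.y + v.y + 32 - 2 * u.y = S (t.y - 2 * u.y + v.y) := by apply S_of; omega
  have q2 : u.x + w.x + 32 - 2 * v.x = S (u.x - 2 * v.x + w.x) := by apply S_of; omega
  have q3 : u.y + w.y + 32 - 2 * v.y = S (u.y - 2 * v.y + w.y) := by apply S_of; omega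
  have q4 : S 0 = 32 := rfl
  rw [q4] at h
  rw [q0, q1, q2, q3, h] at hs
  simpa [and_assoc] using hs

lemma spec7 {a b c d : ℤ} (h1 : a + b + c + d = 0) (h2 : b + 3 * c + 4 * d = 0)
    (hc : -6 ≤ c) (hc' : c ≤ 6) (hd : -3 ≤ d) (hd' : d ≤ 3) :
    goodPar (S a) (S b) (S c) (S d) = true := by
  have hm : S d ∈ [29, 30, 31, 32, 33, 34, 35] := by
    have : S d = 29 ∨ S d = 30 ∨ S d = 31 ∨ S d = 32 ∨ S d = 33 ∨ S d = 34 ∨ S d = 35 := by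
      unfold S; omega
    simpa using this
  have h := all_spec (all_spec check7_true (S c)
    (mem_rng (by unfold S; omega) (by unfold S; omega))) (S d) hm
  have h' : goodPar (2 * S c + 3 * S d - 128) (256 - (3 * S c + 4 * S d)) (S c) (S d) = true := h
  have q0 : 2 * S c + 3 * S d - 128 = S a := by unfold S; omega
  have q1 : 256 - (3 * S c + 4 * S d) = S b := by unfold S; omega
  rw [q0, q1] at h'
  exact h'

/-! ### The word -/

/-- The morphism, on indices of letters. -/
def phi : Fin 4 → List (Fin 4) := ![[0, 2], [3, 2], [1], [0, 1]]

/-- The iterates of the morphism. -/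
def W : ℕ → List (Fin 4)
  | 0 => [0]
  | n + 1 => (W n).flatMap phi

/-- A position in `W n`: the part before it and the letter after it. -/
def Cut (n : ℕ) (u : List (Fin 4)) (c : Fin 4) : Prop := ∃ t, W n = u ++ c :: t

/-- Number of occurrences of a letter. -/
def ct (i : Fin 4) (u : List (Fin 4)) : ℤ := (u.count i : ℤ)

/-- Second differences. -/
def dv (i : Fin 4) (u v w : List (Fin 4)) : ℤ := ct i u - 2 * ct i v + ct i w

lemma flatMap_cut {c : Fin 4} {t : List (Fin 4)} : ∀ {l u : List (Fin 4)},
    l.flatMap phi = u ++ c :: t →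
    ∃ u' a t' v s, l = u' ++ a :: t' ∧ phi a = v ++ c :: s ∧ u = u'.flatMap phi ++ v := by
  intro l
  induction l with
  | nil => intro u h; simp at h
  | cons x l ih =>
    intro u h
    rw [List.flatMap_cons, List.append_eq_append_iff] at h
    rcases h with ⟨as, rfl, h2⟩ | ⟨bs, h1, h2⟩
    · obtain ⟨u', a, t', v, s, rfl, h4, rfl⟩ := ih h2
      exact ⟨x :: u', a, t', v, s, rfl, h4, by simp⟩
    · cases bs with
      | nil =>
        obtain ⟨u', a, t', v, s, rfl, h4, h5⟩ := ih (u := []) (by simpa using h2.symm)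
        refine ⟨x :: u', a, t', v, s, rfl, h4, ?_⟩
        rw [List.flatMap_cons, List.append_assoc, ← h5, h1]
        simp
      | cons y bs =>
        obtain ⟨rfl, -⟩ : c = y ∧ _ := by simpa using h2
        exact ⟨[], x, l, u, bs, rfl, h1, by simp⟩

lemma op_exists {a c : Fin 4} {v s : List (Fin 4)} (h : phi a = v ++ c :: s) :
    ∃ t ∈ T, t.a = a ∧ t.c = c ∧ ct 0 v = t.x ∧ ct 1 v = 0 ∧ ct 2 v = 0 ∧ ct 3 v = t.y := by
  fin_cases a <;> rcases v with _ | ⟨x, _ | ⟨y, v⟩⟩ <;> simp [phi] at h <;>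
    simp [T, ct, ← h] <;> simp [h]

lemma pre_unique {a c : Fin 4} {v s v' s' : List (Fin 4)} (h : phi a = v ++ c :: s)
    (h' : phi a = v' ++ c :: s') : v = v' := by
  fin_cases a <;> rcases v with _ | ⟨x, _ | ⟨y, v⟩⟩ <;> simp [phi] at h <;>
    rcases v' with _ | ⟨x', _ | ⟨y', v'⟩⟩ <;> simp [phi] at h' <;> grind

lemma ct_nil (i : Fin 4) : ct i [] = 0 := by simp [ct]

lemma ct_append (i : Fin 4) (u v : List (Fin 4)) : ct i (u ++ v) = ct i u + ct i v := by
  simp [ct]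

lemma ct_cons (i x : Fin 4) (u : List (Fin 4)) :
    ct i (x :: u) = ct i u + if x = i then 1 else 0 := by
  simp only [ct, List.count_cons, beq_iff_eq]
  push_cast
  rfl

lemma ct_flatMap (u : List (Fin 4)) :
    ct 0 (u.flatMap phi) = ct 0 u + ct 3 u ∧ ct 1 (u.flatMap phi) = ct 2 u + ct 3 u ∧
    ct 2 (u.flatMap phi) = ct 0 u + ct 1 u ∧ ct 3 (u.flatMap phi) = ct 1 u := by
  induction u with
  | nil => simp [ct_nil]
  | cons x u ih =>
    obtain ⟨h0, h1, h2, h3⟩ := ih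
    simp only [List.flatMap_cons, ct_append, h0, h1, h2, h3, ct_cons]
    fin_cases x <;> simp [phi, ct_cons, ct_nil] <;> omega

/-- The position `(u, c)` of the next word comes from `(u', a)` in `W n` by `t`. -/
structure Par (n : ℕ) (u : List (Fin 4)) (c : Fin 4) (u' : List (Fin 4)) (a : Fin 4) (t : Op) :
    Prop where
  cut : Cut n u' a
  mem : t ∈ T
  ea : t.a = a
  ec : t.c = c
  c0 : ct 0 u = ct 0 u' + ct 3 u' + t.x
  c1 : ct 1 u = ct 2 u' + ct 3 u'
  c2 : ct 2 u = ct 0 u' + ct 1 u'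
  c3 : ct 3 u = ct 1 u' + t.y
  pre : ∃ v s, phi a = v ++ c :: s ∧ u = u'.flatMap phi ++ v

lemma Cut.par {n : ℕ} {u : List (Fin 4)} {c : Fin 4} (h : Cut (n + 1) u c) :
    ∃ u' a t, Par n u c u' a t := by
  obtain ⟨r, hr⟩ := h
  obtain ⟨u', a, t', v, s, h1, h2, h3⟩ := flatMap_cut hr
  obtain ⟨t, ht, e1, e2, e3, e4, e5, e6⟩ := op_exists h2
  obtain ⟨f0, f1, f2, f3⟩ := ct_flatMap u'
  refine ⟨u', a, t, ⟨t', h1⟩, ht, e1, e2, ?_, ?_, ?_, ?_, ⟨v, s, h2, h3⟩⟩ <;>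
    rw [h3, ct_append] <;> omega

lemma par_dv {n : ℕ} {u0 u1 u2 v0 v1 v2 : List (Fin 4)} {c0 c1 c2 a0 a1 a2 : Fin 4}
    {t0 t1 t2 : Op} (h0 : Par n u0 c0 v0 a0 t0) (h1 : Par n u1 c1 v1 a1 t1)
    (h2 : Par n u2 c2 v2 a2 t2) :
    dv 0 u0 u1 u2 = dv 0 v0 v1 v2 + dv 3 v0 v1 v2 + (t0.x - 2 * t1.x + t2.x) ∧
    dv 1 u0 u1 u2 = dv 2 v0 v1 v2 + dv 3 v0 v1 v2 ∧
    dv 2 u0 u1 u2 = dv 0 v0 v1 v2 + dv 1 v0 v1 v2 ∧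
    dv 3 u0 u1 u2 = dv 1 v0 v1 v2 + (t0.y - 2 * t1.y + t2.y) := by
  have := h0.c0; have := h0.c1; have := h0.c2; have := h0.c3
  have := h1.c0; have := h1.c1; have := h1.c2; have := h1.c3
  have := h2.c0; have := h2.c1; have := h2.c2; have := h2.c3
  simp only [dv]
  omega

lemma cut_zero {u : List (Fin 4)} {c : Fin 4} (h : Cut 0 u c) : u = [] ∧ c = 0 := by
  obtain ⟨t, ht⟩ := h
  cases u with
  | nil => simp [W] at ht; exact ⟨rfl, ht.1.symm⟩
  | cons x u => simp [W] at ht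

lemma dv_same (i : Fin 4) (u : List (Fin 4)) : dv i u u u = 0 := by
  simp only [dv]; ring

/-! ### Contraction -/

/-- The contracting linear form. -/
noncomputable def ell (u v w : ℂ) (u0 u1 u2 : List (Fin 4)) : ℂ :=
  dv 0 u0 u1 u2 + dv 1 u0 u1 u2 * u + dv 2 u0 u1 u2 * v + dv 3 u0 u1 u2 * w

lemma ell_bound {z u v w : ℂ} (hz : ‖z‖ ≤ 0.628) (hw : ‖w‖ ≤ 1) (hw' : ‖1 - w‖ ≤ 1)
    (e0 : 1 + v = z) (e1 : w + v = z * u) (e2 : u = z * v) (e3 : 1 + u = z * w) :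
    ∀ n {u0 u1 u2 : List (Fin 4)} {c0 c1 c2 : Fin 4}, Cut n u0 c0 → Cut n u1 c1 → Cut n u2 c2 →
      ‖ell u v w u0 u1 u2‖ ≤ 5.4 := by
  intro n
  induction n with
  | zero =>
    intro u0 u1 u2 c0 c1 c2 h0 h1 h2
    rw [(cut_zero h0).1, (cut_zero h1).1, (cut_zero h2).1]
    simp [ell, dv_same]
    norm_num
  | succ n ih =>
    intro u0 u1 u2 c0 c1 c2 h0 h1 h2
    obtain ⟨v0, a0, t0, p0⟩ := h0.par
    obtain ⟨v1, a1, t1, p1⟩ := h1.par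
    obtain ⟨v2, a2, t2, p2⟩ := h2.par
    have hb := ih p0.cut p1.cut p2.cut
    obtain ⟨f0, f1, f2, f3⟩ := par_dv p0 p1 p2
    have key : ell u v w u0 u1 u2 = z * ell u v w v0 v1 v2 +
        (((t0.x + t0.y * w) - (t1.x + t1.y * w)) + ((t2.x + t2.y * w) - (t1.x + t1.y * w))) := by
      simp only [ell, f0, f1, f2, f3]
      push_cast
      linear_combination (dv 0 v0 v1 v2 : ℂ) * e0 + (dv 1 v0 v1 v2 : ℂ) * e1
        + (dv 2 v0 v1 v2 : ℂ) * e2 + (dv 3 v0 v1 v2 : ℂ) * e3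
    have hw2 : ‖w - 1‖ ≤ 1 := by rwa [norm_sub_rev]
    have small : ∀ t ∈ T, ∀ r ∈ T, ‖((t.x + t.y * w) - (r.x + r.y * w) : ℂ)‖ ≤ 1 := by
      intro t ht r hr
      rcases T_xy t ht with ⟨x, y⟩ | ⟨x, y⟩ | ⟨x, y⟩ <;>
        rcases T_xy r hr with ⟨x', y'⟩ | ⟨x', y'⟩ | ⟨x', y'⟩ <;>
        simp [x, y, x', y', hw, hw', hw2]
    have s1 := small t0 p0.mem t1 p1.mem
    have s2 := small t2 p2.mem t1 p1.mem
    rw [key]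
    refine (norm_add_le _ _).trans ?_
    have s3 := (norm_add_le _ _).trans (add_le_add s1 s2)
    have s4 : ‖z * ell u v w v0 v1 v2‖ ≤ 0.628 * 5.4 := by
      rw [norm_mul]
      exact mul_le_mul hz hb (norm_nonneg _) (by norm_num)
    refine (add_le_add s4 s3).trans ?_
    norm_num

lemma dsq_cast (m n : ℕ) : (dsq m n : ℤ) = ((m : ℤ) - n) ^ 2 := by
  unfold dsq
  rcases le_total m n with h | h
  · rw [Nat.sub_eq_zero_of_le h]
    push_cast [Nat.cast_sub h]; ring
  · rw [Nat.sub_eq_zero_of_le h]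
    push_cast [Nat.cast_sub h]; ring

lemma not_big {u v w : ℂ} (hu : ‖u - ⟨-0.469, -0.088⟩‖ ≤ 0.001) (hv : ‖v - ⟨-0.593, 0.477⟩‖ ≤ 0.001)
    (hw : ‖w - ⟨0.444, -0.736⟩‖ ≤ 0.001) {a b c d : ℤ}
    (h : ‖(a + b * u + c * v + d * w : ℂ)‖ ≤ 5.4)
    (ha : |a| ≤ 30) (hb : |b| ≤ 30) (hc : |c| ≤ 30) (hd : |d| ≤ 30) :
    big (S a) (S b) (S c) (S d) = false := by
  have hb' : ‖(b : ℂ)‖ ≤ 30 := by rw [Complex.norm_intCast]; exact_mod_cast hb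
  have hc' : ‖(c : ℂ)‖ ≤ 30 := by rw [Complex.norm_intCast]; exact_mod_cast hc
  have hd' : ‖(d : ℂ)‖ ≤ 30 := by rw [Complex.norm_intCast]; exact_mod_cast hd
  have m1 : ‖(b * (u - ⟨-0.469, -0.088⟩) : ℂ)‖ ≤ 30 * 0.001 := by
    rw [norm_mul]; exact mul_le_mul hb' hu (norm_nonneg _) (by norm_num)
  have m2 : ‖(c * (v - ⟨-0.593, 0.477⟩) : ℂ)‖ ≤ 30 * 0.001 := by
    rw [norm_mul]; exact mul_le_mul hc' hv (norm_nonneg _) (by norm_num)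
  have m3 : ‖(d * (w - ⟨0.444, -0.736⟩) : ℂ)‖ ≤ 30 * 0.001 := by
    rw [norm_mul]; exact mul_le_mul hd' hw (norm_nonneg _) (by norm_num)
  have key : (⟨a - 0.469 * b - 0.593 * c + 0.444 * d, -0.088 * b + 0.477 * c - 0.736 * d⟩ : ℂ) =
      (a + b * u + c * v + d * w) - b * (u - ⟨-0.469, -0.088⟩) - c * (v - ⟨-0.593, 0.477⟩)
      - d * (w - ⟨0.444, -0.736⟩) := by
    apply Complex.ext <;> simp <;> ring
  have hn : ‖(⟨a - 0.469 * b - 0.593 * c + 0.444 * d,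
      -0.088 * b + 0.477 * c - 0.736 * d⟩ : ℂ)‖ ≤ 5.5 := by
    rw [key]
    have n1 := norm_sub_le ((a + b * u + c * v + d * w : ℂ) - b * (u - ⟨-0.469, -0.088⟩)
      - c * (v - ⟨-0.593, 0.477⟩)) (d * (w - ⟨0.444, -0.736⟩))
    have n2 := norm_sub_le ((a + b * u + c * v + d * w : ℂ) - b * (u - ⟨-0.469, -0.088⟩))
      (c * (v - ⟨-0.593, 0.477⟩))
    have n3 := norm_sub_le (a + b * u + c * v + d * w : ℂ) (b * (u - ⟨-0.469, -0.088⟩))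
    linarith
  have hsq : ‖(⟨a - 0.469 * b - 0.593 * c + 0.444 * d,
      -0.088 * b + 0.477 * c - 0.736 * d⟩ : ℂ)‖ ^ 2 ≤ 5.5 ^ 2 :=
    pow_le_pow_left₀ (norm_nonneg _) hn 2
  rw [Complex.sq_norm, Complex.normSq_apply] at hsq
  simp only at hsq
  have hr : ((1000 * a - 469 * b - 593 * c + 444 * d : ℤ) : ℝ) ^ 2 +
      ((477 * c - 88 * b - 736 * d : ℤ) : ℝ) ^ 2 ≤ (30250000 : ℤ) := by
    push_cast
    linarith
  have hi : (1000 * a - 469 * b - 593 * c + 444 * d) ^ 2 + (477 * c - 88 * b - 736 * d) ^ 2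
      ≤ (30250000 : ℤ) := by exact_mod_cast hr
  rw [abs_le] at ha hb hc hd
  have ea : (S a : ℤ) = a + 32 := by unfold S; omega
  have eb : (S b : ℤ) = b + 32 := by unfold S; omega
  have ec : (S c : ℤ) = c + 32 := by unfold S; omega
  have ed : (S d : ℤ) = d + 32 := by unfold S; omega
  have hle : dsq (1000 * S a + 444 * S d) (469 * S b + 593 * S c + 12224) +
      dsq (477 * S c + 11104) (88 * S b + 736 * S d) ≤ 30250000 := by
    zify
    rw [dsq_cast, dsq_cast]
    push_cast
    rw [ea, eb, ec, ed]
    refine le_trans (le_of_eq ?_) hi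
    ring
  rw [← Bool.not_eq_true]
  intro hbig
  rw [big, Nat.blt_eq] at hbig
  omega

lemma not_big_cut {n : ℕ} {u0 u1 u2 : List (Fin 4)} {c0 c1 c2 : Fin 4} (h0 : Cut n u0 c0)
    (h1 : Cut n u1 c1) (h2 : Cut n u2 c2) (b0 : |dv 0 u0 u1 u2| ≤ 30) (b1 : |dv 1 u0 u1 u2| ≤ 30)
    (b2 : |dv 2 u0 u1 u2| ≤ 30) (b3 : |dv 3 u0 u1 u2| ≤ 30) :
    big (S (dv 0 u0 u1 u2)) (S (dv 1 u0 u1 u2)) (S (dv 2 u0 u1 u2)) (S (dv 3 u0 u1 u2)) = false := by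
  obtain ⟨z, u, v, w, hz, hw, hw', e0, e1, e2, e3, n1, n2, n3⟩ := exists_weights
  exact not_big n1 n2 n3 (ell_bound hz hw hw' e0 e1 e2 e3 n h0 h1 h2) b0 b1 b2 b3

lemma kernel_bound {n : ℕ} {u0 u1 u2 : List (Fin 4)} {c0 c1 c2 : Fin 4} (h0 : Cut n u0 c0)
    (h1 : Cut n u1 c1) (h2 : Cut n u2 c2)
    (k1 : dv 0 u0 u1 u2 + dv 1 u0 u1 u2 + dv 2 u0 u1 u2 + dv 3 u0 u1 u2 = 0)
    (k2 : dv 1 u0 u1 u2 + 3 * dv 2 u0 u1 u2 + 4 * dv 3 u0 u1 u2 = 0) :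
    |dv 2 u0 u1 u2| ≤ 6 ∧ |dv 3 u0 u1 u2| ≤ 3 := by
  obtain ⟨z, u, v, w, hz, hw, hw', e0, e1, e2, e3, n1, n2, n3⟩ := exists_weights
  have hl := ell_bound hz hw hw' e0 e1 e2 e3 n h0 h1 h2
  unfold ell at hl
  generalize dv 0 u0 u1 u2 = a at *
  generalize dv 1 u0 u1 u2 = b at *
  generalize dv 2 u0 u1 u2 = c at *
  generalize dv 3 u0 u1 u2 = d at *
  obtain rfl : a = 2 * c + 3 * d := by omega
  obtain rfl : b = -3 * c - 4 * d := by omega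
  have hre := (Complex.abs_re_le_norm _).trans hl
  have him := (Complex.abs_im_le_norm _).trans hl
  have r1 := (Complex.abs_re_le_norm _).trans n1
  have r2 := (Complex.abs_re_le_norm _).trans n2
  have r3 := (Complex.abs_re_le_norm _).trans n3
  have i1 := (Complex.abs_im_le_norm _).trans n1
  have i2 := (Complex.abs_im_le_norm _).trans n2
  have i3 := (Complex.abs_im_le_norm _).trans n3
  simp only [Complex.sub_re, Complex.sub_im] at r1 r2 r3 i1 i2 i3
  simp at hre him
  rw [abs_le] at hre him r1 r2 r3 i1 i2 i3
  have p1 : |(c : ℝ) * ((2 - 3 * u.re + v.re) - 2.814)| ≤ |(c : ℝ)| * 0.004 := by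
    rw [abs_mul]
    exact mul_le_mul_of_nonneg_left (abs_le.2 ⟨by linarith, by linarith⟩) (abs_nonneg _)
  have p2 : |(c : ℝ) * ((-3 * u.im + v.im) - 0.741)| ≤ |(c : ℝ)| * 0.004 := by
    rw [abs_mul]
    exact mul_le_mul_of_nonneg_left (abs_le.2 ⟨by linarith, by linarith⟩) (abs_nonneg _)
  have p3 : |(d : ℝ) * ((3 - 4 * u.re + w.re) - 5.32)| ≤ |(d : ℝ)| * 0.005 := by
    rw [abs_mul]
    exact mul_le_mul_of_nonneg_left (abs_le.2 ⟨by linarith, by linarith⟩) (abs_nonneg _)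
  have p4 : |(d : ℝ) * ((-4 * u.im + w.im) + 0.384)| ≤ |(d : ℝ)| * 0.005 := by
    rw [abs_mul]
    exact mul_le_mul_of_nonneg_left (abs_le.2 ⟨by linarith, by linarith⟩) (abs_nonneg _)
  rw [abs_le] at p1 p2 p3 p4
  have gc : |(c : ℝ)| < 7 ∧ |(d : ℝ)| < 4 := by
    rcases abs_cases (c : ℝ) with ⟨q, q'⟩ | ⟨q, q'⟩ <;>
      rcases abs_cases (d : ℝ) with ⟨r, r'⟩ | ⟨r, r'⟩ <;> rw [q] at p1 p2 ⊢ <;>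
      rw [r] at p3 p4 ⊢ <;> constructor <;> linarith
  constructor
  · have : |c| < 7 := by exact_mod_cast gc.1
    omega
  · have : |d| < 4 := by exact_mod_cast gc.2
    omega

/-! ### Descent -/

lemma inD_dv {n : ℕ} {u0 u1 u2 : List (Fin 4)} {c0 c1 c2 : Fin 4} (h0 : Cut n u0 c0)
    (h1 : Cut n u1 c1) (h2 : Cut n u2 c2) (b0 : |dv 0 u0 u1 u2| ≤ 30) (b1 : |dv 1 u0 u1 u2| ≤ 30)
    (b2 : |dv 2 u0 u1 u2| ≤ 30) (b3 : |dv 3 u0 u1 u2| ≤ 30)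
    (hg : goodPar (S (dv 0 u0 u1 u2)) (S (dv 1 u0 u1 u2)) (S (dv 2 u0 u1 u2))
      (S (dv 3 u0 u1 u2)) = true) :
    inD (S (dv 0 u0 u1 u2)) (S (dv 1 u0 u1 u2)) (S (dv 2 u0 u1 u2)) (S (dv 3 u0 u1 u2)) = true := by
  rw [goodPar, not_big_cut h0 h1 h2 b0 b1 b2 b3, Bool.or_false] at hg
  exact hg

lemma inD_par {n : ℕ} {u0 u1 u2 v0 v1 v2 : List (Fin 4)} {c0 c1 c2 a0 a1 a2 : Fin 4}
    {t0 t1 t2 : Op} (h0 : Par n u0 c0 v0 a0 t0) (h1 : Par n u1 c1 v1 a1 t1)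
    (h2 : Par n u2 c2 v2 a2 t2)
    (h : inD (S (dv 0 u0 u1 u2)) (S (dv 1 u0 u1 u2)) (S (dv 2 u0 u1 u2))
      (S (dv 3 u0 u1 u2)) = true) :
    inD (S (dv 0 v0 v1 v2)) (S (dv 1 v0 v1 v2)) (S (dv 2 v0 v1 v2)) (S (dv 3 v0 v1 v2)) = true := by
  obtain ⟨f0, f1, f2, f3⟩ := par_dv h0 h1 h2
  have hg := spec1 h0.mem h1.mem h2.mem f0 f1 f2 f3 h
  obtain ⟨p1, p2, p3, p4, p5, p6, p7, p8⟩ := inD_bounds h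
  have g0 := S_cast p1
  have g1 := S_cast p3
  have g2 := S_cast p5
  have g3 := S_cast p7
  have x0 := T_xy _ h0.mem
  have x1 := T_xy _ h1.mem
  have x2 := T_xy _ h2.mem
  have y0 : t0.x ≤ 1 ∧ t0.y ≤ 1 := by omega
  have y1 : t1.x ≤ 1 ∧ t1.y ≤ 1 := by omega
  have y2 : t2.x ≤ 1 ∧ t2.y ≤ 1 := by omega
  clear x0 x1 x2
  refine inD_dv h0.cut h1.cut h2.cut ?_ ?_ ?_ ?_ hg <;> rw [abs_le] <;> omega

lemma inF_cut : ∀ n {u0 u1 u2 : List (Fin 4)} {c0 c1 c2 : Fin 4}, Cut n u0 c0 → Cut n u1 c1 →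
    Cut n u2 c2 →
    inD (S (dv 0 u0 u1 u2)) (S (dv 1 u0 u1 u2)) (S (dv 2 u0 u1 u2)) (S (dv 3 u0 u1 u2)) = true →
    inF c0 c1 c2 (S (dv 0 u0 u1 u2)) (S (dv 1 u0 u1 u2)) (S (dv 2 u0 u1 u2))
      (S (dv 3 u0 u1 u2)) = true := by
  intro n
  induction n with
  | zero =>
    intro u0 u1 u2 c0 c1 c2 h0 h1 h2 _
    obtain ⟨rfl, rfl⟩ := cut_zero h0
    obtain ⟨rfl, rfl⟩ := cut_zero h1
    obtain ⟨rfl, rfl⟩ := cut_zero h2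
    simp only [dv_same]
    exact inF_zero
  | succ n ih =>
    intro u0 u1 u2 c0 c1 c2 h0 h1 h2 h
    obtain ⟨v0, a0, t0, p0⟩ := h0.par
    obtain ⟨v1, a1, t1, p1⟩ := h1.par
    obtain ⟨v2, a2, t2, p2⟩ := h2.par
    have hf := ih p0.cut p1.cut p2.cut (inD_par p0 p1 p2 h)
    obtain ⟨f0, f1, f2, f3⟩ := par_dv p0 p1 p2
    rw [← p0.ea, ← p1.ea, ← p2.ea] at hf
    rw [← p0.ec, ← p1.ec, ← p2.ec]
    exact spec2 p0.mem p1.mem p2.mem (by rw [p0.ea]; exact a0.isLt) (by rw [p1.ea]; exact a1.isLt)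
      (by rw [p2.ea]; exact a2.isLt) f0 f1 f2 f3 h hf

lemma no_B : ∀ n {u0 u1 u2 u3 : List (Fin 4)} {c0 c1 c2 c3 : Fin 4}, Cut n u0 c0 → Cut n u1 c1 →
    Cut n u2 c2 → Cut n u3 c3 →
    inB c0 c1 c2 c3 (S (dv 0 u0 u1 u2)) (S (dv 1 u0 u1 u2)) (S (dv 2 u0 u1 u2))
      (S (dv 3 u0 u1 u2)) (S (dv 0 u1 u2 u3)) (S (dv 1 u1 u2 u3)) (S (dv 2 u1 u2 u3))
      (S (dv 3 u1 u2 u3)) = true →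
    u0 = u1 ∧ u0 = u2 ∧ u0 = u3 := by
  intro n
  induction n with
  | zero =>
    intro u0 u1 u2 u3 c0 c1 c2 c3 h0 h1 h2 h3 _
    rw [(cut_zero h0).1, (cut_zero h1).1, (cut_zero h2).1, (cut_zero h3).1]
    simp
  | succ n ih =>
    intro u0 u1 u2 u3 c0 c1 c2 c3 h0 h1 h2 h3 h
    obtain ⟨v0, a0, t0, p0⟩ := h0.par
    obtain ⟨v1, a1, t1, p1⟩ := h1.par
    obtain ⟨v2, a2, t2, p2⟩ := h2.par
    obtain ⟨v3, a3, t3, p3⟩ := h3.par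
    obtain ⟨i1, i2⟩ := inB_inD h
    have k1 := inF_cut n p0.cut p1.cut p2.cut (inD_par p0 p1 p2 i1)
    have k2 := inF_cut n p1.cut p2.cut p3.cut (inD_par p1 p2 p3 i2)
    obtain ⟨f0, f1, f2, f3⟩ := par_dv p0 p1 p2
    obtain ⟨g0, g1, g2, g3⟩ := par_dv p1 p2 p3
    rw [← p0.ea, ← p1.ea, ← p2.ea] at k1
    rw [← p1.ea, ← p2.ea, ← p3.ea] at k2
    rw [← p0.ec, ← p1.ec, ← p2.ec, ← p3.ec] at h
    have hB := spec4 p0.mem p1.mem p2.mem p3.mem (by rw [p0.ec]; exact c0.isLt)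
      (by rw [p1.ec]; exact c1.isLt) (by rw [p2.ec]; exact c2.isLt) (by rw [p3.ec]; exact c3.isLt)
      f0 f1 f2 f3 g0 g1 g2 g3 h k1 k2
    rw [p0.ea, p1.ea, p2.ea, p3.ea] at hB
    obtain ⟨e1, e2, e3⟩ := ih p0.cut p1.cut p2.cut p3.cut hB
    subst e1 e2 e3
    have cu : ∀ {a b : Fin 4}, Cut n v0 a → Cut n v0 b → a = b := by
      rintro a b ⟨t, ht⟩ ⟨t', ht'⟩
      rw [ht] at ht'
      exact (List.cons.inj (List.append_cancel_left ht')).1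
    have q1 := cu p0.cut p1.cut
    have q2 := cu p0.cut p2.cut
    have q3 := cu p0.cut p3.cut
    subst q1 q2 q3
    simp only [dv_same, zero_add] at f0 f1 f2 f3 g0 g1 g2 g3
    rw [f0, f1, f2, f3, g0, g1, g2, g3] at h
    obtain ⟨w1, w2, w3⟩ := spec6 p0.mem p1.mem p2.mem p3.mem (by rw [p0.ea, p1.ea])
      (by rw [p0.ea, p2.ea]) (by rw [p0.ea, p3.ea]) h
    rw [p0.ec, p1.ec] at w1
    rw [p0.ec, p2.ec] at w2
    rw [p0.ec, p3.ec] at w3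
    have w1 := Fin.ext w1
    have w2 := Fin.ext w2
    have w3 := Fin.ext w3
    subst w1 w2 w3
    obtain ⟨x0, s0, j0, l0⟩ := p0.pre
    obtain ⟨x1, s1, j1, l1⟩ := p1.pre
    obtain ⟨x2, s2, j2, l2⟩ := p2.pre
    obtain ⟨x3, s3, j3, l3⟩ := p3.pre
    rw [l0, l1, l2, l3, pre_unique j1 j0, pre_unique j2 j0, pre_unique j3 j0]
    simp

lemma inF_kernel {n : ℕ} {u0 u1 u2 : List (Fin 4)} {c0 c1 c2 : Fin 4} (h0 : Cut n u0 c0)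
    (h1 : Cut n u1 c1) (h2 : Cut n u2 c2)
    (k1 : dv 0 u0 u1 u2 + dv 1 u0 u1 u2 + dv 2 u0 u1 u2 + dv 3 u0 u1 u2 = 0)
    (k2 : dv 1 u0 u1 u2 + 3 * dv 2 u0 u1 u2 + 4 * dv 3 u0 u1 u2 = 0) :
    inF c0 c1 c2 32 32 32 32 = true ∧ ∀ i, dv i u0 u1 u2 = 0 := by
  obtain ⟨b2, b3⟩ := kernel_bound h0 h1 h2 k1 k2
  rw [abs_le] at b2 b3
  have hg := spec7 k1 k2 b2.1 b2.2 b3.1 b3.2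
  have hD := inD_dv h0 h1 h2 (abs_le.2 ⟨by omega, by omega⟩) (abs_le.2 ⟨by omega, by omega⟩)
    (abs_le.2 ⟨by omega, by omega⟩) (abs_le.2 ⟨by omega, by omega⟩) hg
  have hF := inF_cut n h0 h1 h2 hD
  obtain ⟨z0, z1, z2, z3⟩ := spec3 hF k1 k2
  rw [z0, z1, z2, z3] at hF
  refine ⟨hF, fun i => ?_⟩
  fin_cases i
  · exact z0
  · exact z1
  · exact z2
  · exact z3

/-! ### The final word -/

/-- The letters as numbers. -/
def lv : Fin 4 → ℕ := ![0, 1, 3, 4]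

lemma length_ct (u : List (Fin 4)) : ((u.map lv).length : ℤ) = ct 0 u + ct 1 u + ct 2 u + ct 3 u := by
  induction u with
  | nil => simp [ct_nil]
  | cons x u ih =>
    simp only [List.map_cons, List.length_cons, ct_cons]
    push_cast
    rw [ih]
    fin_cases x <;> simp <;> ring

lemma sum_ct (u : List (Fin 4)) : ((u.map lv).sum : ℤ) = ct 1 u + 3 * ct 2 u + 4 * ct 3 u := by
  induction u with
  | nil => simp [ct_nil]
  | cons x u ih =>
    simp only [List.map_cons, List.sum_cons, ct_cons]
    rw [Nat.cast_add]
    rw [ih]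
    fin_cases x <;> simp [lv] <;> ring

lemma no_cube {n : ℕ} {s x y z t : List (Fin 4)} {e : Fin 4}
    (h : W n = (s ++ x ++ y ++ z ++ t) ++ [e]) (hx : x ≠ [])
    (l1 : (x.map lv).length = (y.map lv).length) (l2 : (y.map lv).length = (z.map lv).length)
    (s1 : (x.map lv).sum = (y.map lv).sum) (s2 : (y.map lv).sum = (z.map lv).sum) : False := by
  have cut : ∀ p q : List (Fin 4), W n = p ++ (q ++ [e]) → ∃ c, Cut n p c := by
    intro p q h
    cases q with
    | nil => exact ⟨e, [], h⟩
    | cons c q => exact ⟨c, q ++ [e], h⟩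
  obtain ⟨c0, h0⟩ := cut s (x ++ y ++ z ++ t) (by rw [h]; simp)
  obtain ⟨c1, h1⟩ := cut (s ++ x) (y ++ z ++ t) (by rw [h]; simp)
  obtain ⟨c2, h2⟩ := cut (s ++ x ++ y) (z ++ t) (by rw [h]; simp)
  obtain ⟨c3, h3⟩ := cut (s ++ x ++ y ++ z) t (by rw [h]; simp)
  have l1' : ((x.map lv).length : ℤ) = (y.map lv).length := by exact_mod_cast l1
  have l2' : ((y.map lv).length : ℤ) = (z.map lv).length := by exact_mod_cast l2
  have s1' : ((x.map lv).sum : ℤ) = (y.map lv).sum := by exact_mod_cast s1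
  have s2' : ((y.map lv).sum : ℤ) = (z.map lv).sum := by exact_mod_cast s2
  simp only [length_ct] at l1' l2'
  simp only [sum_ct] at s1' s2'
  obtain ⟨f1, z1⟩ := inF_kernel h0 h1 h2 (by simp only [dv, ct_append]; linarith)
    (by simp only [dv, ct_append]; linarith)
  obtain ⟨f2, z2⟩ := inF_kernel h1 h2 h3 (by simp only [dv, ct_append]; linarith)
    (by simp only [dv, ct_append]; linarith)
  have hB := spec5 c0.isLt c1.isLt c2.isLt c3.isLt f1 f2
  have := no_B n h0 h1 h2 h3 (by simp only [z1, z2]; exact hB)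
  apply hx
  simpa using this.1

lemma W_head (n : ℕ) : ∃ t, W n = 0 :: t ∧ n ≤ t.length := by
  have hlen : ∀ t : List (Fin 4), t.length ≤ (t.flatMap phi).length := by
    intro t
    induction t with
    | nil => simp
    | cons x t ih =>
      simp only [List.length_cons, List.flatMap_cons, List.length_append]
      have : 1 ≤ (phi x).length := by fin_cases x <;> simp [phi]
      omega
  induction n with
  | zero => exact ⟨[], rfl, le_refl _⟩
  | succ n ih =>
    obtain ⟨t, ht, hl⟩ := ih
    refine ⟨2 :: t.flatMap phi, ?_, ?_⟩
    · rw [W, ht]; rfl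
    · have := hlen t
      simp only [List.length_cons]
      omega


end AddCube

/-- For every `R` there is a word over `{0,1,3,4}` of length at least `R`
containing no nonempty factor `x₁x₂x₃` with `|x₁| = |x₂| = |x₃|` and `Σx₁ = Σx₂ = Σx₃`. -/
theorem not_uniformly_three_repetitive :
    ∀ R : ℕ, ∃ u : List ℕ, (∀ a ∈ u, a ∈ ({0, 1, 3, 4} : Set ℕ)) ∧ R ≤ u.length ∧
      ¬ ∃ (s x₁ x₂ x₃ t : List ℕ), u = s ++ x₁ ++ x₂ ++ x₃ ++ t ∧ x₁ ≠ [] ∧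
          x₁.length = x₂.length ∧ x₂.length = x₃.length ∧
          x₁.sum = x₂.sum ∧ x₂.sum = x₃.sum := by
  intro R
  obtain ⟨t, ht, hl⟩ := AddCube.W_head R
  have hne : AddCube.W R ≠ [] := by rw [ht]; simp
  have hW := (List.dropLast_append_getLast hne).symm
  have hlen : R ≤ (AddCube.W R).dropLast.length := by
    rw [List.length_dropLast, ht]; simpa using hl
  generalize (AddCube.W R).dropLast = P at hW hlen
  refine ⟨P.map AddCube.lv, ?_, by simpa using hlen, ?_⟩
  · intro a ha
    obtain ⟨i, -, rfl⟩ := List.mem_map.1 ha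
    fin_cases i <;> simp [AddCube.lv]
  · rintro ⟨s, x, y, z, r, h, hx, l1, l2, s1, s2⟩
    obtain ⟨Qr, r', rfl, hr, rfl⟩ := List.map_eq_append_iff.1 h
    obtain ⟨Qz, z', rfl, hz, rfl⟩ := List.map_eq_append_iff.1 hr
    obtain ⟨Qy, y', rfl, hy, rfl⟩ := List.map_eq_append_iff.1 hz
    obtain ⟨s', x', rfl, rfl, rfl⟩ := List.map_eq_append_iff.1 hy
    refine AddCube.no_cube hW ?_ l1 l2 s1 s2
    rintro rfl
    exact hx rfl
end

section
/- If b and c are factors of w having the same length and the same sum of letters, then ψ(b) − ψ(c) ∈ {(0,0,0,0), (1,−2,2,−1), (−1,2,−2,1)}. -/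
/-- The morphism φ on letters: φ(0)=03, φ(1)=43, φ(3)=1, φ(4)=01. -/
def phiLetter : ℕ → List ℕ
  | 0 => [0, 3]
  | 1 => [4, 3]
  | 3 => [1]
  | 4 => [0, 1]
  | _ => []

/-- The morphism φ on words, applied letterwise and concatenated. -/
def phi (x : List ℕ) : List ℕ := x.flatMap phiLetter

/-- The fixed point `w` of φ beginning with 0: `w n` is the `n`-th letter of
`φ^k([0])` for any `k` with `|φ^k([0])| > n` (e.g. `k = n+1`). -/
def w (n : ℕ) : ℕ := (phi^[n + 1] [0]).getD n 0

/-- The factor `w[p, q) = (w p, …, w (q-1))`. -/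
def factorW (p q : ℕ) : List ℕ := (List.range' p (q - p)).map w

/-- The Parikh map ψ, sending a word over `{0,1,3,4}` to `(|x|₀,|x|₁,|x|₃,|x|₄) ∈ ℤ⁴`. -/
def psi (x : List ℕ) : Fin 4 → ℤ :=
  ![(x.count 0 : ℤ), (x.count 1 : ℤ), (x.count 3 : ℤ), (x.count 4 : ℤ)]

/-- The incidence matrix of φ. -/
def M : Matrix (Fin 4) (Fin 4) ℤ :=
  !![1, 0, 0, 1; 0, 0, 1, 1; 1, 1, 0, 0; 0, 1, 0, 0]

/-- `η(p) = |φ(w[0,p))|`. -/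
def eta (p : ℕ) : ℕ := (phi ((List.range p).map w)).length

/-- `σ(p) = ψ(w[0,p))`, the Parikh vector of the prefix of `w` of length `p`. -/
def sigmaW (p : ℕ) : Fin 4 → ℤ := psi ((List.range p).map w)

/-- The parent of a position `x`: the unique `t` with `η(t) ≤ x < η(t+1)`. -/
def par (x : ℕ) : ℕ := Nat.findGreatest (fun t => eta t ≤ x) x

/-- The Lucas-type sequence attached to the quadratic factor `x² - s x + P` of the
characteristic polynomial of `M`. -/
def lucF (s P : ℝ) : ℕ → ℝ
  | 0 => 0
  | 1 => 1
  | (n + 2) => s * lucF s P (n + 1) - P * lucF s P n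

/-- The weight of a letter under the `j`-th linear functional. -/
def wt (s P : ℝ) (j a : ℕ) : ℝ :=
  if a = 0 then lucF s P j
  else if a = 1 then lucF s P (j + 2) - lucF s P (j + 1)
  else if a = 3 then lucF s P (j + 1) - lucF s P j
  else if a = 4 then lucF s P (j + 3) - lucF s P (j + 2) - lucF s P (j + 1) + lucF s P j
  else 0

/-- The `j`-th linear functional on words. -/
def gw (s P : ℝ) (j : ℕ) (u : List ℕ) : ℝ := (u.map (wt s P j)).sum

theorem gw_nil (s P : ℝ) (j : ℕ) : gw s P j [] = 0 := by simp [gw]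

theorem gw_append (s P : ℝ) (j : ℕ) (u v : List ℕ) :
    gw s P j (u ++ v) = gw s P j u + gw s P j v := by simp [gw]

theorem gw_cons (s P : ℝ) (j a : ℕ) (v : List ℕ) :
    gw s P j (a :: v) = wt s P j a + gw s P j v := by simp [gw]

theorem exists_sP : ∃ s P : ℝ, s ^ 3 - 2 * s * P - (s ^ 2 - P) - 2 * s + 2 = 0 ∧
    -P * (s ^ 2 - P) + s * P + 2 * P - 1 = 0 ∧
    0.81478391 ≤ s ∧ s ≤ 0.81478393 ∧ 0.3930826 ≤ P ∧ P ≤ 0.3930828 := by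
  let h : ℝ → ℝ := fun s =>
    -(s^3 - s^2 - 2*s + 2) * (s^2 * (2*s-1) - (s^3 - s^2 - 2*s + 2))
      + s * (s^3 - s^2 - 2*s + 2) * (2*s-1) + 2 * (s^3 - s^2 - 2*s + 2) * (2*s-1) - (2*s-1)^2
  have hc : ContinuousOn h (Set.Icc 0.81478391 0.81478393) := by
    apply Continuous.continuousOn
    fun_prop
  have h0 : (0:ℝ) ∈ h '' Set.Icc 0.81478391 0.81478393 := by
    exact intermediate_value_Icc' (by norm_num) hc ⟨by norm_num [h], by norm_num [h]⟩
  obtain ⟨s, ⟨h1, h2⟩, hs⟩ := h0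
  have hd : 0 < 2 * s - 1 := by linarith
  have hP : (s^3 - s^2 - 2*s + 2) / (2*s-1) * (2*s-1) = s^3 - s^2 - 2*s + 2 :=
    div_mul_cancel₀ _ hd.ne'
  set P := (s^3 - s^2 - 2*s + 2) / (2*s-1) with hPdef
  refine ⟨s, P, by linarith, ?_, h1, h2, ?_, ?_⟩
  · have : (-P * (s ^ 2 - P) + s * P + 2 * P - 1) * (2*s-1)^2 = 0 := by
      rw [← hs]
      simp only [h]
      rw [← hP]
      ring
    rcases mul_eq_zero.1 this with h | h
    · exact h
    · exact absurd h (by positivity)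
  · rw [hPdef, le_div_iff₀ hd]
    obtain ⟨t, rfl⟩ : ∃ t, s = 0.81478392 + t := ⟨s - 0.81478392, by ring⟩
    nlinarith [mul_nonneg (sub_nonneg.2 h1) (sub_nonneg.2 h2), mul_nonneg hd.le (mul_nonneg (sub_nonneg.2 h1) (sub_nonneg.2 h2))]
  · rw [hPdef, div_le_iff₀ hd]
    obtain ⟨t, rfl⟩ : ∃ t, s = 0.81478392 + t := ⟨s - 0.81478392, by ring⟩
    nlinarith [mul_nonneg (sub_nonneg.2 h1) (sub_nonneg.2 h2), mul_nonneg hd.le (mul_nonneg (sub_nonneg.2 h1) (sub_nonneg.2 h2))]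

section
variable {s P : ℝ} (e1 : s ^ 3 - 2 * s * P - (s ^ 2 - P) - 2 * s + 2 = 0)
  (e2 : -P * (s ^ 2 - P) + s * P + 2 * P - 1 = 0)

theorem lucF_succ (s P : ℝ) (n : ℕ) :
    lucF s P (n + 2) = s * lucF s P (n + 1) - P * lucF s P n := rfl

theorem lucF_rec (e1 : s ^ 3 - 2 * s * P - (s ^ 2 - P) - 2 * s + 2 = 0)
    (e2 : -P * (s ^ 2 - P) + s * P + 2 * P - 1 = 0) (n : ℕ) :
    lucF s P (n + 4) =
      lucF s P (n + 3) + 2 * lucF s P (n + 2) - 2 * lucF s P (n + 1) + lucF s P n := by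
  rw [lucF_succ s P (n + 2), lucF_succ s P (n + 1), lucF_succ s P n]
  linear_combination lucF s P (n + 1) * e1 + lucF s P n * e2

theorem lucF_four (s P : ℝ) (n : ℕ) :
    lucF s P (n + 4) =
      (s ^ 3 - 2 * s * P) * lucF s P (n + 1) - P * (s ^ 2 - P) * lucF s P n := by
  rw [lucF_succ s P (n + 2), lucF_succ s P (n + 1), lucF_succ s P n]
  ring

theorem wt_four (s P : ℝ) (j a : ℕ) :
    wt s P (j + 4) a =
      (s ^ 3 - 2 * s * P) * wt s P (j + 1) a - P * (s ^ 2 - P) * wt s P j a := by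
  have h0 := lucF_four s P j
  have h1 := lucF_four s P (j + 1)
  have h2 := lucF_four s P (j + 2)
  have h3 := lucF_four s P (j + 3)
  simp only [Nat.add_assoc, Nat.reduceAdd] at h0 h1 h2 h3
  unfold wt
  simp only [Nat.add_assoc, Nat.reduceAdd]
  split_ifs
  · linear_combination h0
  · linear_combination h2 - h1
  · linear_combination h1 - h0
  · linear_combination h3 - h2 - h1 + h0
  · ring

theorem gw_four (s P : ℝ) (j : ℕ) (u : List ℕ) :
    gw s P (j + 4) u =
      (s ^ 3 - 2 * s * P) * gw s P (j + 1) u - P * (s ^ 2 - P) * gw s P j u := by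
  induction u with
  | nil => simp [gw_nil]
  | cons a u ih =>
    rw [gw_cons, gw_cons, gw_cons, ih, wt_four]
    ring

theorem gw_phiLetter (e1 : s ^ 3 - 2 * s * P - (s ^ 2 - P) - 2 * s + 2 = 0)
    (e2 : -P * (s ^ 2 - P) + s * P + 2 * P - 1 = 0) (j a : ℕ) :
    gw s P j (phiLetter a) = wt s P (j + 1) a := by
  have h := lucF_rec e1 e2 j
  unfold phiLetter
  split
  · simp [gw, wt]
  · simp [gw, wt]
  · simp [gw, wt]
  · simp [gw, wt]; linarith
  · simp_all [gw, wt]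

theorem gw_phi (e1 : s ^ 3 - 2 * s * P - (s ^ 2 - P) - 2 * s + 2 = 0)
    (e2 : -P * (s ^ 2 - P) + s * P + 2 * P - 1 = 0) (j : ℕ) (u : List ℕ) :
    gw s P j (phi u) = gw s P (j + 1) u := by
  induction u with
  | nil => simp [gw, phi]
  | cons a u ih =>
    have : phi (a :: u) = phiLetter a ++ phi u := by simp [phi]
    rw [this, gw_append, gw_cons, ih, gw_phiLetter e1 e2]

end

/-- A word position is governed by its parent position. -/
theorem phi_split (v : List ℕ) : ∀ (u r : List ℕ) (a : ℕ), phi v = u ++ a :: r →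
    ∃ v1 b v2 c d, v = v1 ++ b :: v2 ∧ u = phi v1 ++ c ∧ phiLetter b = c ++ a :: d := by
  induction v with
  | nil => intro u r a h; simp [phi] at h
  | cons b v ih =>
    intro u r a h
    have hb : phi (b :: v) = phiLetter b ++ phi v := by simp [phi]
    have key : ∀ u', u = phiLetter b ++ u' → phi v = u' ++ a :: r → 
        ∃ v1 b' v2 c d, b :: v = v1 ++ b' :: v2 ∧ u = phi v1 ++ c ∧ phiLetter b' = c ++ a :: d := by
      intro u' h1 h2
      obtain ⟨v1, b', v2, c, d, i1, i2, i3⟩ := ih u' r a h2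
      exact ⟨b :: v1, b', v2, c, d, by simp [i1], by simp [h1, i2, phi], i3⟩
    rw [hb, List.append_eq_append_iff] at h
    rcases h with ⟨u', h1, h2⟩ | ⟨c', h1, h2⟩
    · exact key u' h1 h2
    · cases c' with
      | nil => exact key [] (by simpa using h1.symm) (by simpa using h2.symm)
      | cons x d =>
        simp only [List.cons_append, List.cons.injEq] at h2
        exact ⟨[], b, v, u, d, rfl, by simp [phi], by rw [h1, h2.1]⟩

/-- Letters of the alphabet. -/
def okL (a : ℕ) : Prop := a = 0 ∨ a = 1 ∨ a = 3 ∨ a = 4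

theorem phi_ok (v : List ℕ) : ∀ a ∈ phi v, okL a := by
  intro a ha
  simp only [phi, List.mem_flatMap] at ha
  obtain ⟨b, -, hb⟩ := ha
  unfold phiLetter at hb
  unfold okL
  split at hb <;> simp at hb <;> omega

theorem phi_len (v : List ℕ) (h : ∀ a ∈ v, okL a) : v.length ≤ (phi v).length := by
  induction v with
  | nil => simp
  | cons a v ih =>
    have hb : phi (a :: v) = phiLetter a ++ phi v := by simp [phi]
    have h1 := ih fun b hb => h b (by simp [hb])
    have h2 : 1 ≤ (phiLetter a).length := by
      rcases h a (by simp) with rfl | rfl | rfl | rfl <;> simp [phiLetter]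
    rw [hb, List.length_append, List.length_cons]
    omega

theorem iter_ok (k : ℕ) : (∀ a ∈ phi^[k] [0], okL a) ∧ (∃ t, phi^[k] [0] = 0 :: t) ∧
    k + 1 ≤ (phi^[k] [0]).length := by
  induction k with
  | zero => simp [okL]
  | succ k ih =>
    obtain ⟨h1, ⟨t, ht⟩, h3⟩ := ih
    rw [Function.iterate_succ_apply']
    refine ⟨phi_ok _, ?_⟩
    rw [ht] at h1 h3 ⊢
    have hb : phi (0 :: t) = 0 :: 3 :: phi t := by simp [phi, phiLetter]
    have := phi_len t fun b hb => h1 b (by simp [hb])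
    rw [hb]
    refine ⟨⟨_, rfl⟩, ?_⟩
    simp only [List.length_cons] at h3 ⊢
    omega

theorem phi_prefix {u v : List ℕ} (h : u <+: v) : phi u <+: phi v := by
  obtain ⟨r, rfl⟩ := h
  exact ⟨phi r, by simp [phi]⟩

theorem iter_prefix (k : ℕ) : phi^[k] [0] <+: phi^[k + 1] [0] := by
  induction k with
  | zero => exact ⟨[3], by simp [phi, phiLetter]⟩
  | succ k ih =>
    rw [Function.iterate_succ_apply', Function.iterate_succ_apply' phi (k + 1)]
    exact phi_prefix ih

theorem iter_prefix_le {k m : ℕ} (h : k ≤ m) : phi^[k] [0] <+: phi^[m] [0] := by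
  induction m, h using Nat.le_induction with
  | base => exact List.prefix_rfl
  | succ m _ ih => exact ih.trans (iter_prefix m)

theorem w_eq {n k : ℕ} (h : n + 1 ≤ k) : (phi^[k] [0])[n]? = some (w n) := by
  have h1 := iter_prefix_le h
  have h2 : n < (phi^[n + 1] [0]).length := by have := (iter_ok (n + 1)).2.2; omega
  obtain ⟨r, hr⟩ := h1
  rw [← hr, List.getElem?_append_left h2, w, List.getD_eq_getElem _ _ h2, List.getElem?_eq_getElem h2]

theorem pre_eq (p : ℕ) : ∃ a r, phi^[p] [0] = (List.range p).map w ++ a :: r := by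
  have hl := (iter_ok p).2.2
  have h1 : (List.range p).map w = (phi^[p] [0]).take p := by
    apply List.ext_getElem?
    intro i
    by_cases hi : i < p
    · rw [List.getElem?_take_of_lt hi, w_eq hi]
      simp [hi]
    · rw [List.getElem?_eq_none (by simp; omega), List.getElem?_eq_none (by simp; omega)]
  have h2 : (phi^[p] [0]).drop p ≠ [] := by
    intro h
    have := List.drop_eq_nil_iff.1 h
    omega
  obtain ⟨a, r, har⟩ := List.exists_cons_of_ne_nil h2
  refine ⟨a, r, ?_⟩
  rw [h1, ← har, List.take_append_drop]

theorem w_ok (n : ℕ) : okL (w n) :=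
  (iter_ok (n + 1)).1 _ (List.mem_of_getElem? (w_eq le_rfl))

theorem counts (s P : ℝ) (x : List ℕ) (h : ∀ a ∈ x, okL a) :
    x.length = x.count 0 + x.count 1 + x.count 3 + x.count 4 ∧
    x.sum = x.count 1 + 3 * x.count 3 + 4 * x.count 4 ∧
    ∀ j, gw s P j x = x.count 0 * wt s P j 0 + x.count 1 * wt s P j 1 +
      x.count 3 * wt s P j 3 + x.count 4 * wt s P j 4 := by
  induction x with
  | nil => simp [gw]
  | cons a x ih =>
    obtain ⟨h1, h2, h3⟩ := ih fun b hb => h b (by simp [hb])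
    rcases h a (by simp) with rfl | rfl | rfl | rfl
    all_goals
      refine ⟨?_, ?_, fun j => ?_⟩
      · simp; omega
      · simp; omega
      · rw [gw_cons, h3 j]; simp; ring

theorem pre_append {p q : ℕ} (h : p ≤ q) :
    (List.range q).map w = (List.range p).map w ++ factorW p q := by
  unfold factorW
  rw [← List.map_append, List.range_eq_range', List.range_eq_range']
  congr 1
  obtain ⟨d, rfl⟩ := Nat.exists_eq_add_of_le h
  rw [Nat.add_sub_cancel_left]
  have := List.range'_append (s := 0) (m := p) (n := d) (step := 1)
  simpa using this.symm

/-- Tabulated bounds on the functionals, according to the letter that follows. -/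
def Bd (a : ℕ) (g : ℕ → ℝ) : Prop :=
  (a = 0 ∧ -2048 ≤ 10000 * g 0 ∧ 10000 * g 0 ≤ 7835 ∧
    -2048 ≤ 10000 * g 1 ∧ 10000 * g 1 ≤ 2102 ∧
    -2048 ≤ 10000 * g 2 ∧ 10000 * g 2 ≤ 422 ∧
    -2002 ≤ 10000 * g 3 ∧ 10000 * g 3 ≤ 422 ∧
    -1050 ≤ 10000 * g 4 ∧ 10000 * g 4 ≤ 422 ∧
    -124 ≤ 10000 * g 5 ∧ 10000 * g 5 ≤ 422 ∧
    -91 ≤ 10000 * g 6 ∧ 10000 * g 6 ≤ 422 ∧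
    -91 ≤ 10000 * g 7 ∧ 10000 * g 7 ≤ 322) ∨
  (a = 1 ∧ -198 ≤ 10000 * g 0 ∧ 10000 * g 0 ≤ 10423 ∧
    3437 ≤ 10000 * g 1 ∧ 10000 * g 1 ≤ 12103 ∧
    1656 ≤ 10000 * g 2 ∧ 10000 * g 2 ≤ 7835 ∧
    -1122 ≤ 10000 * g 3 ∧ 10000 * g 3 ≤ 2102 ∧
    -2048 ≤ 10000 * g 4 ∧ 10000 * g 4 ≤ -314 ∧
    -2002 ≤ 10000 * g 5 ∧ 10000 * g 5 ≤ -607 ∧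
    -1050 ≤ 10000 * g 6 ∧ 10000 * g 6 ≤ -58 ∧
    -124 ≤ 10000 * g 7 ∧ 10000 * g 7 ≤ 320) ∨
  (a = 3 ∧ -12004 ≤ 10000 * g 0 ∧ 10000 * g 0 ≤ 2102 ∧
    -198 ≤ 10000 * g 1 ∧ 10000 * g 1 ≤ 10423 ∧
    3437 ≤ 10000 * g 2 ∧ 10000 * g 2 ≤ 8571 ∧
    1656 ≤ 10000 * g 3 ∧ 10000 * g 3 ≤ 4131 ∧
    -1122 ≤ 10000 * g 4 ∧ 10000 * g 4 ≤ 1223 ∧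
    -1969 ≤ 10000 * g 5 ∧ 10000 * g 5 ≤ -314 ∧
    -1230 ≤ 10000 * g 6 ∧ 10000 * g 6 ≤ -607 ∧
    -568 ≤ 10000 * g 7 ∧ 10000 * g 7 ≤ -58) ∨
  (a = 4 ∧ 3437 ≤ 10000 * g 0 ∧ 10000 * g 0 ≤ 12103 ∧
    1656 ≤ 10000 * g 1 ∧ 10000 * g 1 ≤ 7835 ∧
    -1122 ≤ 10000 * g 2 ∧ 10000 * g 2 ≤ 2102 ∧
    -2048 ≤ 10000 * g 3 ∧ 10000 * g 3 ≤ -314 ∧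
    -2002 ≤ 10000 * g 4 ∧ 10000 * g 4 ≤ -607 ∧
    -1050 ≤ 10000 * g 5 ∧ 10000 * g 5 ≤ -58 ∧
    -124 ≤ 10000 * g 6 ∧ 10000 * g 6 ≤ 320 ∧
    89 ≤ 10000 * g 7 ∧ 10000 * g 7 ≤ 422)

section
variable {s P : ℝ}

theorem numF (e1 : s ^ 3 - 2 * s * P - (s ^ 2 - P) - 2 * s + 2 = 0)
    (e2 : -P * (s ^ 2 - P) + s * P + 2 * P - 1 = 0)
    (h1 : 0.81478391 ≤ s) (h2 : s ≤ 0.81478393) (h3 : 0.3930826 ≤ P) (h4 : P ≤ 0.3930828) :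
    ∃ y, 0.2707899 ≤ y ∧ y ≤ 0.2707903 ∧ y = s ^ 2 - P ∧
    lucF s P 0 = 0 ∧ lucF s P 1 = 1 ∧ lucF s P 2 = s ∧ lucF s P 3 = y ∧
    lucF s P 4 = y + 2 * s - 2 := by
  refine ⟨s ^ 2 - P, by nlinarith, by nlinarith, rfl, rfl, rfl, ?_, ?_, ?_⟩
  · simp [lucF]
  · simp [lucF]; ring
  · rw [lucF_rec e1 e2 0]; simp [lucF]; ring

theorem numbers (e1 : s ^ 3 - 2 * s * P - (s ^ 2 - P) - 2 * s + 2 = 0)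
    (e2 : -P * (s ^ 2 - P) + s * P + 2 * P - 1 = 0)
    (h1 : 0.81478391 ≤ s) (h2 : s ≤ 0.81478393) (h3 : 0.3930826 ≤ P) (h4 : P ≤ 0.3930828) :
    (wt s P 0 0 = 0 ∧ (9999 ≤ 10000 * wt s P 1 0 ∧ 10000 * wt s P 1 0 ≤ 10001) ∧ (8147 ≤ 10000 * wt s P 2 0 ∧ 10000 * wt s P 2 0 ≤ 8149) ∧ (2707 ≤ 10000 * wt s P 3 0 ∧ 10000 * wt s P 3 0 ≤ 2709) ∧ (-997 ≤ 10000 * wt s P 4 0 ∧ 10000 * wt s P 4 0 ≤ -996) ∧ (-1877 ≤ 10000 * wt s P 5 0 ∧ 10000 * wt s P 5 0 ≤ -1875) ∧ (-1138 ≤ 10000 * wt s P 6 0 ∧ 10000 * wt s P 6 0 ≤ -1136) ∧ (-190 ≤ 10000 * wt s P 7 0 ∧ 10000 * wt s P 7 0 ≤ -188)) ∧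
    ((-15441 ≤ 10000 * wt s P 0 4 ∧ 10000 * wt s P 0 4 ≤ -15439) ∧ (-1853 ≤ 10000 * wt s P 1 4 ∧ 10000 * wt s P 1 4 ≤ -1851) ∧ (4559 ≤ 10000 * wt s P 2 4 ∧ 10000 * wt s P 2 4 ≤ 4561) ∧ (4443 ≤ 10000 * wt s P 3 4 ∧ 10000 * wt s P 3 4 ≤ 4444) ∧ (1827 ≤ 10000 * wt s P 4 4 ∧ 10000 * wt s P 4 4 ≤ 1829) ∧ (-258 ≤ 10000 * wt s P 5 4 ∧ 10000 * wt s P 5 4 ≤ -256) ∧ (-929 ≤ 10000 * wt s P 6 4 ∧ 10000 * wt s P 6 4 ≤ -927) ∧ (-656 ≤ 10000 * wt s P 7 4 ∧ 10000 * wt s P 7 4 ≤ -654)) := by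
  obtain ⟨y, y1, y2, y3, f0, f1, f2, f3, f4⟩ := numF e1 e2 h1 h2 h3 h4
  have f5 := lucF_rec e1 e2 1
  have f6 := lucF_rec e1 e2 2
  have f7 := lucF_rec e1 e2 3
  have f8 := lucF_rec e1 e2 4
  have f9 := lucF_rec e1 e2 5
  have f10 := lucF_rec e1 e2 6
  simp only [Nat.reduceAdd] at f5 f6 f7 f8 f9 f10
  simp only [wt, if_true, Nat.reduceAdd, Nat.zero_add, OfNat.ofNat_ne_zero, if_false,
    show (4 : ℕ) ≠ 1 by decide, show (4 : ℕ) ≠ 3 by decide]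
  refine ⟨⟨f0, ?_, ?_, ?_, ?_, ?_, ?_, ?_⟩, ?_, ?_, ?_, ?_, ?_, ?_, ?_, ?_⟩ <;>
    constructor <;> linarith

/-- The bound on the eighth functional, obtained from the quadratic recurrence. -/
theorem closure_bd (h1 : 0.81478391 ≤ s) (h2 : s ≤ 0.81478393)
    (h3 : 0.3930826 ≤ P) (h4 : P ≤ 0.3930828) (g : ℕ → ℝ) (a : ℕ) (hb : Bd a g)
    (h8 : g 8 = (s ^ 3 - 2 * s * P) * g 5 - P * (s ^ 2 - P) * g 4) :
    |10000 * g 8 - (-0.0996420 * (10000 * g 5) - 0.1064429 * (10000 * g 4))| ≤ 2 := by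
  have b5 : |10000 * g 5| ≤ 3000 := by
    rw [abs_le]
    rcases hb with h | h | h | h <;> constructor <;> linarith
  have b4 : |10000 * g 4| ≤ 3000 := by
    rw [abs_le]
    rcases hb with h | h | h | h <;> constructor <;> linarith
  have s2 : 0.66387281 ≤ s ^ 2 ∧ s ^ 2 ≤ 0.66387287 := by constructor <;> nlinarith
  have s3 : 0.540912 ≤ s ^ 3 ∧ s ^ 3 ≤ 0.540914 := by
    have : s ^ 3 = s * s ^ 2 := by ring
    rw [this]
    constructor <;> nlinarith [s2.1, s2.2]
  have sP : 0.320276 ≤ s * P ∧ s * P ≤ 0.320279 := by constructor <;> nlinarith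
  have PP : 0.106442 ≤ P * (s ^ 2 - P) ∧ P * (s ^ 2 - P) ≤ 0.106444 := by
    constructor <;> nlinarith [s2.1, s2.2]
  have c5 : |s ^ 3 - 2 * s * P + 0.0996420| ≤ 0.0001 := by
    rw [abs_le]; constructor <;> nlinarith [s3.1, s3.2, sP.1, sP.2]
  have c4 : |P * (s ^ 2 - P) - 0.1064429| ≤ 0.0001 := by
    rw [abs_le]; constructor <;> linarith [PP.1, PP.2]
  have m5 : |(s ^ 3 - 2 * s * P + 0.0996420) * (10000 * g 5)| ≤ 0.0001 * 3000 := by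
    rw [abs_mul]; exact mul_le_mul c5 b5 (abs_nonneg _) (by norm_num)
  have m4 : |(P * (s ^ 2 - P) - 0.1064429) * (10000 * g 4)| ≤ 0.0001 * 3000 := by
    rw [abs_mul]; exact mul_le_mul c4 b4 (abs_nonneg _) (by norm_num)
  rw [abs_le] at m5 m4 ⊢
  rw [h8]
  constructor <;> nlinarith [m5.1, m5.2, m4.1, m4.2]

set_option maxHeartbeats 4000000 in
theorem step_bd (e1 : s ^ 3 - 2 * s * P - (s ^ 2 - P) - 2 * s + 2 = 0)
    (e2 : -P * (s ^ 2 - P) + s * P + 2 * P - 1 = 0)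
    (h1 : 0.81478391 ≤ s) (h2 : s ≤ 0.81478393) (h3 : 0.3930826 ≤ P) (h4 : P ≤ 0.3930828)
    (g g' : ℕ → ℝ) (a b : ℕ) (c d : List ℕ) (hb : Bd b g)
    (h8 : g 8 = (s ^ 3 - 2 * s * P) * g 5 - P * (s ^ 2 - P) * g 4)
    (hc : phiLetter b = c ++ a :: d) (hg : ∀ j, g' j = g (j + 1) + gw s P j c) : Bd a g' := by
  have hcl := abs_le.1 (closure_bd h1 h2 h3 h4 g b hb h8)
  obtain ⟨hcl1, hcl2⟩ := hcl
  obtain ⟨⟨n0, n1, n2, n3, n4, n5, n6, n7⟩, k0, k1, k2, k3, k4, k5, k6, k7⟩ :=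
    numbers e1 e2 h1 h2 h3 h4
  have q0 := hg 0
  have q1 := hg 1
  have q2 := hg 2
  have q3 := hg 3
  have q4 := hg 4
  have q5 := hg 5
  have q6 := hg 6
  have q7 := hg 7
  clear hg h8 e1 e2
  simp only [Nat.reduceAdd] at q0 q1 q2 q3 q4 q5 q6 q7
  unfold Bd at hb
  rcases hb with ⟨rfl, hb⟩ | ⟨rfl, hb⟩ | ⟨rfl, hb⟩ | ⟨rfl, hb⟩ <;>
    simp only [phiLetter] at hc <;>
    rcases c with _ | ⟨x, _ | ⟨y, c⟩⟩ <;> simp at hc <;>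
    (try obtain ⟨rfl, hc⟩ := hc) <;> (try obtain ⟨rfl, hc⟩ := hc) <;> (try subst hc) <;>
    simp only [gw, List.map_cons, List.map_nil, List.sum_cons, List.sum_nil] at q0 q1 q2 q3 q4 q5 q6 q7
  · refine Or.inl ⟨rfl, ?_⟩
    refine ⟨?_, ?_, ?_, ?_, ?_, ?_, ?_, ?_, ?_, ?_, ?_, ?_, ?_, ?_, ?_, ?_⟩ <;> linarith
  · refine Or.inr (Or.inr (Or.inl ⟨rfl, ?_⟩))
    refine ⟨?_, ?_, ?_, ?_, ?_, ?_, ?_, ?_, ?_, ?_, ?_, ?_, ?_, ?_, ?_, ?_⟩ <;> linarith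
  · refine Or.inr (Or.inr (Or.inr ⟨rfl, ?_⟩))
    refine ⟨?_, ?_, ?_, ?_, ?_, ?_, ?_, ?_, ?_, ?_, ?_, ?_, ?_, ?_, ?_, ?_⟩ <;> linarith
  · refine Or.inr (Or.inr (Or.inl ⟨rfl, ?_⟩))
    refine ⟨?_, ?_, ?_, ?_, ?_, ?_, ?_, ?_, ?_, ?_, ?_, ?_, ?_, ?_, ?_, ?_⟩ <;> linarith
  · refine Or.inr (Or.inl ⟨rfl, ?_⟩)
    refine ⟨?_, ?_, ?_, ?_, ?_, ?_, ?_, ?_, ?_, ?_, ?_, ?_, ?_, ?_, ?_, ?_⟩ <;> linarith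
  · refine Or.inl ⟨rfl, ?_⟩
    refine ⟨?_, ?_, ?_, ?_, ?_, ?_, ?_, ?_, ?_, ?_, ?_, ?_, ?_, ?_, ?_, ?_⟩ <;> linarith
  · refine Or.inr (Or.inl ⟨rfl, ?_⟩)
    refine ⟨?_, ?_, ?_, ?_, ?_, ?_, ?_, ?_, ?_, ?_, ?_, ?_, ?_, ?_, ?_, ?_⟩ <;> linarith

theorem bounds_iter (e1 : s ^ 3 - 2 * s * P - (s ^ 2 - P) - 2 * s + 2 = 0)
    (e2 : -P * (s ^ 2 - P) + s * P + 2 * P - 1 = 0)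
    (h1 : 0.81478391 ≤ s) (h2 : s ≤ 0.81478393) (h3 : 0.3930826 ≤ P) (h4 : P ≤ 0.3930828) (k : ℕ) : ∀ (u r : List ℕ) (a : ℕ), phi^[k] [0] = u ++ a :: r →
    Bd a (fun j => gw s P j u) := by
  induction k with
  | zero =>
    intro u r a h
    have hu : u = [] ∧ a = 0 := by
      cases u with
      | nil => simp at h; exact ⟨rfl, h.1.symm⟩
      | cons x u => simp at h
    obtain ⟨rfl, rfl⟩ := hu
    refine Or.inl ⟨rfl, ?_⟩
    simp only [gw_nil]
    norm_num
  | succ k ih =>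
    intro u r a h
    rw [Function.iterate_succ_apply'] at h
    obtain ⟨v1, b, v2, c, d, i1, i2, i3⟩ := phi_split _ u r a h
    refine step_bd e1 e2 h1 h2 h3 h4 _ _ a b c d (ih v1 v2 b i1) (gw_four s P 4 v1) i3 ?_
    intro j
    rw [i2, gw_append, gw_phi e1 e2]

theorem bounds_pre (e1 : s ^ 3 - 2 * s * P - (s ^ 2 - P) - 2 * s + 2 = 0)
    (e2 : -P * (s ^ 2 - P) + s * P + 2 * P - 1 = 0)
    (h1 : 0.81478391 ≤ s) (h2 : s ≤ 0.81478393) (h3 : 0.3930826 ≤ P) (h4 : P ≤ 0.3930828) (p : ℕ) :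
    (-12004 ≤ 10000 * gw s P 0 ((List.range p).map w) ∧
      10000 * gw s P 0 ((List.range p).map w) ≤ 12103) ∧
    (-2048 ≤ 10000 * gw s P 1 ((List.range p).map w) ∧
      10000 * gw s P 1 ((List.range p).map w) ≤ 12103) ∧
    (-2048 ≤ 10000 * gw s P 2 ((List.range p).map w) ∧
      10000 * gw s P 2 ((List.range p).map w) ≤ 8571) := by
  obtain ⟨a, r, h⟩ := pre_eq p
  have hb := bounds_iter e1 e2 h1 h2 h3 h4 p _ r a h
  rcases hb with hb | hb | hb | hb <;>
    refine ⟨⟨?_, ?_⟩, ⟨?_, ?_⟩, ⟨?_, ?_⟩⟩ <;> linarith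

end

set_option maxHeartbeats 4000000 in
/-- If `b` and `c` are factors of `w` with the same length and sum,
then `ψ(b) − ψ(c)` is `(0,0,0,0)`, `(1,−2,2,−1)`, or `(−1,2,−2,1)`. -/
theorem parikh_difference_of_equal_blocks (p q p' q' : ℕ) (hpq : p ≤ q) (hpq' : p' ≤ q')
    (hlen : (factorW p q).length = (factorW p' q').length)
    (hsum : (factorW p q).sum = (factorW p' q').sum) :
    psi (factorW p q) - psi (factorW p' q') ∈
      ({0, ![(1 : ℤ), -2, 2, -1], ![(-1 : ℤ), 2, -2, 1]} : Set (Fin 4 → ℤ)) := by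
  obtain ⟨s, P, e1, e2, h1, h2, h3, h4⟩ := exists_sP
  have bp := bounds_pre e1 e2 h1 h2 h3 h4 p
  have bq := bounds_pre e1 e2 h1 h2 h3 h4 q
  have bp' := bounds_pre e1 e2 h1 h2 h3 h4 p'
  have bq' := bounds_pre e1 e2 h1 h2 h3 h4 q'
  rw [pre_append hpq] at bq
  rw [pre_append hpq'] at bq'
  simp only [gw_append] at bq bq'
  have hok : ∀ m n, ∀ a ∈ factorW m n, okL a := by
    intro m n a ha
    simp only [factorW, List.mem_map] at ha
    obtain ⟨i, -, rfl⟩ := ha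
    exact w_ok i
  obtain ⟨l1, l2, l3⟩ := counts s P (factorW p q) (hok p q)
  obtain ⟨m1, m2, m3⟩ := counts s P (factorW p' q') (hok p' q')
  simp only [psi]
  generalize factorW p q = x at *
  generalize factorW p' q' = x' at *
  have t0 : |gw s P 0 x - gw s P 0 x'| ≤ 4.8214 := by
    rw [abs_le]; constructor <;> linarith
  have t1 : |gw s P 1 x - gw s P 1 x'| ≤ 2.8302 := by
    rw [abs_le]; constructor <;> linarith
  have t2 : |gw s P 2 x - gw s P 2 x'| ≤ 2.1238 := by
    rw [abs_le]; constructor <;> linarith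
  clear bp bq bp' bq'
  obtain ⟨y, y1, y2, y3, f0, f1, f2, f3, f4⟩ := numF e1 e2 h1 h2 h3 h4
  have f5 := lucF_rec e1 e2 1
  obtain ⟨c, hc⟩ : ∃ c : ℤ, c = (x.count 3 : ℤ) - x'.count 3 := ⟨_, rfl⟩
  obtain ⟨d, hd⟩ : ∃ d : ℤ, d = (x.count 4 : ℤ) - x'.count 4 := ⟨_, rfl⟩
  have ha : (x.count 0 : ℤ) - x'.count 0 = 2 * c + 3 * d := by omega
  have hb : (x.count 1 : ℤ) - x'.count 1 = -3 * c - 4 * d := by omega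
  have goalD : (c = 0 ∧ d = 0) ∨ (c = 2 ∧ d = -1) ∨ (c = -2 ∧ d = 1) := by
    have ha' : (x.count 0 : ℝ) - x'.count 0 = 2 * c + 3 * d := by exact_mod_cast ha
    have hb' : (x.count 1 : ℝ) - x'.count 1 = -3 * c - 4 * d := by exact_mod_cast hb
    have hc' : (x.count 3 : ℝ) - x'.count 3 = c := by exact_mod_cast hc.symm
    have hd' : (x.count 4 : ℝ) - x'.count 4 = d := by exact_mod_cast hd.symm
    have key : ∀ j, gw s P j x - gw s P j x' =
        c * (2 * wt s P j 0 - 3 * wt s P j 1 + wt s P j 3) +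
        d * (3 * wt s P j 0 - 4 * wt s P j 1 + wt s P j 4) := by
      intro j
      rw [l3, m3]
      linear_combination wt s P j 0 * ha' + wt s P j 1 * hb' + wt s P j 3 * hc' +
        wt s P j 4 * hd'
    have k0 := key 0
    have k1 := key 1
    have k2 := key 2
    simp only [wt, if_true, Nat.reduceAdd, Nat.zero_add, OfNat.ofNat_ne_zero, if_false,
      one_ne_zero, show (4 : ℕ) ≠ 1 by decide, show (4 : ℕ) ≠ 3 by decide,
      show (3 : ℕ) ≠ 1 by decide] at k0 k1 k2 f5
    simp only [f5, f4, f3, f2, f1, f0] at k0 k1 k2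
    rw [k0] at t0
    rw [k1] at t1
    rw [k2] at t2
    clear key k0 k1 k2 l3 m3 f0 f1 f2 f3 f4 f5 y3 e1 e2 ha' hb' hc' hd'
    -- first coarse bounds, then finitely many cases
    have approx : ∀ z K κ : ℝ, |K - κ| ≤ 0.0001 → |z * K - κ * z| ≤ 0.0001 * |z| := by
      intro z K κ h
      rw [show z * K - κ * z = (K - κ) * z by ring, abs_mul]
      exact mul_le_mul_of_nonneg_right h (abs_nonneg _)
    have a1 := abs_le.1 (approx c _ 1.5556 (show |(2 * 0 - 3 * (s - 1) + (1 - 0)) - 1.5556| ≤ 0.0001 by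
      rw [abs_le]; constructor <;> linarith))
    have a2 := abs_le.1 (approx d _ (-0.8031) (show |(3 * 0 - 4 * (s - 1) + (y - s - 1 + 0)) - (-0.8031)| ≤ 0.0001 by
      rw [abs_le]; constructor <;> linarith))
    have a3 := abs_le.1 (approx c _ 3.4468 (show |(2 * 1 - 3 * (y - s) + (s - 1)) - 3.4468| ≤ 0.0001 by
      rw [abs_le]; constructor <;> linarith))
    have a4 := abs_le.1 (approx d _ 4.9908 (show |(3 * 1 - 4 * (y - s) + (y + 2 * s - 2 - y - s + 1)) - 4.9908| ≤ 0.0001 by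
      rw [abs_le]; constructor <;> linarith))
    rw [abs_le] at t0 t1 t2
    have hcd : (-3 < (c : ℝ) ∧ (c : ℝ) < 3) ∧ (-2 < (d : ℝ) ∧ (d : ℝ) < 2) := by
      rcases abs_cases (c : ℝ) with ⟨u1, u2⟩ | ⟨u1, u2⟩ <;>
        rcases abs_cases (d : ℝ) with ⟨v1, v2⟩ | ⟨v1, v2⟩ <;>
        rw [u1] at a1 a3 <;> rw [v1] at a2 a4 <;>
        refine ⟨⟨?_, ?_⟩, ?_, ?_⟩ <;> linarith
    clear a1 a2 a3 a4 approx ha hb hc hd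
    obtain ⟨⟨c1, c2⟩, d1, d2⟩ := hcd
    have c1 : -3 < c := by exact_mod_cast c1
    have c2 : c < 3 := by exact_mod_cast c2
    have d1 : -2 < d := by exact_mod_cast d1
    have d2 : d < 2 := by exact_mod_cast d2
    interval_cases c <;> interval_cases d <;> first
      | decide
      | (exfalso; push_cast at t0 t1 t2; linarith)
  simp only [Set.mem_insert_iff, Set.mem_singleton_iff]
  rcases goalD with ⟨rfl, rfl⟩ | ⟨rfl, rfl⟩ | ⟨rfl, rfl⟩
  · left
    ext i
    fin_cases i <;> simp <;> omega
  · right; left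
    ext i
    fin_cases i <;> simp <;> omega
  · right; right
    ext i
    fin_cases i <;> simp <;> omega
end

section
/- Let b₀ = w[p,q) and c₀ = w[p',q') be factors of w with the same length and the same sum of letters, and let b_i := w[par^i(p), par^i(q)) and c_i := w[par^i(p'), par^i(q')) be their ancestral sequences. Then for every i ∈ ℕ, the Euclidean norm satisfies ‖ψ(b_i) − ψ(c_i)‖ ≤ 6.28. -/
namespace APD

/-- The prefix of `w` of length `n`. -/
def pre (n : ℕ) : List ℕ := (List.range n).map w

/-- Letters of the alphabet. -/
def Lt (n : ℕ) : Prop := n = 0 ∨ n = 1 ∨ n = 3 ∨ n = 4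

lemma phi_append (x y : List ℕ) : phi (x ++ y) = phi x ++ phi y := by
  simp [phi]

lemma phiLetter_Lt {a b : ℕ} (h : b ∈ phiLetter a) : Lt b := by
  unfold phiLetter at h
  unfold Lt
  split at h <;> simp at h <;> omega

lemma phiLetter_len {a : ℕ} (h : Lt a) : 1 ≤ (phiLetter a).length := by
  rcases h with rfl | rfl | rfl | rfl <;> simp [phiLetter]

lemma phi_Lt (x : List ℕ) : ∀ b ∈ phi x, Lt b := by
  intro b hb
  simp only [phi, List.mem_flatMap] at hb
  obtain ⟨a, _, h⟩ := hb
  exact phiLetter_Lt h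

lemma phi_len (x : List ℕ) (h : ∀ b ∈ x, Lt b) : x.length ≤ (phi x).length := by
  induction x with
  | nil => simp
  | cons a x ih =>
    have h1 := phiLetter_len (h a (by simp))
    have h2 := ih (fun b hb => h b (by simp [hb]))
    simp only [phi, List.flatMap_cons, List.length_append, List.length_cons] at *
    omega

lemma phi_mono {x y : List ℕ} (h : x <+: y) : phi x <+: phi y := by
  obtain ⟨t, rfl⟩ := h
  rw [phi_append]
  exact List.prefix_append _ _

lemma iter_Lt (k : ℕ) : ∀ b ∈ phi^[k] [0], Lt b := by
  cases k with
  | zero => simp [Lt]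
  | succ k => rw [Function.iterate_succ_apply']; exact phi_Lt _

lemma iter_prefix_succ (k : ℕ) : phi^[k] [0] <+: phi^[k + 1] [0] := by
  induction k with
  | zero => simp [phi, phiLetter]
  | succ k ih =>
    rw [Function.iterate_succ_apply' phi k, Function.iterate_succ_apply' phi (k + 1)]
    exact phi_mono ih

lemma iter_prefix {k m : ℕ} (h : k ≤ m) : phi^[k] [0] <+: phi^[m] [0] := by
  induction m, h using Nat.le_induction with
  | base => exact List.prefix_refl _
  | succ m _ ih => exact ih.trans (iter_prefix_succ m)

lemma iter_head (k : ℕ) : ∃ t, phi^[k] [0] = 0 :: t := by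
  obtain ⟨t, ht⟩ := iter_prefix (Nat.zero_le k)
  exact ⟨t, by simpa using ht.symm⟩

lemma iter_len (k : ℕ) : k + 1 ≤ (phi^[k] [0]).length := by
  induction k with
  | zero => simp
  | succ k ih =>
    obtain ⟨t, ht⟩ := iter_head k
    have hL := iter_Lt k
    rw [Function.iterate_succ_apply']
    rw [ht] at ih hL ⊢
    have := phi_len t (fun b hb => hL b (by simp [hb]))
    simp only [phi, List.flatMap_cons, List.length_append, List.length_cons, phiLetter] at *
    simp only [List.length_nil]
    omega

lemma w_eq {n k : ℕ} (h : n < (phi^[k] [0]).length) : w n = (phi^[k] [0])[n] := by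
  have h1 : n < (phi^[n + 1] [0]).length := by have := iter_len (n + 1); omega
  have : w n = (phi^[n + 1] [0])[n] := by
    rw [w, List.getD_eq_getElem?_getD, List.getElem?_eq_getElem h1, Option.getD_some]
  rw [this]
  rcases le_total k (n + 1) with hk | hk
  · exact ((iter_prefix hk).getElem h).symm
  · exact (iter_prefix hk).getElem h1

lemma w_Lt (n : ℕ) : Lt (w n) := by
  have h1 : n < (phi^[n] [0]).length := by have := iter_len n; omega
  rw [w_eq h1]
  exact iter_Lt n _ (List.getElem_mem _)

lemma pre_length (n : ℕ) : (pre n).length = n := by simp [pre]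

lemma pre_eq_take {n k : ℕ} (h : n ≤ (phi^[k] [0]).length) : pre n = (phi^[k] [0]).take n := by
  apply List.ext_getElem
  · simp [pre_length, h]
  · intro i h1 h2
    rw [pre_length] at h1
    simp only [pre, List.getElem_map, List.getElem_range, List.getElem_take]
    exact w_eq (by omega)

lemma eq_pre {x : List ℕ} {k : ℕ} (h : x <+: phi^[k] [0]) : x = pre x.length := by
  rw [pre_eq_take h.length_le]
  exact (List.prefix_iff_eq_take.1 h)

lemma phi_pre (n : ℕ) : phi (pre n) = pre (eta n) := by
  have h : n ≤ (phi^[n] [0]).length := by have := iter_len n; omega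
  have h2 : pre n <+: phi^[n] [0] := by rw [pre_eq_take h]; exact List.take_prefix _ _
  have h3 := phi_mono h2
  rw [← Function.iterate_succ_apply' phi] at h3
  exact eq_pre h3

lemma pre_succ (n : ℕ) : pre (n + 1) = pre n ++ [w n] := by
  simp [pre, List.range_succ]

lemma eta_succ (n : ℕ) : eta (n + 1) = eta n + (phiLetter (w n)).length := by
  change (phi (pre (n + 1))).length = (phi (pre n)).length + _
  rw [pre_succ, phi_append]
  simp [phi]

lemma eta_lt (n : ℕ) : eta n < eta (n + 1) := by
  rw [eta_succ]
  have := phiLetter_len (w_Lt n)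
  omega

lemma eta_strictMono : StrictMono eta := strictMono_nat_of_lt_succ eta_lt

lemma w_zero : w 0 = 0 := by simp [w, phi, phiLetter]

lemma eta_zero : eta 0 = 0 := by simp [eta, phi]

lemma eta_gt (n : ℕ) : n + 2 ≤ eta (n + 1) := by
  induction n with
  | zero => rw [eta_succ, eta_zero, w_zero]; simp [phiLetter]
  | succ n ih => have := eta_lt (n + 1); omega

lemma par_le (x : ℕ) : eta (par x) ≤ x := by
  have := Nat.findGreatest_spec (P := fun t => eta t ≤ x) (m := 0) (n := x) (Nat.zero_le _)
    (by rw [eta_zero]; omega)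
  exact this

lemma lt_par (x : ℕ) : x < eta (par x + 1) := by
  by_contra h
  have h' : eta (par x + 1) ≤ x := by omega
  have h1 : par x + 1 ≤ x := by have := eta_gt (par x); omega
  have := Nat.le_findGreatest (P := fun t => eta t ≤ x) h1 h'
  change par x + 1 ≤ par x at this
  omega

lemma par_lt {x : ℕ} (h : 0 < x) : par x < x := by
  have := par_le x
  rcases Nat.eq_zero_or_pos (par x) with h0 | h0
  · omega
  · obtain ⟨m, hm⟩ := Nat.exists_eq_succ_of_ne_zero h0.ne'
    have h2 := eta_gt m
    have h3 := eta_strictMono.monotone (show m + 1 ≤ par x by omega)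
    omega

lemma par_mono : Monotone par := by
  intro x y h
  by_contra hc
  have h1 := par_le x
  have h2 := lt_par y
  have h3 := eta_strictMono.monotone (show par y + 1 ≤ par x by omega)
  omega

lemma pre_child (x : ℕ) : ∃ j, ∃ h : j < (phiLetter (w (par x))).length,
    pre x = phi (pre (par x)) ++ (phiLetter (w (par x))).take j ∧
    w x = (phiLetter (w (par x)))[j] := by
  have h1 := par_le x
  have h2 := lt_par x
  set t := par x
  have h3 := eta_succ t
  have key : pre (eta t) ++ phiLetter (w t) = pre (eta (t + 1)) := by
    rw [← phi_pre, ← phi_pre, pre_succ, phi_append]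
    simp [phi]
  have hj : x - eta t < (phiLetter (w t)).length := by omega
  refine ⟨x - eta t, hj, ?_, ?_⟩
  · rw [phi_pre]
    have h4 : pre x = (pre (eta (t + 1))).take x := by
      apply List.ext_getElem
      · simp [pre_length, h2.le]
      · intro i _ _
        simp [pre]
    rw [h4, ← key, List.take_append, pre_length, List.take_of_length_le]
    rw [pre_length]; exact h1
  · have h5 : (pre (eta (t + 1)))[x]'(by rw [pre_length]; exact h2) = w x := by
      simp [pre]
    rw [← h5]
    simp only [← key]
    rw [List.getElem_append_right (by rw [pre_length]; exact h1)]
    simp only [pre_length]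

/-- `v = M v' + (α,0,0,β)`. -/
def Step (v v' : Fin 4 → ℤ) (α β : ℤ) : Prop :=
  v 0 = v' 0 + v' 3 + α ∧ v 1 = v' 2 + v' 3 ∧ v 2 = v' 0 + v' 1 ∧ v 3 = v' 1 + β

lemma psi_append (x y : List ℕ) (j : Fin 4) : psi (x ++ y) j = psi x j + psi y j := by
  fin_cases j <;> simp [psi]

lemma psi_phi (x : List ℕ) : Step (psi (phi x)) (psi x) 0 0 := by
  induction x with
  | nil => simp [phi, psi, Step]
  | cons a x ih =>
    have e : phi (a :: x) = phiLetter a ++ phi x := by simp [phi]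
    have e2 : a :: x = [a] ++ x := rfl
    rw [e, e2]
    unfold Step at *
    simp only [psi_append]
    have : Step (psi (phiLetter a)) (psi [a]) 0 0 := by
      unfold phiLetter
      split
      · simp [psi, Step]
      · simp [psi, Step]
      · simp [psi, Step]
      · simp [psi, Step]
      · rename_i h0 h1 h3 h4
        simp only [psi, Step, List.count_nil, List.count_singleton]
        have g0 : ¬ a = 0 := h0
        have g1 : ¬ a = 1 := h1
        have g3 : ¬ a = 3 := h3
        have g4 : ¬ a = 4 := h4
        simp [g0, g1, g3, g4]
    unfold Step at this
    omega

/-- Admissible transitions: child letter, parent letter, digit. -/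
def Tr (a b : ℕ) (α β : ℤ) : Prop :=
  (a = 0 ∧ b = 0 ∧ α = 0 ∧ β = 0) ∨ (a = 0 ∧ b = 4 ∧ α = 0 ∧ β = 0) ∨
  (a = 1 ∧ b = 3 ∧ α = 0 ∧ β = 0) ∨ (a = 1 ∧ b = 4 ∧ α = 1 ∧ β = 0) ∨
  (a = 3 ∧ b = 0 ∧ α = 1 ∧ β = 0) ∨ (a = 3 ∧ b = 1 ∧ α = 0 ∧ β = 1) ∨
  (a = 4 ∧ b = 1 ∧ α = 0 ∧ β = 0)

lemma sigma_step (x : ℕ) : ∃ α β, Tr (w x) (w (par x)) α β ∧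
    Step (psi (pre x)) (psi (pre (par x))) α β := by
  obtain ⟨j, hj, h1, h2⟩ := pre_child x
  have h3 := psi_phi (pre (par x))
  rw [h1, h2]
  have hL := w_Lt (par x)
  revert hj h2
  generalize w (par x) = b at *
  unfold Step at *
  simp only [psi_append]
  intro hj h2
  clear h1 h2
  rcases hL with rfl | rfl | rfl | rfl <;> simp only [phiLetter, List.length_cons, List.length_nil] at hj <;>
    interval_cases j
  · exact ⟨0, 0, by simp [Tr, phiLetter], by simpa [psi, phiLetter] using h3⟩
  · exact ⟨1, 0, by simp [Tr, phiLetter], by simpa [psi, phiLetter] using h3⟩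
  · exact ⟨0, 0, by simp [Tr, phiLetter], by simpa [psi, phiLetter] using h3⟩
  · exact ⟨0, 1, by simp [Tr, phiLetter], by simpa [psi, phiLetter] using h3⟩
  · exact ⟨0, 0, by simp [Tr, phiLetter], by simpa [psi, phiLetter] using h3⟩
  · exact ⟨0, 0, by simp [Tr, phiLetter], by simpa [psi, phiLetter] using h3⟩
  · exact ⟨1, 0, by simp [Tr, phiLetter], by simpa [psi, phiLetter] using h3⟩

lemma psi_factor {p q : ℕ} (h : p ≤ q) (j : Fin 4) :
    psi (factorW p q) j = psi (pre q) j - psi (pre p) j := by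
  have : pre q = pre p ++ factorW p q := by
    obtain ⟨k, rfl⟩ := Nat.exists_eq_add_of_le h
    simp only [pre, factorW, ← List.map_append, Nat.add_sub_cancel_left]
    congr 1
    rw [List.range_eq_range', List.range_eq_range']
    have := (List.range'_append (s := 0) (m := p) (n := k) (step := 1)).symm
    simpa using this
  rw [this, psi_append]
  ring

lemma len_sum (x : List ℕ) (h : ∀ b ∈ x, Lt b) :
    (x.length : ℤ) = psi x 0 + psi x 1 + psi x 2 + psi x 3 ∧
    (x.sum : ℤ) = psi x 1 + 3 * psi x 2 + 4 * psi x 3 := by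
  induction x with
  | nil => simp [psi]
  | cons a x ih =>
    have ih := ih (fun b hb => h b (by simp [hb]))
    have ha := h a (by simp)
    have e2 : a :: x = [a] ++ x := rfl
    rw [e2]
    simp only [psi_append, List.length_append, List.sum_append, Nat.cast_add]
    have : (([a] : List ℕ).length : ℤ) = psi [a] 0 + psi [a] 1 + psi [a] 2 + psi [a] 3 ∧
      (([a] : List ℕ).sum : ℤ) = psi [a] 1 + 3 * psi [a] 2 + 4 * psi [a] 3 := by
      rcases ha with rfl | rfl | rfl | rfl <;> simp [psi]
    omega

lemma factor_Lt (p q : ℕ) : ∀ b ∈ factorW p q, Lt b := by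
  intro b hb
  simp only [factorW, List.mem_map] at hb
  obtain ⟨n, _, rfl⟩ := hb
  exact w_Lt n

lemma approx_mul {x y x0 y0 e f : ℝ} (h : |x - x0| ≤ e) (h' : |y - y0| ≤ f) :
    |x * y - x0 * y0| ≤ |x0| * f + |y0| * e + e * f := by
  have e1 : x * y - x0 * y0 = x0 * (y - y0) + y0 * (x - x0) + (x - x0) * (y - y0) := by ring
  rw [e1]
  have he : 0 ≤ e := (abs_nonneg _).trans h
  refine (abs_add_three _ _ _).trans ?_
  rw [abs_mul, abs_mul, abs_mul]
  gcongr

lemma cauchy {x y R p q K : ℝ} (h : x ^ 2 + y ^ 2 ≤ R ^ 2) (hK : 0 ≤ K)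
    (hpq : (p ^ 2 + q ^ 2) * R ^ 2 ≤ K ^ 2) : -K ≤ p * x + q * y ∧ p * x + q * y ≤ K := by
  apply abs_le.1
  apply abs_le_of_sq_le_sq _ hK
  have : (p * x + q * y) ^ 2 ≤ (p ^ 2 + q ^ 2) * (x ^ 2 + y ^ 2) := by
    nlinarith [sq_nonneg (p * y - q * x)]
  have h2 : (p ^ 2 + q ^ 2) * (x ^ 2 + y ^ 2) ≤ (p ^ 2 + q ^ 2) * R ^ 2 := by gcongr
  linarith

lemma scale_err {k k0 e t m : ℝ} (h : |k - k0| ≤ e) (ht : |t| ≤ m) :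
    k0 * t - e * m ≤ k * t ∧ k * t ≤ k0 * t + e * m := by
  have : |(k - k0) * t| ≤ e * m := by
    rw [abs_mul]
    have := (abs_nonneg _).trans h
    gcongr
  have := abs_le.1 this
  constructor <;> nlinarith

/-- The polynomial whose roots are the eigenvalues. -/
def Po {K : Type*} [CommRing K] (x : K) : K := x ^ 4 - x ^ 3 - 2 * x ^ 2 + 2 * x - 1

/-- Numerical data: the eigenvalues. -/
structure Dat where
  r1 : ℝ
  r2 : ℝ
  a : ℝ
  b : ℝ
  p1 : Po r1 = 0
  p2 : Po r2 = 0
  pz : Po (⟨a, b⟩ : ℂ) = 0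
  h1 : |r1 - 1.6902845| ≤ 0.0000001
  h2 : |r2 - (-1.5050684)| ≤ 0.0000001
  ha : |a - 0.407392| ≤ 0.000001
  hb : |b - 0.476565| ≤ 0.000003

lemma exists_dat : Nonempty Dat := by
  have hc : Continuous (fun x : ℝ => Po x) := by unfold Po; fun_prop
  obtain ⟨r1, ⟨hl1, hu1⟩, p1⟩ : (0 : ℝ) ∈ (fun x : ℝ => Po x) '' Set.Icc 1.69028449 1.69028450 := by
    apply intermediate_value_Icc (by norm_num) hc.continuousOn
    constructor <;> norm_num [Po]
  obtain ⟨r2, ⟨hl2, hu2⟩, p2⟩ : (0 : ℝ) ∈ (fun x : ℝ => Po x) ''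
      Set.Icc (-1.50506842) (-1.50506841) := by
    apply intermediate_value_Icc' (by norm_num) hc.continuousOn
    constructor <;> norm_num [Po]
  simp only at p1 p2
  obtain ⟨s, hs⟩ : ∃ s, s = r1 + r2 := ⟨_, rfl⟩
  obtain ⟨t, ht⟩ : ∃ t, t = r1 * r2 := ⟨_, rfl⟩
  obtain ⟨c, hcdef⟩ : ∃ c, c = -2 - t - s * (1 - s) := ⟨_, rfl⟩
  -- remainder
  have q1 : (2 + s * c + t * (1 - s)) * r1 + (-1 - t * c) = 0 := by
    unfold Po at p1
    rw [hcdef, hs, ht]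
    linear_combination p1
  have q2 : (2 + s * c + t * (1 - s)) * r2 + (-1 - t * c) = 0 := by
    unfold Po at p2
    rw [hcdef, hs, ht]
    linear_combination p2
  have hne : r1 - r2 ≠ 0 := by
    have : 0 < r1 - r2 := by norm_num at *; linarith
    exact this.ne'
  have e1 : 2 + s * c + t * (1 - s) = 0 := by
    apply mul_right_cancel₀ hne
    linear_combination q1 - q2
  have e2 : t * c = -1 := by
    rw [e1] at q1; linarith
  have b1 : |r1 - 1.690284495| ≤ 0.000000005 := by
    rw [abs_le]; norm_num at *; constructor <;> linarith
  have b2 : |r2 - (-1.505068415)| ≤ 0.000000005 := by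
    rw [abs_le]; norm_num at *; constructor <;> linarith
  have bt := approx_mul b1 b2
  rw [← ht] at bt
  have bs : |s - 0.18521608| ≤ 0.00000001 := by
    rw [abs_le] at *; norm_num at *; constructor <;> linarith
  have bss := approx_mul bs bs
  have hcl : c = -2 - t - s + s * s := by rw [hcdef]; ring
  have bc : |c - 0.393083| ≤ 0.000001 := by
    rw [abs_le] at bt bss bs ⊢
    norm_num [abs_of_pos, abs_of_neg] at bt bss bs ⊢
    constructor <;> linarith
  clear bt bss q1 q2 hcl b1 b2
  obtain ⟨a, hadef⟩ : ∃ a, a = (1 - s) / 2 := ⟨_, rfl⟩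
  have ba : |a - 0.40739196| ≤ 0.00000001 := by
    rw [abs_le] at bs ⊢; norm_num at bs ⊢; constructor <;> linarith
  have baa := approx_mul ba ba
  have hca : |c - a * a - 0.2271148| ≤ 0.000002 := by
    rw [abs_le] at bc baa ⊢
    norm_num [abs_of_pos, abs_of_neg] at bc baa ⊢
    constructor <;> linarith
  obtain ⟨hcl, hcu⟩ := abs_le.1 hca
  have hpos : 0 ≤ c - a * a := by norm_num at hcl; linarith
  obtain ⟨b, hbdef⟩ : ∃ b, b = Real.sqrt (c - a * a) := ⟨_, rfl⟩
  have hbb : b * b = c - a * a := by rw [hbdef]; exact Real.mul_self_sqrt hpos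
  have bb : |b - 0.476565| ≤ 0.000003 := by
    have u : b ≤ 0.476565 + 0.000003 := by
      rw [hbdef]
      apply Real.sqrt_le_iff.2
      constructor
      · norm_num
      · norm_num at hcu ⊢; linarith
    have l : 0.476565 - 0.000003 ≤ b := by
      rw [hbdef]
      apply Real.le_sqrt_of_sq_le
      norm_num at hcl ⊢; linarith
    rw [abs_le]
    constructor <;> linarith
  have hz : Po (⟨a, b⟩ : ℂ) = 0 := by
    have hq : (⟨a, b⟩ : ℂ) ^ 2 = (1 - s : ℝ) * (⟨a, b⟩ : ℂ) - (c : ℝ) := by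
      have e3 : 1 - s = 2 * a := by rw [hadef]; ring
      rw [e3, pow_two]
      apply Complex.ext
      · simp only [Complex.mul_re, Complex.sub_re, Complex.ofReal_re, Complex.ofReal_im]
        linear_combination - hbb
      · simp only [Complex.mul_im, Complex.sub_im, Complex.ofReal_re, Complex.ofReal_im]
        ring
    generalize (⟨a, b⟩ : ℂ) = z at hq
    have e1' : (2 + s * c + t * (1 - s) : ℂ) = 0 := by exact_mod_cast e1
    have e2' : (t * c : ℂ) = -1 := by exact_mod_cast e2
    have e4 : (c : ℂ) = -2 - t - s * (1 - s) := by exact_mod_cast hcdef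
    push_cast at hq
    unfold Po
    linear_combination (z ^ 2 - s * z + t) * hq - e2' + z * e1' - z ^ 2 * e4
  refine ⟨⟨r1, r2, a, b, p1, p2, hz, ?_, ?_, ?_, bb⟩⟩
  · rw [abs_le]; norm_num at hl1 hu1 ⊢; constructor <;> linarith
  · rw [abs_le]; norm_num at hl2 hu2 ⊢; constructor <;> linarith
  · rw [abs_le] at ba ⊢; norm_num at ba ⊢; constructor <;> linarith
/-- Left eigenvector functional for the eigenvalue `k`. -/
def Lf {K : Type*} [CommRing K] (k : K) (v : Fin 4 → ℤ) : K :=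
  (v 0 : K) + k * (k - 1) * (v 1 : K) + (k - 1) * (v 2 : K) + (k - 1) * (k ^ 2 - 1) * (v 3 : K)

/-- Contribution of a digit. -/
def Dg {K : Type*} [CommRing K] (k : K) (α β : ℤ) : K := (α : K) + (k - 1) * (k ^ 2 - 1) * (β : K)

lemma Lf_step {K : Type*} [CommRing K] {k : K} (hk : Po k = 0) {v v' : Fin 4 → ℤ} {α β : ℤ}
    (h : Step v v' α β) : Lf k v = k * Lf k v' + Dg k α β := by
  obtain ⟨h0, h1, h2, h3⟩ := h
  unfold Po at hk
  unfold Lf Dg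
  rw [h0, h1, h2, h3]
  push_cast
  linear_combination (-(v' 3 : K)) * hk

namespace Dat
variable (D : Dat)

/-- The complex eigenvalue. -/
def z : ℂ := ⟨D.a, D.b⟩

lemma c1 : |D.r1 * (D.r1 - 1) - 1.16678| ≤ 0.00001 ∧ |D.r1 - 1 - 0.69028| ≤ 0.00001 ∧
    |(D.r1 - 1) * (D.r1 ^ 2 - 1) - 1.2819| ≤ 0.00001 := by
  have h1 := D.h1
  have h2 : |D.r1 - 1 - 0.6902845| ≤ 0.0000001 := by
    rw [abs_le] at *; norm_num at *; constructor <;> linarith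
  have h3 := approx_mul h1 h2
  have h4 := approx_mul h2 h2
  have h5 : |D.r1 + 1 - 2.6902845| ≤ 0.0000001 := by
    rw [abs_le] at *; norm_num at *; constructor <;> linarith
  have h6 := approx_mul h4 h5
  have e : (D.r1 - 1) * (D.r1 ^ 2 - 1) = (D.r1 - 1) * (D.r1 - 1) * (D.r1 + 1) := by ring
  rw [e]
  refine ⟨?_, ?_, ?_⟩
  · rw [abs_le] at h3 ⊢; norm_num [abs_of_pos, abs_of_neg] at h3 ⊢; constructor <;> linarith
  · rw [abs_le] at h2 ⊢; norm_num [abs_of_pos, abs_of_neg] at h2 ⊢; constructor <;> linarith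
  · rw [abs_le] at h6 ⊢; norm_num [abs_of_pos, abs_of_neg] at h6 ⊢; constructor <;> linarith

lemma c2 : |D.r2 * (D.r2 - 1) - 3.7703| ≤ 0.00001 ∧ |D.r2 - 1 - (-2.50507)| ≤ 0.00001 ∧
    |(D.r2 - 1) * (D.r2 ^ 2 - 1) - (-3.16949)| ≤ 0.00001 := by
  have h1 := D.h2
  have h2 : |D.r2 - 1 - (-2.5050684)| ≤ 0.0000001 := by
    rw [abs_le] at *; norm_num at *; constructor <;> linarith
  have h3 := approx_mul h1 h2
  have h4 := approx_mul h2 h2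
  have h5 : |D.r2 + 1 - (-0.5050684)| ≤ 0.0000001 := by
    rw [abs_le] at *; norm_num at *; constructor <;> linarith
  have h6 := approx_mul h4 h5
  have e : (D.r2 - 1) * (D.r2 ^ 2 - 1) = (D.r2 - 1) * (D.r2 - 1) * (D.r2 + 1) := by ring
  rw [e]
  refine ⟨?_, ?_, ?_⟩
  · rw [abs_le] at h3 ⊢; norm_num [abs_of_pos, abs_of_neg] at h3 ⊢; constructor <;> linarith
  · rw [abs_le] at h2 ⊢; norm_num [abs_of_pos, abs_of_neg] at h2 ⊢; constructor <;> linarith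
  · rw [abs_le] at h6 ⊢; norm_num [abs_of_pos, abs_of_neg] at h6 ⊢; constructor <;> linarith

lemma cz1 : |(D.z * (D.z - 1)).re - (-0.46854)| ≤ 0.00002 ∧ |(D.z * (D.z - 1)).im - (-0.08827)| ≤ 0.00002 := by
  have ha := D.ha
  have hb := D.hb
  have haa := approx_mul ha ha
  have hab := approx_mul ha hb
  have hbb := approx_mul hb hb
  have e1 : (D.z * (D.z - 1)).re = D.a * D.a - D.b * D.b - D.a := by
    simp [z]; ring
  have e2 : (D.z * (D.z - 1)).im = 2 * (D.a * D.b) - D.b := by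
    simp [z]; ring
  rw [e1, e2]
  simp only [abs_le] at ha hb haa hab hbb ⊢
  norm_num [abs_of_pos, abs_of_neg] at ha hb haa hab hbb ⊢
  refine ⟨⟨?_, ?_⟩, ?_, ?_⟩ <;> linarith

lemma cz2 : |(D.z - 1).re - (-0.59261)| ≤ 0.00002 ∧ |(D.z - 1).im - 0.47657| ≤ 0.00002 := by
  have ha := D.ha
  have hb := D.hb
  have e1 : (D.z - 1).re = D.a - 1 := by simp [z]
  have e2 : (D.z - 1).im = D.b := by simp [z]
  rw [e1, e2]
  simp only [abs_le] at ha hb ⊢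
  norm_num [abs_of_pos, abs_of_neg] at ha hb ⊢
  refine ⟨⟨?_, ?_⟩, ?_, ?_⟩ <;> linarith

lemma cz3 : |((D.z - 1) * (D.z ^ 2 - 1)).re - 0.44379| ≤ 0.00003 ∧
    |((D.z - 1) * (D.z ^ 2 - 1)).im - (-0.73581)| ≤ 0.00003 := by
  have ha := D.ha
  have hb := D.hb
  have ha1 : |D.a - 1 - (-0.592608)| ≤ 0.000001 := by
    rw [abs_le] at ha ⊢; norm_num at ha ⊢; constructor <;> linarith
  have haa := approx_mul ha ha
  have hab := approx_mul ha hb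
  have hbb := approx_mul hb hb
  have hX : |D.a * D.a - D.b * D.b - 1 - (-1.061146)| ≤ 0.000006 := by
    rw [abs_le] at haa hbb ⊢; norm_num [abs_of_pos, abs_of_neg] at haa hbb ⊢
    constructor <;> linarith
  have hY : |2 * (D.a * D.b) - 0.388297| ≤ 0.000006 := by
    rw [abs_le] at hab ⊢; norm_num [abs_of_pos, abs_of_neg] at hab ⊢
    constructor <;> linarith
  have m1 := approx_mul ha1 hX
  have m2 := approx_mul hb hY
  have m3 := approx_mul ha1 hY
  have m4 := approx_mul hb hX
  have e1 : ((D.z - 1) * (D.z ^ 2 - 1)).re = (D.a - 1) * (D.a * D.a - D.b * D.b - 1)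
      - D.b * (2 * (D.a * D.b)) := by
    simp only [z, pow_two, Complex.mul_re, Complex.mul_im, Complex.sub_re, Complex.sub_im,
      Complex.one_re, Complex.one_im]
    ring
  have e2 : ((D.z - 1) * (D.z ^ 2 - 1)).im = (D.a - 1) * (2 * (D.a * D.b))
      + D.b * (D.a * D.a - D.b * D.b - 1) := by
    simp only [z, pow_two, Complex.mul_re, Complex.mul_im, Complex.sub_re, Complex.sub_im,
      Complex.one_re, Complex.one_im]
    ring
  rw [e1, e2]
  clear e1 e2 haa hab hbb hX hY
  simp only [abs_le] at m1 m2 m3 m4 ⊢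
  norm_num [abs_of_pos, abs_of_neg] at m1 m2 m3 m4 ⊢
  refine ⟨⟨?_, ?_⟩, ?_, ?_⟩ <;> linarith

lemma norm_z : ‖D.z‖ ≤ 0.62697 := by
  have haa := approx_mul D.ha D.ha
  have hbb := approx_mul D.hb D.hb
  refine (le_abs_self _).trans (abs_le_of_sq_le_sq ?_ (by norm_num))
  rw [Complex.sq_norm, Complex.normSq_apply]
  simp only [z]
  rw [abs_le] at haa hbb
  norm_num [abs_of_pos, abs_of_neg] at haa hbb ⊢
  linarith

/-- Centers of the discs. -/
noncomputable def cen (n : ℕ) : ℂ :=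
  if n = 0 then ⟨-0.06, 0.13⟩ else if n = 1 then ⟨0.56, 0.19⟩ else
  if n = 3 then ⟨0.65, -0.2⟩ else ⟨0.14, 0.34⟩

/-- Radii of the discs. -/
noncomputable def rad (n : ℕ) : ℝ :=
  if n = 0 then 0.312 else if n = 1 then 0.56 else if n = 3 then 0.555 else 0.357

lemma norm_le_of {u : ℂ} {X Y K : ℝ} (hX : |u.re| ≤ X) (hY : |u.im| ≤ Y) (hK : 0 ≤ K)
    (h : X ^ 2 + Y ^ 2 ≤ K ^ 2) : ‖u‖ ≤ K := by
  refine (le_abs_self _).trans (abs_le_of_sq_le_sq ?_ hK)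
  rw [Complex.sq_norm, Complex.normSq_apply, ← pow_two, ← pow_two]
  have h1 : u.re ^ 2 ≤ X ^ 2 := sq_le_sq' (by linarith [(abs_le.1 hX).1]) (abs_le.1 hX).2
  have h2 : u.im ^ 2 ≤ Y ^ 2 := sq_le_sq' (by linarith [(abs_le.1 hY).1]) (abs_le.1 hY).2
  linarith

lemma disc_step {x y : ℕ} {α β : ℤ} (h : Tr x y α β) :
    ‖D.z * cen y + Dg D.z α β - cen x‖ + 0.62697 * rad y ≤ rad x := by
  have ha := abs_le.1 D.ha
  have hb := abs_le.1 D.hb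
  have h3 := D.cz3
  generalize hl : (D.z - 1) * (D.z ^ 2 - 1) = l3 at h3
  obtain ⟨h3, h3'⟩ := h3
  rw [abs_le] at h3 h3'
  norm_num at ha hb h3 h3'
  unfold Dg
  rw [hl]
  rcases h with ⟨rfl, rfl, rfl, rfl⟩ | ⟨rfl, rfl, rfl, rfl⟩ | ⟨rfl, rfl, rfl, rfl⟩ |
    ⟨rfl, rfl, rfl, rfl⟩ | ⟨rfl, rfl, rfl, rfl⟩ | ⟨rfl, rfl, rfl, rfl⟩ | ⟨rfl, rfl, rfl, rfl⟩
  all_goals rw [← le_sub_iff_add_le]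
  all_goals simp only [cen, rad]
  all_goals norm_num
  · apply norm_le_of (X := 0.026437) (Y := 0.105673) _ _ (by norm_num) (by norm_num) <;>
    · simp only [z, Complex.sub_re, Complex.sub_im, Complex.mul_re, Complex.mul_im]
      rw [abs_le]; constructor <;> linarith
  · apply norm_le_of (X := 0.045037) (Y := 0.075272) _ _ (by norm_num) (by norm_num) <;>
    · simp only [z, Complex.sub_re, Complex.sub_im, Complex.mul_re, Complex.mul_im]
      rw [abs_le]; constructor <;> linarith
  · apply norm_le_of (X := 0.199922) (Y := 0.038329) _ _ (by norm_num) (by norm_num) <;>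
    · simp only [z, Complex.sub_re, Complex.sub_im, Complex.mul_re, Complex.mul_im]
      rw [abs_le]; constructor <;> linarith
  · apply norm_le_of (X := 0.335043) (Y := 0.015272) _ _ (by norm_num) (by norm_num) <;>
    · simp only [z, Complex.sub_re, Complex.sub_im, Complex.mul_re, Complex.mul_im,
        Complex.add_re, Complex.add_im, Complex.one_re, Complex.one_im]
      rw [abs_le]; constructor <;> linarith
  · apply norm_le_of (X := 0.263643) (Y := 0.224407) _ _ (by norm_num) (by norm_num) <;>
    · simp only [z, Complex.sub_re, Complex.sub_im, Complex.mul_re, Complex.mul_im,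
        Complex.add_re, Complex.add_im, Complex.one_re, Complex.one_im]
      rw [abs_le]; constructor <;> linarith
  · apply norm_le_of (X := 0.068653) (Y := 0.191573) _ _ (by norm_num) (by norm_num) <;>
    · simp only [z, Complex.sub_re, Complex.sub_im, Complex.mul_re, Complex.mul_im,
        Complex.add_re, Complex.add_im]
      rw [abs_le]; constructor <;> linarith
  · apply norm_le_of (X := 0.002448) (Y := 0.004321) _ _ (by norm_num) (by norm_num) <;>
    · simp only [z, Complex.sub_re, Complex.sub_im, Complex.mul_re, Complex.mul_im]
      rw [abs_le]; constructor <;> linarith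

lemma disc (x : ℕ) : ‖Lf D.z (psi (pre x)) - cen (w x)‖ ≤ rad (w x) := by
  induction x using Nat.strong_induction_on with
  | _ x ih =>
    rcases Nat.eq_zero_or_pos x with rfl | hx
    · rw [w_zero]
      simp only [pre, Lf, psi, cen, rad]
      simp
      apply norm_le_of (X := 0.06) (Y := 0.13) _ _ (by norm_num) (by norm_num) <;>
        norm_num [abs_of_pos, abs_of_neg]
    · obtain ⟨α, β, hT, hS⟩ := sigma_step x
      have h1 := ih _ (par_lt hx)
      have h2 := D.disc_step hT
      rw [Lf_step (k := D.z) D.pz hS]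
      set S := Lf D.z (psi (pre (par x)))
      have e : D.z * S + Dg D.z α β - cen (w x) =
          D.z * (S - cen (w (par x))) + (D.z * cen (w (par x)) + Dg D.z α β - cen (w x)) := by
        ring
      rw [e]
      refine (norm_add_le _ _).trans ?_
      rw [norm_mul]
      have h3 : ‖D.z‖ * ‖S - cen (w (par x))‖ ≤ 0.62697 * rad (w (par x)) :=
        mul_le_mul D.norm_z h1 (norm_nonneg _) (by norm_num)
      linarith

lemma disc' (x : ℕ) : ‖Lf D.z (psi (pre x)) - ⟨0.42, -0.03⟩‖ ≤ 0.845 := by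
  have h := D.disc x
  have e : Lf D.z (psi (pre x)) - ⟨0.42, -0.03⟩ = (Lf D.z (psi (pre x)) - cen (w x)) +
    (cen (w x) - ⟨0.42, -0.03⟩) := by ring
  rw [e]
  refine (norm_add_le _ _).trans ?_
  have h2 : ‖cen (w x) - ⟨0.42, -0.03⟩‖ ≤ 0.845 - rad (w x) := by
    rcases w_Lt x with h | h | h | h <;> rw [h] <;> simp only [cen, rad] <;> norm_num
    · apply norm_le_of (X := 0.48) (Y := 0.16) _ _ (by norm_num) (by norm_num) <;>
        norm_num [abs_of_pos, abs_of_neg]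
    · apply norm_le_of (X := 0.14) (Y := 0.22) _ _ (by norm_num) (by norm_num) <;>
        norm_num [abs_of_pos, abs_of_neg]
    · apply norm_le_of (X := 0.23) (Y := 0.17) _ _ (by norm_num) (by norm_num) <;>
        norm_num [abs_of_pos, abs_of_neg]
    · apply norm_le_of (X := 0.28) (Y := 0.37) _ _ (by norm_num) (by norm_num) <;>
        norm_num [abs_of_pos, abs_of_neg]
  linarith

/-- Finite check. -/
def chk (a b c d : ℤ) : Bool :=
  (a * a + b * b + c * c + d * d ≤ 39) ||
  (37600 < 10000 * a + 11668 * b + 6903 * c + 12819 * d) ||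
  (10000 * a + 11668 * b + 6903 * c + 12819 * d < -37600) ||
  (173100 < 10000 * a + 37703 * b - 25051 * c - 31695 * d) ||
  (10000 * a + 37703 * b - 25051 * c - 31695 * d < -173100) ||
  (1162810000 < (10000 * a - 4685 * b - 5926 * c + 4438 * d) * (10000 * a - 4685 * b - 5926 * c + 4438 * d)
    + (-883 * b + 4766 * c - 7358 * d) * (-883 * b + 4766 * c - 7358 * d))

/-- The whole finite check. -/
def chkAll : Bool :=
  (List.range 9).all fun a => (List.range 9).all fun b => (List.range 11).all fun c =>
    (List.range 9).all fun d => chk ((a : ℤ) - 4) ((b : ℤ) - 4) ((c : ℤ) - 5) ((d : ℤ) - 4)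

set_option maxRecDepth 100000 in
lemma chkAll_true : chkAll = true := by decide +kernel

lemma chk_of {a b c d : ℤ} (ha : -4 ≤ a ∧ a ≤ 4) (hb : -4 ≤ b ∧ b ≤ 4) (hc : -5 ≤ c ∧ c ≤ 5)
    (hd : -4 ≤ d ∧ d ≤ 4) : chk a b c d = true := by
  have h := chkAll_true
  simp only [chkAll, List.all_eq_true, List.mem_range] at h
  have := h (a + 4).toNat (by omega) (b + 4).toNat (by omega) (c + 5).toNat (by omega)
    (d + 4).toNat (by omega)
  rw [Int.toNat_of_nonneg (by omega), Int.toNat_of_nonneg (by omega),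
    Int.toNat_of_nonneg (by omega), Int.toNat_of_nonneg (by omega)] at this
  simpa using this

lemma Lf_re (v : Fin 4 → ℤ) : (Lf D.z v).re = (v 0 : ℝ) + (D.z * (D.z - 1)).re * (v 1 : ℝ) +
    (D.z - 1).re * (v 2 : ℝ) + ((D.z - 1) * (D.z ^ 2 - 1)).re * (v 3 : ℝ) := by
  unfold Lf
  generalize D.z * (D.z - 1) = u1
  generalize (D.z - 1) * (D.z ^ 2 - 1) = u2
  generalize D.z - 1 = u3
  simp [Complex.mul_re]

lemma Lf_im (v : Fin 4 → ℤ) : (Lf D.z v).im = (D.z * (D.z - 1)).im * (v 1 : ℝ) +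
    (D.z - 1).im * (v 2 : ℝ) + ((D.z - 1) * (D.z ^ 2 - 1)).im * (v 3 : ℝ) := by
  unfold Lf
  generalize D.z * (D.z - 1) = u1
  generalize (D.z - 1) * (D.z ^ 2 - 1) = u2
  generalize D.z - 1 = u3
  simp [Complex.mul_im]

/-- Approximate values of the four functionals. -/
lemma approx (v : Fin 4 → ℤ) (m : ℝ) (h1 : |(v 1 : ℝ)| ≤ m) (h2 : |(v 2 : ℝ)| ≤ m)
    (h3 : |(v 3 : ℝ)| ≤ m) :
    |Lf D.r1 v - (v 0 + 1.16678 * v 1 + 0.69028 * v 2 + 1.2819 * v 3)| ≤ 0.00003 * m ∧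
    |Lf D.r2 v - (v 0 + 3.7703 * v 1 - 2.50507 * v 2 - 3.16949 * v 3)| ≤ 0.00003 * m ∧
    |(Lf D.z v).re - (v 0 - 0.46854 * v 1 - 0.59261 * v 2 + 0.44379 * v 3)| ≤ 0.00007 * m ∧
    |(Lf D.z v).im - (-0.08827 * v 1 + 0.47657 * v 2 - 0.73581 * v 3)| ≤ 0.00007 * m := by
  refine ⟨?_, ?_, ?_, ?_⟩
  · have a1 := scale_err D.c1.1 h1
    have a2 := scale_err D.c1.2.1 h2
    have a3 := scale_err D.c1.2.2 h3
    unfold Lf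
    norm_num at a1 a2 a3 ⊢
    rw [abs_le]; constructor <;> linarith
  · have a1 := scale_err D.c2.1 h1
    have a2 := scale_err D.c2.2.1 h2
    have a3 := scale_err D.c2.2.2 h3
    unfold Lf
    norm_num at a1 a2 a3 ⊢
    rw [abs_le]; constructor <;> linarith
  · have a1 := scale_err D.cz1.1 h1
    have a2 := scale_err D.cz2.1 h2
    have a3 := scale_err D.cz3.1 h3
    rw [Lf_re]
    generalize (D.z * (D.z - 1)).re = u1 at *
    generalize (D.z - 1).re = u2 at *
    generalize ((D.z - 1) * (D.z ^ 2 - 1)).re = u3 at *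
    norm_num at a1 a2 a3 ⊢
    rw [abs_le]; constructor <;> linarith
  · have a1 := scale_err D.cz1.2 h1
    have a2 := scale_err D.cz2.2 h2
    have a3 := scale_err D.cz3.2 h3
    rw [Lf_im]
    generalize (D.z * (D.z - 1)).im = u1 at *
    generalize (D.z - 1).im = u2 at *
    generalize ((D.z - 1) * (D.z ^ 2 - 1)).im = u3 at *
    norm_num at a1 a2 a3 ⊢
    rw [abs_le]; constructor <;> linarith

lemma exists_max (a b c d : ℝ) : ∃ m, |a| ≤ m ∧ |b| ≤ m ∧ |c| ≤ m ∧ |d| ≤ m ∧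
    ∀ K, |a| ≤ K → |b| ≤ K → |c| ≤ K → |d| ≤ K → m ≤ K := by
  refine ⟨max (max |a| |b|) (max |c| |d|), by simp, by simp, by simp, by simp, ?_⟩
  intro K h1 h2 h3 h4
  simp [*]

lemma real_bound {a b c d m l1 l2 x y : ℝ}
    (ha : |a| ≤ m) (hb : |b| ≤ m) (hc : |c| ≤ m) (hd : |d| ≤ m)
    (h1 : |l1 - (a + 1.16678 * b + 0.69028 * c + 1.2819 * d)| ≤ 0.00003 * m)
    (h2 : |l2 - (a + 3.7703 * b - 2.50507 * c - 3.16949 * d)| ≤ 0.00003 * m)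
    (h3 : |x - (a - 0.46854 * b - 0.59261 * c + 0.44379 * d)| ≤ 0.00007 * m)
    (h4 : |y - (-0.08827 * b + 0.47657 * c - 0.73581 * d)| ≤ 0.00007 * m)
    (hl1 : |l1| ≤ 3.75) (hl2 : |l2| ≤ 17.3) (hxy : x ^ 2 + y ^ 2 ≤ 3.4 ^ 2) :
    |a| ≤ 4.95 + 0.001 * m ∧ |b| ≤ 4.82 + 0.001 * m ∧ |c| ≤ 5.92 + 0.001 * m ∧
    |d| ≤ 4.67 + 0.001 * m := by
  have k0 := cauchy (p := 0.725775) (q := 0.720927) (K := 3.4783) hxy (by norm_num) (by norm_num)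
  have k1 := cauchy (p := -0.403688) (q := -0.27372) (K := 1.6584) hxy (by norm_num) (by norm_num)
  have k2 := cauchy (p := -0.208373) (q := 0.853979) (K := 2.9888) hxy (by norm_num) (by norm_num)
  have k3 := cauchy (p := -0.086531) (q := -0.773107) (K := 2.6451) hxy (by norm_num) (by norm_num)
  clear hxy
  rw [abs_le] at ha hb hc hd h1 h2 h3 h4 hl1 hl2
  norm_num at ha hb hc hd h1 h2 h3 h4 hl1 hl2 k0 k1 k2 k3
  refine ⟨?_, ?_, ?_, ?_⟩
  · clear k1 k2 k3; rw [abs_le]; norm_num; constructor <;> linarith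
  · clear k0 k2 k3; rw [abs_le]; norm_num; constructor <;> linarith
  · clear k1 k0 k3; rw [abs_le]; norm_num; constructor <;> linarith
  · clear k1 k2 k0; rw [abs_le]; norm_num; constructor <;> linarith

lemma int_of {n k : ℤ} {e : ℝ} (h : |(n : ℝ)| ≤ e) (he : e < k + 1) : -k ≤ n ∧ n ≤ k := by
  have h1 := abs_le.1 h
  have h2 : (n : ℝ) < ((k + 1 : ℤ) : ℝ) := by push_cast; linarith
  have h3 : ((-(k + 1) : ℤ) : ℝ) < (n : ℝ) := by push_cast; linarith
  have h2 := Int.cast_lt.1 h2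
  have h3 := Int.cast_lt.1 h3
  omega

lemma final (v : Fin 4 → ℤ) (hl1 : |Lf D.r1 v| ≤ 3.75) (hl2 : |Lf D.r2 v| ≤ 17.3)
    (hz : ‖Lf D.z v‖ ≤ 3.4) : v 0 * v 0 + v 1 * v 1 + v 2 * v 2 + v 3 * v 3 ≤ 39 := by
  have hxy : (Lf D.z v).re ^ 2 + (Lf D.z v).im ^ 2 ≤ 3.4 ^ 2 := by
    have : ‖Lf D.z v‖ ^ 2 ≤ 3.4 ^ 2 := by gcongr
    rw [Complex.sq_norm, Complex.normSq_apply] at this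
    linarith
  obtain ⟨m, m0, m1, m2, m3, hm⟩ := exists_max (v 0) (v 1) (v 2) (v 3)
  obtain ⟨a1, a2, a3, a4⟩ := D.approx v m m1 m2 m3
  generalize Lf D.r1 v = l1 at *
  generalize Lf D.r2 v = l2 at *
  generalize (Lf D.z v).re = x at *
  generalize (Lf D.z v).im = y at *
  obtain ⟨b0, b1, b2, b3⟩ := real_bound m0 m1 m2 m3 a1 a2 a3 a4 hl1 hl2 hxy
  have hm6 : m < 6 := by
    have := hm (5.92 + 0.001 * m) (by linarith) (by linarith) (by linarith) (by linarith)
    norm_num at this; linarith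
  have i0 := int_of (k := 4) b0 (by norm_num; linarith)
  have i1 := int_of (k := 4) b1 (by norm_num; linarith)
  have i2 := int_of (k := 5) b2 (by norm_num; linarith)
  have i3 := int_of (k := 4) b3 (by norm_num; linarith)
  have hchk := chk_of i0 i1 i2 i3
  simp only [chk, Bool.or_eq_true, decide_eq_true_eq] at hchk
  have n0 := abs_le.1 m0
  have n1 := abs_le.1 m1
  have n2 := abs_le.1 m2
  have n3 := abs_le.1 m3
  rw [abs_le] at a1 a2 a3 a4 hl1 hl2
  norm_num at a1 a2 a3 a4 hl1 hl2
  rcases hchk with ((((h | h) | h) | h) | h) | h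
  · exact h
  · exfalso
    have h' : ((37600 : ℤ) : ℝ) < ((10000 * v 0 + 11668 * v 1 + 6903 * v 2 + 12819 * v 3 : ℤ) : ℝ) :=
      Int.cast_lt.2 h
    push_cast at h'
    linarith
  · exfalso
    have h' : ((10000 * v 0 + 11668 * v 1 + 6903 * v 2 + 12819 * v 3 : ℤ) : ℝ) < ((-37600 : ℤ) : ℝ) :=
      Int.cast_lt.2 h
    push_cast at h'
    linarith
  · exfalso
    have h' : ((173100 : ℤ) : ℝ) < ((10000 * v 0 + 37703 * v 1 - 25051 * v 2 - 31695 * v 3 : ℤ) : ℝ) :=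
      Int.cast_lt.2 h
    push_cast at h'
    linarith
  · exfalso
    have h' : ((10000 * v 0 + 37703 * v 1 - 25051 * v 2 - 31695 * v 3 : ℤ) : ℝ) < ((-173100 : ℤ) : ℝ) :=
      Int.cast_lt.2 h
    push_cast at h'
    linarith
  · exfalso
    have h' := (Int.cast_lt (R := ℝ)).2 h
    push_cast at h'
    obtain ⟨X, hX⟩ : ∃ X : ℝ, X = 10000 * v 0 - 4685 * v 1 - 5926 * v 2 + 4438 * v 3 := ⟨_, rfl⟩
    obtain ⟨Y, hY⟩ : ∃ Y : ℝ, Y = -883 * v 1 + 4766 * v 2 - 7358 * v 3 := ⟨_, rfl⟩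
    rw [← hX, ← hY] at h'
    have eX : |X - 10000 * x| ≤ 20 := by rw [abs_le]; constructor <;> linarith
    have eY : |Y - 10000 * y| ≤ 20 := by rw [abs_le]; constructor <;> linarith
    have cx := cauchy (p := 1) (q := 0) (K := 3.4) hxy (by norm_num) (by norm_num)
    have cy := cauchy (p := 0) (q := 1) (K := 3.4) hxy (by norm_num) (by norm_num)
    obtain ⟨s, hs⟩ : ∃ s, s = X - 10000 * x := ⟨_, rfl⟩
    obtain ⟨t, ht⟩ : ∃ t, t = Y - 10000 * y := ⟨_, rfl⟩
    rw [← hs] at eX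
    rw [← ht] at eY
    have q1 : |s * x| ≤ 20 * 3.4 := by
      rw [abs_mul]
      have : |x| ≤ 3.4 := by rw [abs_le]; constructor <;> linarith
      gcongr
    have q2 : |t * y| ≤ 20 * 3.4 := by
      rw [abs_mul]
      have : |y| ≤ 3.4 := by rw [abs_le]; constructor <;> linarith
      gcongr
    have q3 : s ^ 2 ≤ 20 ^ 2 := sq_le_sq' (abs_le.1 eX).1 (abs_le.1 eX).2
    have q4 : t ^ 2 ≤ 20 ^ 2 := sq_le_sq' (abs_le.1 eY).1 (abs_le.1 eY).2
    have hX' : X = 10000 * x + s := by linarith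
    have hY' : Y = 10000 * y + t := by linarith
    have q1 := (abs_le.1 q1).2
    have q2 := (abs_le.1 q2).2
    rw [hX', hY'] at h'
    have e : (10000 * x + s) * (10000 * x + s) + (10000 * y + t) * (10000 * y + t) =
      100000000 * (x ^ 2 + y ^ 2) + 20000 * (s * x) + 20000 * (t * y) + s ^ 2 + t ^ 2 := by ring
    rw [e] at h'
    norm_num at hxy q1 q2 q3 q4
    linarith

lemma start (v : Fin 4 → ℤ) (s1 : v 0 + v 1 + v 2 + v 3 = 0) (s2 : v 1 + 3 * v 2 + 4 * v 3 = 0)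
    (hz : ‖Lf D.z v‖ ≤ 3.4) : |Lf D.r1 v| ≤ 3.75 ∧ |Lf D.r2 v| ≤ 17.3 := by
  have hxy : (Lf D.z v).re ^ 2 + (Lf D.z v).im ^ 2 ≤ 3.4 ^ 2 := by
    have : ‖Lf D.z v‖ ^ 2 ≤ 3.4 ^ 2 := by gcongr
    rw [Complex.sq_norm, Complex.normSq_apply] at this
    linarith
  have s1' : (v 0 + v 1 + v 2 + v 3 : ℝ) = 0 := by exact_mod_cast s1
  have s2' : (v 1 + 3 * v 2 + 4 * v 3 : ℝ) = 0 := by exact_mod_cast s2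
  obtain ⟨m, m0, m1, m2, m3, hm⟩ := exists_max (v 0) (v 1) (v 2) (v 3)
  obtain ⟨a1, a2, a3, a4⟩ := D.approx v m m1 m2 m3
  generalize Lf D.r1 v = l1 at *
  generalize Lf D.r2 v = l2 at *
  generalize (Lf D.z v).re = x at *
  generalize (Lf D.z v).im = y at *
  have k1 := cauchy (p := -0.118668) (q := -0.64237) (K := 2.23) hxy (by norm_num) (by norm_num)
  have k2 := cauchy (p := -3.153651) (q := -3.972015) (K := 17.25) hxy (by norm_num) (by norm_num)
  have k3 := cauchy (p := 0.076256) (q := 1.059517) (K := 3.62) hxy (by norm_num) (by norm_num)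
  have k4 := cauchy (p := 0.147706) (q := -0.560447) (K := 1.98) hxy (by norm_num) (by norm_num)
  have n0 := abs_le.1 m0
  have n1 := abs_le.1 m1
  have n2 := abs_le.1 m2
  have n3 := abs_le.1 m3
  rw [abs_le] at a1 a2 a3 a4
  norm_num at a1 a2 a3 a4 k1 k2 k3 k4
  have w2 : |(v 2 : ℝ)| ≤ 3.62 + 0.001 * m := by
    rw [abs_le]; norm_num; constructor <;> linarith
  have w3 : |(v 3 : ℝ)| ≤ 1.98 + 0.001 * m := by
    rw [abs_le]; norm_num; constructor <;> linarith
  rw [abs_le] at w2 w3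
  norm_num at w2 w3
  have hm' : m ≤ 20 + 0.01 * m := by
    apply hm <;> rw [abs_le] <;> norm_num <;> constructor <;> linarith
  norm_num at hm'
  have hm2 : m ≤ 21 := by linarith
  constructor
  · rw [abs_le]; norm_num; constructor <;> linarith
  · rw [abs_le]; norm_num; constructor <;> linarith

/-- The difference vector. -/
def dv (p q p' q' : ℕ) : Fin 4 → ℤ := fun j =>
  psi (pre q) j - psi (pre p) j - (psi (pre q') j - psi (pre p') j)

lemma Lf_dv {K : Type*} [CommRing K] (k : K) (p q p' q' : ℕ) : Lf k (dv p q p' q') =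
    Lf k (psi (pre q)) - Lf k (psi (pre p)) - (Lf k (psi (pre q')) - Lf k (psi (pre p'))) := by
  simp only [Lf, dv]
  push_cast
  ring

lemma dv_disc (p q p' q' : ℕ) : ‖Lf D.z (dv p q p' q')‖ ≤ 3.4 := by
  rw [Lf_dv]
  have h1 := D.disc' p
  have h2 := D.disc' q
  have h3 := D.disc' p'
  have h4 := D.disc' q'
  set g : ℂ := ⟨0.42, -0.03⟩
  generalize Lf D.z (psi (pre p)) = P at *
  generalize Lf D.z (psi (pre q)) = Q at *
  generalize Lf D.z (psi (pre p')) = P' at *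
  generalize Lf D.z (psi (pre q')) = Q' at *
  have e : Q - P - (Q' - P') = ((Q - g) - (P - g)) - ((Q' - g) - (P' - g)) := by ring
  rw [e]
  have t1 := norm_sub_le ((Q - g) - (P - g)) ((Q' - g) - (P' - g))
  have t2 := norm_sub_le (Q - g) (P - g)
  have t3 := norm_sub_le (Q' - g) (P' - g)
  refine t1.trans ?_
  linarith

lemma Dg_bd1 {x y : ℕ} {α β : ℤ} (h : Tr x y α β) : 0 ≤ Dg D.r1 α β ∧ Dg D.r1 α β ≤ 1.282 := by
  have h3 := abs_le.1 D.c1.2.2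
  unfold Dg
  generalize (D.r1 - 1) * (D.r1 ^ 2 - 1) = l at *
  norm_num at h3 ⊢
  rcases h with ⟨rfl, rfl, rfl, rfl⟩ | ⟨rfl, rfl, rfl, rfl⟩ | ⟨rfl, rfl, rfl, rfl⟩ |
    ⟨rfl, rfl, rfl, rfl⟩ | ⟨rfl, rfl, rfl, rfl⟩ | ⟨rfl, rfl, rfl, rfl⟩ | ⟨rfl, rfl, rfl, rfl⟩ <;>
  · push_cast; constructor <;> linarith

lemma Dg_bd2 {x y : ℕ} {α β : ℤ} (h : Tr x y α β) : -3.17 ≤ Dg D.r2 α β ∧ Dg D.r2 α β ≤ 1 := by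
  have h3 := abs_le.1 D.c2.2.2
  unfold Dg
  generalize (D.r2 - 1) * (D.r2 ^ 2 - 1) = l at *
  norm_num at h3 ⊢
  rcases h with ⟨rfl, rfl, rfl, rfl⟩ | ⟨rfl, rfl, rfl, rfl⟩ | ⟨rfl, rfl, rfl, rfl⟩ |
    ⟨rfl, rfl, rfl, rfl⟩ | ⟨rfl, rfl, rfl, rfl⟩ | ⟨rfl, rfl, rfl, rfl⟩ | ⟨rfl, rfl, rfl, rfl⟩ <;>
  · push_cast; constructor <;> linarith

lemma step_bd (p q p' q' : ℕ) (h1 : |Lf D.r1 (dv p q p' q')| ≤ 3.75)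
    (h2 : |Lf D.r2 (dv p q p' q')| ≤ 17.3) :
    |Lf D.r1 (dv (par p) (par q) (par p') (par q'))| ≤ 3.75 ∧
    |Lf D.r2 (dv (par p) (par q) (par p') (par q'))| ≤ 17.3 := by
  simp only [Lf_dv] at h1 h2 ⊢
  obtain ⟨α1, β1, T1, S1⟩ := sigma_step p
  obtain ⟨α2, β2, T2, S2⟩ := sigma_step q
  obtain ⟨α3, β3, T3, S3⟩ := sigma_step p'
  obtain ⟨α4, β4, T4, S4⟩ := sigma_step q'
  constructor
  · rw [Lf_step D.p1 S1, Lf_step D.p1 S2, Lf_step D.p1 S3, Lf_step D.p1 S4] at h1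
    have b1 := D.Dg_bd1 T1
    have b2 := D.Dg_bd1 T2
    have b3 := D.Dg_bd1 T3
    have b4 := D.Dg_bd1 T4
    have hr := abs_le.1 D.h1
    set U := Lf D.r1 (psi (pre (par q))) - Lf D.r1 (psi (pre (par p))) -
      (Lf D.r1 (psi (pre (par q'))) - Lf D.r1 (psi (pre (par p')))) with hU
    have hk : |D.r1 * U| ≤ 6.32 := by
      have e : D.r1 * U = D.r1 * Lf D.r1 (psi (pre (par q))) - D.r1 * Lf D.r1 (psi (pre (par p))) -
        (D.r1 * Lf D.r1 (psi (pre (par q'))) - D.r1 * Lf D.r1 (psi (pre (par p')))) := by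
        rw [hU]; ring
      rw [e]
      rw [abs_le] at h1 ⊢
      norm_num at h1 b1 b2 b3 b4 ⊢
      constructor <;> linarith
    rw [abs_mul] at hk
    have hr2 : 1.69 ≤ |D.r1| := by
      rw [le_abs]; left; norm_num at hr ⊢; linarith
    have : 1.69 * |U| ≤ |D.r1| * |U| := by gcongr
    norm_num at this hk ⊢
    linarith
  · rw [Lf_step D.p2 S1, Lf_step D.p2 S2, Lf_step D.p2 S3, Lf_step D.p2 S4] at h2
    have b1 := D.Dg_bd2 T1
    have b2 := D.Dg_bd2 T2
    have b3 := D.Dg_bd2 T3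
    have b4 := D.Dg_bd2 T4
    have hr := abs_le.1 D.h2
    set U := Lf D.r2 (psi (pre (par q))) - Lf D.r2 (psi (pre (par p))) -
      (Lf D.r2 (psi (pre (par q'))) - Lf D.r2 (psi (pre (par p')))) with hU
    have hk : |D.r2 * U| ≤ 25.64 := by
      have e : D.r2 * U = D.r2 * Lf D.r2 (psi (pre (par q))) - D.r2 * Lf D.r2 (psi (pre (par p))) -
        (D.r2 * Lf D.r2 (psi (pre (par q'))) - D.r2 * Lf D.r2 (psi (pre (par p')))) := by
        rw [hU]; ring
      rw [e]
      rw [abs_le] at h2 ⊢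
      norm_num at h2 b1 b2 b3 b4 ⊢
      constructor <;> linarith
    rw [abs_mul] at hk
    have hr2 : 1.505 ≤ |D.r2| := by
      rw [le_abs]; right; norm_num at hr ⊢; linarith
    have : 1.505 * |U| ≤ |D.r2| * |U| := by gcongr
    norm_num at this hk ⊢
    linarith

lemma all_bd (p q p' q' : ℕ)
    (s1 : dv p q p' q' 0 + dv p q p' q' 1 + dv p q p' q' 2 + dv p q p' q' 3 = 0)
    (s2 : dv p q p' q' 1 + 3 * dv p q p' q' 2 + 4 * dv p q p' q' 3 = 0) (i : ℕ) :
    |Lf D.r1 (dv (par^[i] p) (par^[i] q) (par^[i] p') (par^[i] q'))| ≤ 3.75 ∧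
    |Lf D.r2 (dv (par^[i] p) (par^[i] q) (par^[i] p') (par^[i] q'))| ≤ 17.3 := by
  induction i with
  | zero => exact D.start _ s1 s2 (D.dv_disc _ _ _ _)
  | succ i ih =>
    simp only [Function.iterate_succ_apply' par]
    exact D.step_bd _ _ _ _ ih.1 ih.2

end Dat

end APD

/-- If `b₀ = w[p,q)` and `c₀ = w[p',q')` have the same length and sum,
then every pair of ancestral blocks satisfies `‖ψ(bᵢ) − ψ(cᵢ)‖ ≤ 6.28` in Euclidean norm. -/
theorem ancestral_parikh_difference_bounded (p q p' q' : ℕ) (hpq : p ≤ q) (hpq' : p' ≤ q')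
    (hlen : (factorW p q).length = (factorW p' q').length)
    (hsum : (factorW p q).sum = (factorW p' q').sum) :
    ∀ i : ℕ,
      Real.sqrt (∑ j, ((psi (factorW (par^[i] p) (par^[i] q)) j -
          psi (factorW (par^[i] p') (par^[i] q')) j : ℤ) : ℝ) ^ 2) ≤ 6.28 := by
  intro i
  obtain ⟨D⟩ := APD.exists_dat
  have l1 := APD.len_sum _ (APD.factor_Lt p q)
  have l2 := APD.len_sum _ (APD.factor_Lt p' q')
  rw [hlen, hsum] at l1
  simp only [APD.psi_factor hpq] at l1
  simp only [APD.psi_factor hpq'] at l2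
  have hb := D.all_bd p q p' q' (by simp only [APD.Dat.dv]; linarith [l1.1, l2.1])
    (by simp only [APD.Dat.dv]; linarith [l1.2, l2.2]) i
  have hf := D.final _ hb.1 hb.2 (D.dv_disc _ _ _ _)
  have m1 : par^[i] p ≤ par^[i] q := APD.par_mono.iterate i hpq
  have m2 : par^[i] p' ≤ par^[i] q' := APD.par_mono.iterate i hpq'
  simp only [APD.psi_factor m1, APD.psi_factor m2]
  apply Real.sqrt_le_iff.2
  refine ⟨by norm_num, ?_⟩
  have hf' := (Int.cast_le (R := ℝ)).2 hf
  simp only [APD.Dat.dv] at hf'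
  rw [Fin.sum_univ_four]
  push_cast at hf' ⊢
  norm_num
  linarith
end
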